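/- arXiv:1305.6957 — 4 statements merged into one kernel-verified Lean document; each statement's English description precedes it below -/
import Mathlib

section
/- Let n ≥ 3 and d ≥ 3 be integers. Then every homogeneous form F of degree d in n variables over an algebraically closed field k of characteristic 0 can be written as a sum of at most binom(n+d-2, d-1) − binom(n+d-6, d-3) d-th powers of linear forms; that is, the classical Waring rank of F is at most binom(n+d-2, d-1) − binom(n+d-6, d-3). -/
open MvPolynomial

noncomputable section WaringSetup

variable {k : Type} [Field k] {n : ℕ}

/-- The linear form `∑ aᵢ xᵢ` with coefficient vector `a`. -/
def linForm (a : Fin n → k) : MvPolynomial (Fin n) k :=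
  ∑ i, C (a i) * X i

/-- A subset of the space `S₁` of linear forms (identified with the space of coefficient
vectors) is homogeneous Zariski closed if it is the common zero locus of a set of
homogeneous polynomial functions. -/
def HomZariskiClosed (V : Set (Fin n → k)) : Prop :=
  ∃ P : Set (MvPolynomial (Fin n) k),
    (∀ p ∈ P, ∃ e : ℕ, p.IsHomogeneous e) ∧
    V = {a | ∀ p ∈ P, eval a p = 0}

/-- `F` can be written as a polynomial in `m` linear forms. -/
def WritableIn (m : ℕ) (F : MvPolynomial (Fin n) k) : Prop :=
  ∃ y : Fin m → MvPolynomial (Fin n) k,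
    (∀ j, (y j).IsHomogeneous 1) ∧ ∃ G : MvPolynomial (Fin m) k, F = aeval y G

/-- `F` essentially depends on `n` variables: after any linear change of coordinates it
cannot be written using fewer than `n` variables. -/
def EssDep (F : MvPolynomial (Fin n) k) : Prop :=
  ∀ m : ℕ, m < n → ¬ WritableIn m F

/-- `OrkV d F V` is the minimal number `m` such that `F` is a sum of `m` `d`-th powers of
linear forms lying outside `V` (and `⊤` if there is no such presentation). -/
def OrkV (d : ℕ) (F : MvPolynomial (Fin n) k) (V : Set (Fin n → k)) : ℕ∞ :=
  sInf ((fun m : ℕ => (m : ℕ∞)) ''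
    {m : ℕ | ∃ l : Fin m → (Fin n → k), (∀ i, l i ∉ V) ∧ F = ∑ i, linForm (l i) ^ d})

/-- The open Waring rank of a form `F`: the supremum of `OrkV d F V` over all homogeneous
Zariski-closed proper subsets `V ⊊ S₁`. -/
def Ork (d : ℕ) (F : MvPolynomial (Fin n) k) : ℕ∞ :=
  ⨆ V : {V : Set (Fin n → k) // HomZariskiClosed V ∧ V ≠ Set.univ}, OrkV d F V.1

/-- The open Waring rank `Ork(n, d)`: the supremum of `Ork F` over all forms `F` of degree
`d` essentially depending on `n` variables. -/
def OrkND (k : Type) [Field k] (n d : ℕ) : ℕ∞ :=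
  ⨆ F : {F : MvPolynomial (Fin n) k // F.IsHomogeneous d ∧ EssDep F}, Ork d F.1

/-- Apply the constant-coefficient differential operator `D` (a polynomial, whose variable
`i` is read as `∂/∂xᵢ`) to the polynomial `F`. -/
def contract (D F : MvPolynomial (Fin n) k) : MvPolynomial (Fin n) k :=
  ∑ s ∈ D.support, D.coeff s •
    ((List.finRange n).foldr (fun i G => (fun H => pderiv i H)^[s i] G) F)

/-- Polynomial functions on the affine space of polynomials: the subalgebra of functions
generated by the coefficient functionals. -/
def PolyFun (n : ℕ) (k : Type) [Field k] : Subalgebra k (MvPolynomial (Fin n) k → k) :=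
  Algebra.adjoin k (Set.range fun s : Fin n →₀ ℕ => fun F => coeff s F)

end WaringSetup

noncomputable section WaringProof

namespace WaringProof

/-- The directional derivative, as a bilinear map. -/
def D {k : Type} [Field k] {N : ℕ} :
    (Fin N → k) →ₗ[k] MvPolynomial (Fin N) k →ₗ[k] MvPolynomial (Fin N) k :=
  LinearMap.mk₂ k (fun v F => ∑ i, v i • pderiv i F)
    (by intro a b F; simp [add_smul, Finset.sum_add_distrib])
    (by intro c a F; simp [mul_smul, Finset.smul_sum])
    (by intro a F G; simp [Finset.sum_add_distrib])
    (by intro c a F; simp [Finset.smul_sum, smul_comm c])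

section basics
variable {k : Type} [Field k] {N : ℕ}

lemma D_apply (v : Fin N → k) (F : MvPolynomial (Fin N) k) :
    D v F = ∑ i, v i • pderiv i F := rfl

lemma pderiv_comm' (i j : Fin N) (F : MvPolynomial (Fin N) k) :
    pderiv i (pderiv j F) = pderiv j (pderiv i F) := by
  ext m
  simp only [coeff_pderiv]
  by_cases h : i = j
  · subst h; rfl
  · have h' : j ≠ i := fun e => h e.symm
    rw [add_right_comm m]
    simp [h, h']
    ring

lemma D_comm (u v : Fin N → k) (F : MvPolynomial (Fin N) k) :
    D u (D v F) = D v (D u F) := by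
  simp only [D_apply, map_sum, Derivation.map_smul]
  rw [Finset.sum_comm]
  refine Finset.sum_congr rfl fun i _ => Finset.sum_congr rfl fun j _ => ?_
  rw [pderiv_comm', smul_comm]

lemma D_linForm_pow (v l : Fin N → k) (d : ℕ) :
    D v (linForm l ^ (d + 1)) = (((d : k) + 1) * (l ⬝ᵥ v)) • linForm l ^ d := by
  have h : ∀ i, pderiv i (linForm l) = C (l i) := by
    intro i
    simp [linForm, pderiv_X, Pi.single_apply]
  simp only [D_apply, pderiv_pow, h, dotProduct, Finset.mul_sum, Finset.sum_smul]
  refine Finset.sum_congr rfl fun i _ => ?_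
  simp only [smul_eq_C_mul, map_mul, map_add, map_one, map_natCast, Nat.cast_add, Nat.cast_one,
    Nat.add_sub_cancel]
  ring

lemma linForm_smul (c : k) (l : Fin N → k) : linForm (c • l) = c • linForm l := by
  simp [linForm, Finset.smul_sum, smul_eq_C_mul, mul_assoc]

lemma linForm_homog (l : Fin N → k) : (linForm l).IsHomogeneous 1 := by
  refine IsHomogeneous.sum _ _ _ fun i _ => ?_
  simpa using (isHomogeneous_C (Fin N) (l i)).mul (isHomogeneous_X k i)

lemma linForm_pow_homog (l : Fin N → k) (d : ℕ) : (linForm l ^ d).IsHomogeneous d := by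
  simpa using (linForm_homog l).pow d

lemma smul_homog {F : MvPolynomial (Fin N) k} {d : ℕ} (c : k) (h : F.IsHomogeneous d) :
    (c • F).IsHomogeneous d := (homogeneousSubmodule (Fin N) k d).smul_mem c h

lemma D_homog {F : MvPolynomial (Fin N) k} {d : ℕ} (h : F.IsHomogeneous (d + 1))
    (v : Fin N → k) : (D v F).IsHomogeneous d := by
  rw [D_apply]
  refine IsHomogeneous.sum _ _ _ fun i _ => smul_homog _ ?_
  simpa using h.pderiv (i := i)

lemma D_single (i : Fin N) (F : MvPolynomial (Fin N) k) : D (Pi.single i 1) F = pderiv i F := by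
  rw [D_apply, Finset.sum_eq_single i] <;> simp +contextual

lemma eq_zero_of_D [CharZero k] {F : MvPolynomial (Fin N) k} {d : ℕ} (h : F.IsHomogeneous (d + 1))
    (h0 : ∀ v, D v F = 0) : F = 0 := by
  have e := h.sum_X_mul_pderiv
  have : ∀ i, pderiv i F = 0 := fun i => by rw [← D_single, h0]
  simp only [this, mul_zero, Finset.sum_const_zero] at e
  exact (smul_eq_zero.1 e.symm).resolve_left (Nat.succ_ne_zero d)

lemma deg_one {F : MvPolynomial (Fin N) k} (h : F.IsHomogeneous 1) : ∃ l, F = linForm l := by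
  have e := h.sum_X_mul_pderiv
  have : ∀ i, ∃ c, pderiv i F = C c := fun i => by
    have h1 := h.pderiv (i := i)
    rw [← totalDegree_zero_iff_isHomogeneous, totalDegree_eq_zero_iff_eq_C] at h1
    exact ⟨_, h1⟩
  choose l hl using this
  refine ⟨l, ?_⟩
  rw [one_smul] at e
  rw [← e, linForm]
  exact Finset.sum_congr rfl fun i _ => by rw [hl, mul_comm]

end basics

section rep
variable {k : Type} [Field k] {N : ℕ}

/-- `F` is a sum of at most `b` powers of linear forms from `A`. -/
def Rep (d : ℕ) (A : Set (Fin N → k)) (b : ℕ) (F : MvPolynomial (Fin N) k) : Prop :=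
  ∃ L : List (Fin N → k), L.length ≤ b ∧ (∀ l ∈ L, l ∈ A) ∧
    F = (L.map fun l => linForm l ^ d).sum

lemma Rep.zero (d : ℕ) (A : Set (Fin N → k)) (b : ℕ) : Rep d A b 0 := ⟨[], by simp⟩

lemma Rep.add {d : ℕ} {A : Set (Fin N → k)} {a b : ℕ} {F G : MvPolynomial (Fin N) k}
    (hF : Rep d A a F) (hG : Rep d A b G) : Rep d A (a + b) (F + G) := by
  obtain ⟨L, h1, h2, rfl⟩ := hF
  obtain ⟨M, h3, h4, rfl⟩ := hG
  refine ⟨L ++ M, by simp; omega, ?_, by simp⟩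
  intro l hl
  rcases List.mem_append.1 hl with h | h
  exacts [h2 l h, h4 l h]

lemma Rep.mono {d : ℕ} {A B : Set (Fin N → k)} {a b : ℕ} {F : MvPolynomial (Fin N) k}
    (hF : Rep d A a F) (hAB : A ⊆ B) (hab : a ≤ b) : Rep d B b F := by
  obtain ⟨L, h1, h2, h3⟩ := hF
  exact ⟨L, h1.trans hab, fun l hl => hAB (h2 l hl), h3⟩

/-- Weighted sums are sums of powers, over an algebraically closed field. -/
lemma Rep.weighted [IsAlgClosed k] {d : ℕ} (hd : d ≠ 0) {A : Set (Fin N → k)}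
    (hA : ∀ c : k, c ≠ 0 → ∀ l ∈ A, c • l ∈ A) (L : List (Fin N → k)) (c : (Fin N → k) → k)
    (hL : ∀ l ∈ L, l ∈ A) :
    Rep d A L.length ((L.map fun l => c l • linForm l ^ d).sum) := by
  induction L with
  | nil => exact Rep.zero _ _ _
  | cons l L ih =>
    have h1 := ih fun x hx => hL x (List.mem_cons_of_mem _ hx)
    have h2 : Rep d A 1 (c l • linForm l ^ d) := by
      by_cases hc : c l = 0
      · rw [hc, zero_smul]; exact Rep.zero _ _ _
      · obtain ⟨r, hr⟩ := IsAlgClosed.exists_pow_nat_eq (c l) (Nat.pos_of_ne_zero hd)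
        refine ⟨[r • l], by simp, ?_, ?_⟩
        · intro x hx
          rw [List.mem_singleton.1 hx]
          refine hA r ?_ l (hL l (by simp))
          rintro rfl
          exact hc (by rw [← hr, zero_pow hd])
        · simp [linForm_smul, smul_pow, hr]
    have := h2.add h1
    simpa [add_comm] using this

/-- The admissible linear forms: those vanishing on `K` but on no element of `U`. -/
def Adm (K : Submodule k (Fin N → k)) (U : Finset (Fin N → k)) : Set (Fin N → k) :=
  {l | (∀ w ∈ K, l ⬝ᵥ w = 0) ∧ ∀ u ∈ U, l ⬝ᵥ u ≠ 0}

lemma Adm_smul (K : Submodule k (Fin N → k)) (U : Finset (Fin N → k)) :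
    ∀ c : k, c ≠ 0 → ∀ l ∈ Adm K U, c • l ∈ Adm K U := by
  rintro c hc l ⟨h1, h2⟩
  exact ⟨fun w hw => by simp [h1 w hw], fun u hu => by simp [hc, h2 u hu]⟩

lemma Adm_mono {K K' : Submodule k (Fin N → k)} {U U' : Finset (Fin N → k)}
    (hK : K ≤ K') (hU : U ⊆ U') : Adm K' U' ⊆ Adm K U :=
  fun _ h => ⟨fun w hw => h.1 w (hK hw), fun u hu => h.2 u (hU hu)⟩

/-- The main inductive statement. -/
def P (k : Type) [Field k] (N n d b : ℕ) : Prop :=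
  ∀ F : MvPolynomial (Fin N) k, F.IsHomogeneous d → ∀ K : Submodule k (Fin N → k),
    (∀ w ∈ K, D w F = 0) → N ≤ Module.finrank k K + n → ∀ U : Finset (Fin N → k),
    (∀ u ∈ U, D u F ≠ 0) → Rep d (Adm K U) b F

lemma P_one [CharZero k] (n : ℕ) : P k N n 1 1 := by
  intro F hF K hK _ U hU
  obtain ⟨l, rfl⟩ := deg_one hF
  have key : ∀ w, D w (linForm l) = C (l ⬝ᵥ w) := fun w => by
    have := D_linForm_pow w l 0
    simpa [smul_eq_C_mul] using this
  refine ⟨[l], by simp, ?_, by simp⟩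
  intro x hx
  rw [List.mem_singleton.1 hx]
  refine ⟨fun w hw => ?_, fun u hu h => ?_⟩
  · simpa [key] using hK w hw
  · exact hU u hu (by simp [key, h])

lemma P_zero [CharZero k] (d : ℕ) : P k N 0 (d + 1) 0 := by
  intro F hF K hK hn U hU
  have : K = ⊤ := Submodule.eq_top_of_finrank_eq (le_antisymm (Submodule.finrank_le K)
    (by simpa using hn))
  have : F = 0 := eq_zero_of_D hF fun v => hK v (by simp [this])
  rw [this]; exact Rep.zero _ _ _

lemma exists_avoid [Infinite k] {M : Type*} [AddCommGroup M] [Module k M]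
    (s : Set (Submodule k M)) (hs : s.Finite) (h : ∀ p ∈ s, p ≠ ⊤) : ∃ v, ∀ p ∈ s, v ∉ p := by
  by_contra! hc
  have := Subspace.biUnion_ne_univ_of_top_notMem (s := hs.toFinset) (k := k) (E := M)
    (by simpa using fun h' => h _ h' rfl)
  apply this
  ext v
  simpa using hc v

end rep

section step
variable {k : Type} [Field k] {N : ℕ}

lemma choose_v [CharZero k] {d : ℕ} {F : MvPolynomial (Fin N) k} (hF : F.IsHomogeneous (d + 2))
    (hF0 : F ≠ 0) (s : Set (Submodule k (Fin N → k))) (hs : s.Finite) (h : ∀ p ∈ s, p ≠ ⊤) :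
    ∃ v, (∀ p ∈ s, v ∉ p) ∧ D v (D v F) ≠ 0 := by
  have hker : LinearMap.ker (D.flip F) ≠ ⊤ := by
    intro h
    apply hF0
    refine eq_zero_of_D hF fun v => ?_
    have : v ∈ LinearMap.ker (D.flip F) := by rw [h]; trivial
    simpa using this
  obtain ⟨v0, hv0⟩ := exists_avoid (insert (LinearMap.ker (D.flip F)) s) (hs.insert _)
    (by rintro p (rfl | hp); exacts [hker, h p hp])
  have hv1 : D v0 F ≠ 0 := by
    intro h; exact hv0 _ (Set.mem_insert _ _) (by simpa using h)
  have hv2 : ∀ p ∈ s, v0 ∉ p := fun p hp => hv0 p (Set.mem_insert_of_mem _ hp)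
  by_cases hc : D v0 (D v0 F) = 0
  swap
  · exact ⟨v0, hv2, hc⟩
  obtain ⟨w, hw⟩ : ∃ w, D w (D v0 F) ≠ 0 := by
    by_contra! h
    exact hv1 (eq_zero_of_D (D_homog hF v0) h)
  obtain ⟨m, hm⟩ := MvPolynomial.ne_zero_iff.1 hw
  set a := coeff m (D w (D v0 F)) with ha
  set b := coeff m (D w (D w F)) with hb
  have hfin : ({0} ∪ {t : k | 2 * a + t * b = 0} ∪ ⋃ p ∈ s, {t : k | v0 + t • w ∈ p}).Finite := by
    refine ((Set.finite_singleton _).union ?_).union (hs.biUnion fun p hp => ?_)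
    · refine Set.Subsingleton.finite ?_
      intro x hx y hy
      simp only [Set.mem_ofPred_eq] at hx hy
      by_cases hb0 : b = 0
      · simp [hb0, hm] at hx
      · exact mul_right_cancel₀ hb0 (by linear_combination hx - hy)
    · refine Set.Subsingleton.finite ?_
      intro x hx y hy
      simp only [Set.mem_ofPred_eq] at hx hy
      by_contra hxy
      have h1 : (x - y) • w ∈ p := by
        have := p.sub_mem hx hy
        rwa [add_sub_add_left_eq_sub, ← sub_smul] at this
      have h2 : w ∈ p := (p.smul_mem_iff (sub_ne_zero.2 hxy)).1 h1
      exact hv2 p hp ((p.add_mem_iff_left (p.smul_mem x h2)).1 hx)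
  obtain ⟨t, ht⟩ := hfin.infinite_compl.nonempty
  simp only [Set.mem_compl_iff, Set.mem_union, Set.mem_singleton_iff, Set.mem_ofPred_eq,
    Set.mem_iUnion, not_or, not_exists] at ht
  obtain ⟨⟨t0, t1⟩, t2⟩ := ht
  refine ⟨v0 + t • w, fun p hp => t2 p hp, fun h0 => ?_⟩
  have : coeff m (D (v0 + t • w) (D (v0 + t • w) F)) = t * (2 * a + t * b) := by
    simp only [map_add, LinearMap.add_apply, map_smul, LinearMap.smul_apply, coeff_add, coeff_smul,
      hc, D_comm v0 w, smul_eq_mul, ← ha, ← hb, coeff_zero]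
    ring
  rw [h0, coeff_zero] at this
  exact mul_ne_zero t0 t1 this.symm

lemma mem_sup_span {K : Submodule k (Fin N → k)} {v x : Fin N → k}
    (h : x ∈ K ⊔ Submodule.span k {v}) : ∃ w ∈ K, ∃ c : k, x = w + c • v := by
  obtain ⟨w, hw, y, hy, rfl⟩ := Submodule.mem_sup.1 h
  obtain ⟨c, rfl⟩ := Submodule.mem_span_singleton.1 hy
  exact ⟨w, hw, c, rfl⟩

lemma finrank_sup {K : Submodule k (Fin N → k)} {v : Fin N → k} (hv : v ∉ K) :
    Module.finrank k K + 1 ≤ Module.finrank k (K ⊔ Submodule.span k {v} : Submodule k (Fin N → k)) := by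
  refine Submodule.finrank_lt_finrank_of_lt (lt_of_le_of_ne le_sup_left fun h => hv ?_)
  rw [h]
  exact Submodule.mem_sup_right (Submodule.mem_span_singleton_self v)

/-- The dot product functional. -/
def dotv (u : Fin N → k) : (Fin N → k) →ₗ[k] k :=
  (dotProductBilin k k).flip u

/-- Annihilator of `K` for the dot product. -/
def ann (K : Submodule k (Fin N → k)) : Submodule k (Fin N → k) where
  carrier := {l | ∀ w ∈ K, l ⬝ᵥ w = 0}
  add_mem' := by intro a b ha hb w hw; simp [add_dotProduct, ha w hw, hb w hw]
  zero_mem' := by intro w _; simp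
  smul_mem' := by intro c a ha w hw; simp [ha w hw]

lemma exists_dot (f : (Fin N → k) →ₗ[k] k) : ∃ l : Fin N → k, ∀ v, l ⬝ᵥ v = f v := by
  refine ⟨fun i => f (Pi.single i 1), fun v => ?_⟩
  conv_rhs => rw [pi_eq_sum_univ' v]
  simp [dotProduct, mul_comm]

lemma exists_ann (K : Submodule k (Fin N → k)) {u : Fin N → k} (hu : u ∉ K) :
    ∃ l ∈ ann K, l ⬝ᵥ u ≠ 0 := by
  obtain ⟨f, hf, hK⟩ := Submodule.exists_le_ker_of_notMem hu
  obtain ⟨l, hl⟩ := exists_dot f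
  exact ⟨l, fun w hw => by rw [hl]; exact hK hw, by rwa [hl]⟩

lemma exists_adm [Infinite k] (K : Submodule k (Fin N → k)) (U : Finset (Fin N → k))
    (hU : ∀ u ∈ U, u ∉ K) : ∃ l, l ∈ Adm K U := by
  obtain ⟨l, hl⟩ := exists_avoid (M := ann K)
    ((fun u => LinearMap.ker ((dotv u).comp (ann K).subtype)) '' (U : Set (Fin N → k)))
    (U.finite_toSet.image _) (by
      rintro _ ⟨u, hu, rfl⟩ h
      obtain ⟨l, hl, hl'⟩ := exists_ann K (hU u hu)
      have : (⟨l, hl⟩ : ann K) ∈ LinearMap.ker ((dotv u).comp (ann K).subtype) := by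
        simp only [] at h; rw [h]; trivial
      exact hl' this)
  exact ⟨l, l.2, fun u hu h => hl _ ⟨u, hu, rfl⟩ h⟩

end step

section step2
variable {k : Type} [Field k] {N : ℕ}

lemma slack [IsAlgClosed k] [CharZero k] {n d b : ℕ} (h : P k N n (d + 2) b)
    {G : MvPolynomial (Fin N) k}
    (hG : G.IsHomogeneous (d + 2)) (K : Submodule k (Fin N → k)) (hK : ∀ w ∈ K, D w G = 0)
    (hn : N ≤ Module.finrank k K + n) (U : Finset (Fin N → k)) (hU : ∀ u ∈ U, u ∉ K) :
    Rep (d + 2) (Adm K U) (b + 1) G := by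
  obtain ⟨l, hl⟩ := exists_adm K U hU
  have hl0 : ∀ u ∈ U, linForm l ≠ 0 := by
    intro u hu h0
    have := D_linForm_pow u l 0
    simp [h0] at this
    exact hl.2 u hu ((smul_eq_zero.1 this.symm).resolve_right one_ne_zero)
  have hfin : (⋃ u ∈ U, {c : k | D u (G - c • linForm l ^ (d + 2)) = 0}).Finite := by
    refine U.finite_toSet.biUnion fun u hu => Set.Subsingleton.finite ?_
    intro x hx y hy
    simp only [Set.mem_ofPred_eq, map_sub, map_smul] at hx hy
    have e : (x - y) • D u (linForm l ^ (d + 2)) = 0 := by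
      rw [sub_smul, ← sub_eq_zero.1 hx, ← sub_eq_zero.1 hy, sub_self]
    rcases smul_eq_zero.1 e with e | e
    · exact sub_eq_zero.1 e
    · exfalso
      rw [D_linForm_pow] at e
      rcases smul_eq_zero.1 e with e | e
      · rcases mul_eq_zero.1 e with e | e
        · exact absurd e (by exact_mod_cast Nat.succ_ne_zero (d + 1))
        · exact hl.2 u hu e
      · exact hl0 u hu (pow_eq_zero_iff (Nat.succ_ne_zero d) |>.1 e)
  obtain ⟨c, hc⟩ := hfin.infinite_compl.nonempty
  simp only [Set.mem_compl_iff, Set.mem_iUnion, not_exists, Set.mem_ofPred_eq] at hc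
  have h1 := h (G - c • linForm l ^ (d + 2))
    (hG.sub (smul_homog _ (linForm_pow_homog _ _))) K
    (fun w hw => by rw [map_sub, map_smul, hK w hw, D_linForm_pow, hl.1 w hw]; simp) hn U
    (fun u hu => hc u hu)
  have h2 := Rep.weighted (Nat.succ_ne_zero (d + 1)) (Adm_smul K U) [l] (fun _ => c)
    (by simpa using hl)
  simpa using h1.add h2

lemma D_list_sum (v : Fin N → k) (L : List (Fin N → k)) (f : (Fin N → k) → MvPolynomial (Fin N) k) :
    D v ((L.map f).sum) = (L.map fun l => D v (f l)).sum := by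
  rw [map_list_sum, List.map_map]; rfl

lemma list_sum_homog (d : ℕ) (L : List (Fin N → k)) (c : (Fin N → k) → k) :
    ((L.map fun l => c l • linForm l ^ d).sum).IsHomogeneous d := by
  induction L with
  | nil => simpa using isHomogeneous_zero (Fin N) k d
  | cons l L ih =>
    simp only [List.map_cons, List.sum_cons]
    exact (smul_homog _ (linForm_pow_homog _ _)).add ih

lemma filter_sum (L : List (Fin N → k)) (p : (Fin N → k) → Prop) [DecidablePred p]
    (f : (Fin N → k) → MvPolynomial (Fin N) k) :
    (L.map f).sum = ((L.filter fun l => p l).map f).sum + ((L.filter fun l => ¬ p l).map f).sum := by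
  induction L with
  | nil => simp
  | cons l L ih =>
    by_cases h : p l
    · simp [h, ih, add_assoc]
    · simp [h, ih]; ring

lemma P_step [IsAlgClosed k] [CharZero k] {n d b₁ b₂ : ℕ} (H₁ : P k N (n + 1) (d + 1) b₁)
    (H₂ : P k N n (d + 2) b₂) : P k N (n + 1) (d + 2) (b₁ + b₂) := by
  classical
  intro F hF K hK hn U hU
  by_cases hF0 : F = 0
  · rw [hF0]; exact Rep.zero _ _ _
  have hUK : ∀ u ∈ U, u ∉ K := fun u hu h => hU u hu (hK u h)
  have hker : LinearMap.ker (D.flip F) ≠ ⊤ := by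
    intro h
    apply hF0
    refine eq_zero_of_D hF fun v => ?_
    have : v ∈ LinearMap.ker (D.flip F) := by rw [h]; trivial
    simpa using this
  -- the generic direction
  obtain ⟨v, hv, hvv⟩ := choose_v hF hF0
    ({LinearMap.ker (D.flip F)} ∪ ((fun u => LinearMap.ker (D.flip (D u F))) '' (U : Set (Fin N → k)))
      ∪ {p | (∃ x : (Fin N → k) × (Fin N → k), x ∈ U ×ˢ U ∧
          (K ⊔ Submodule.span k {x.2}) ⊔ Submodule.span k {x.1} = p) ∧ p ≠ ⊤})
    (((Set.finite_singleton _).union (U.finite_toSet.image _)).union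
      (Set.Finite.subset ((U ×ˢ U).finite_toSet.image _) (fun p hp => hp.1)))
    (by
      rintro p ((rfl | ⟨u, hu, rfl⟩) | hp)
      · exact hker
      · intro h
        apply hU u hu
        refine eq_zero_of_D (D_homog hF u) fun v => ?_
        have : v ∈ LinearMap.ker (D.flip (D u F)) := by simp only [] at h; rw [h]; trivial
        simpa using this
      · exact hp.2)
  have hvF : D v F ≠ 0 := by
    intro h
    exact hv _ (Or.inl (Or.inl rfl)) (by simpa using h)
  have hvU : ∀ u ∈ U, D u (D v F) ≠ 0 := by
    intro u hu h
    refine hv _ (Or.inl (Or.inr ⟨u, hu, rfl⟩)) ?_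
    rw [D_comm] at h
    simpa using h
  have hvP : ∀ u ∈ U, ∀ u' ∈ U, (K ⊔ Submodule.span k {u'}) ⊔ Submodule.span k {u} ≠ ⊤ →
      v ∉ (K ⊔ Submodule.span k {u'}) ⊔ Submodule.span k {u} := by
    intro u hu u' hu' h
    exact hv _ (Or.inr ⟨⟨⟨u, u'⟩, by simp [hu, hu'], rfl⟩, h⟩)
  have hvK : v ∉ K := fun h => hvF (hK v h)
  -- represent the derivative
  obtain ⟨L, hL1, hL2, hL3⟩ := H₁ (D v F) (D_homog hF v) K
    (fun w hw => by rw [D_comm, hK w hw, map_zero]) hn (insert v U) (by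
      intro u hu
      rcases Finset.mem_insert.1 hu with rfl | hu
      exacts [hvv, hvU u hu])
  have hLv : ∀ l ∈ L, l ⬝ᵥ v ≠ 0 := fun l hl => (hL2 l hl).2 v (Finset.mem_insert_self _ _)
  have hLA : ∀ l ∈ L, l ∈ Adm K U := fun l hl =>
    Adm_mono le_rfl (Finset.subset_insert _ _) (hL2 l hl)
  set c : (Fin N → k) → k := fun l => ((((d + 1 : ℕ) : k) + 1) * (l ⬝ᵥ v))⁻¹ with hc
  have hd0 : (((d + 1 : ℕ) : k) + 1) ≠ 0 := by exact_mod_cast Nat.succ_ne_zero (d + 1)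
  set f : (Fin N → k) → MvPolynomial (Fin N) k := fun l => c l • linForm l ^ (d + 2) with hf
  set G := F - (L.map f).sum with hG
  have hDf : ∀ w l, D w (f l) = (c l * ((((d + 1 : ℕ) : k) + 1) * (l ⬝ᵥ w))) • linForm l ^ (d + 1) := by
    intro w l
    rw [hf]
    simp only [map_smul]
    rw [D_linForm_pow, smul_smul]
  have hDf0 : ∀ w l, l ⬝ᵥ w = 0 → D w (f l) = 0 := by
    intro w l h; rw [hDf, h]; simp
  have hGhom : G.IsHomogeneous (d + 2) := hF.sub (list_sum_homog _ _ _)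
  have hGv : D v G = 0 := by
    rw [hG, map_sub, D_list_sum, hL3, sub_eq_zero]
    congr 1
    refine List.map_congr_left fun l hl => ?_
    rw [hDf, hc]
    simp only []
    rw [inv_mul_cancel₀ (mul_ne_zero hd0 (hLv l hl)), one_smul]
  have hsum0 : ∀ (M : List (Fin N → k)) w, (∀ l ∈ M, l ⬝ᵥ w = 0) → D w ((M.map f).sum) = 0 := by
    intro M w h
    rw [D_list_sum]
    apply List.sum_eq_zero
    intro x hx
    obtain ⟨l, hl, rfl⟩ := List.mem_map.1 hx
    exact hDf0 w l (h l hl)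
  have hGK : ∀ w ∈ K, D w G = 0 := by
    intro w hw
    rw [hG, map_sub, hK w hw, hsum0 L w fun l hl => (hLA l hl).1 w hw, sub_zero]
  have hkill : ∀ (x : Fin N → k) (H : MvPolynomial (Fin N) k), (∀ w ∈ K, D w H = 0) → D x H = 0 →
      ∀ w ∈ K ⊔ Submodule.span k {x}, D w H = 0 := by
    intro x H h1 h2 w hw
    obtain ⟨y, hy, t, rfl⟩ := mem_sup_span hw
    simp [h1 y hy, h2]
  have hFG : F = (L.map f).sum + G := by rw [hG]; ring
  have hrepL : Rep (d + 2) (Adm K U) b₁ (L.map f).sum :=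
    (Rep.weighted (Nat.succ_ne_zero (d + 1)) (Adm_smul K U) L c hLA).mono le_rfl hL1
  by_cases hG0 : G = 0
  · rw [hFG, hG0]
    exact hrepL.add (Rep.zero _ _ _)
  by_cases hgood : ∀ u ∈ U, D u G ≠ 0
  · rw [hFG]
    refine hrepL.add ((H₂ G hGhom (K ⊔ Submodule.span k {v}) (hkill v G hGK hGv) ?_ U hgood).mono
      (Adm_mono le_sup_left (Finset.Subset.refl _)) le_rfl)
    have := finrank_sup hvK
    omega
  push Not at hgood
  obtain ⟨u₀, hu₀, hGu⟩ := hgood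
  -- `G` is too degenerate: perturb `v`
  have hcont : ¬ (v ∉ K ⊔ Submodule.span k {u₀} ∧ ∃ u ∈ U,
      (K ⊔ Submodule.span k {u₀}) ⊔ Submodule.span k {u} = ⊤) := by
    rintro ⟨h1, u, hu, h2⟩
    apply hG0
    refine eq_zero_of_D hGhom fun x => ?_
    have hGW := hkill u₀ G hGK hGu
    have hv' : v ∈ (K ⊔ Submodule.span k {u₀}) ⊔ Submodule.span k {u} := by rw [h2]; trivial
    have hx' : x ∈ (K ⊔ Submodule.span k {u₀}) ⊔ Submodule.span k {u} := by rw [h2]; trivial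
    obtain ⟨w, hw, a, ha⟩ := mem_sup_span hv'
    obtain ⟨w', hw', a', rfl⟩ := mem_sup_span hx'
    have ha0 : a ≠ 0 := by
      rintro rfl
      exact h1 (by rw [ha]; simpa using hw)
    have hu' : D u G = 0 := by
      have : a • D u G = 0 := by
        have h3 := hGv
        rw [ha] at h3
        simpa [hGW w hw] using h3
      exact (smul_eq_zero.1 this).resolve_left ha0
    simp [hGW w' hw', hu']
  have hvu₀ : v ∉ K ⊔ Submodule.span k {u₀} := by
    by_cases h : (K ⊔ Submodule.span k {u₀}) = ⊤
    · exfalso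
      apply hG0
      refine eq_zero_of_D hGhom fun x => ?_
      exact hkill u₀ G hGK hGu x (by rw [h]; trivial)
    · intro h'
      have e : (K ⊔ Submodule.span k {u₀}) ⊔ Submodule.span k {u₀} = K ⊔ Submodule.span k {u₀} := by
        rw [sup_assoc, sup_idem]
      exact hvP u₀ hu₀ u₀ hu₀ (by rwa [e]) (by rwa [e])
  have hvuu : ∀ u ∈ U, v ∉ (K ⊔ Submodule.span k {u₀}) ⊔ Submodule.span k {u} := fun u hu =>
    hvP u hu u₀ hu₀ fun h => hcont ⟨hvu₀, u, hu, h⟩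
  obtain ⟨l₁, L', rfl⟩ : ∃ l₁ L', L = l₁ :: L' := by
    cases L with
    | nil => exact absurd (by simpa using hL3) hvF
    | cons a b => exact ⟨a, b, rfl⟩
  have hl₁ : l₁ ∈ l₁ :: L' := by simp
  have hl₁u := (hLA l₁ hl₁).2 u₀ hu₀
  set t : k := -(l₁ ⬝ᵥ v) / (l₁ ⬝ᵥ u₀) with ht
  set v' := v + t • u₀ with hv'
  have hl₁v' : l₁ ⬝ᵥ v' = 0 := by
    rw [hv', dotProduct_add, dotProduct_smul, smul_eq_mul, ht, div_mul_cancel₀ _ hl₁u]; ring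
  have hv'K : v' ∉ K := fun h => hvu₀ (by
    have : v = v' + (-t) • u₀ := by rw [hv']; simp
    rw [this]
    exact Submodule.add_mem_sup h (Submodule.smul_mem _ _ (Submodule.mem_span_singleton_self _)))
  have hUv' : ∀ u ∈ U, u ∉ K ⊔ Submodule.span k {v'} := by
    intro u hu h
    obtain ⟨w, hw, s, hs⟩ := mem_sup_span h
    have hs0 : s ≠ 0 := by
      rintro rfl
      exact hUK u hu (by rw [hs]; simpa using hw)
    apply hvuu u hu
    have : v = (-(s⁻¹) • w + (-t) • u₀) + s⁻¹ • u := by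
      rw [hs, smul_add s⁻¹, smul_smul s⁻¹, inv_mul_cancel₀ hs0, one_smul, hv']
      module
    rw [this]
    exact Submodule.add_mem_sup (Submodule.add_mem_sup (K.smul_mem _ hw)
      (Submodule.smul_mem _ _ (Submodule.mem_span_singleton_self _)))
      (Submodule.smul_mem _ _ (Submodule.mem_span_singleton_self _))
  set L₀ := (l₁ :: L').filter fun l => l ⬝ᵥ v' = 0 with hL₀
  set L₁ := (l₁ :: L').filter fun l => ¬ l ⬝ᵥ v' = 0 with hL₁
  have hsplit := filter_sum (l₁ :: L') (fun l => l ⬝ᵥ v' = 0) f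
  rw [← hL₀, ← hL₁] at hsplit
  set G' := G + (L₀.map f).sum with hG'
  have hFG' : F = (L₁.map f).sum + G' := by
    rw [hFG, hsplit, hG']; ring
  have hG'hom : G'.IsHomogeneous (d + 2) := hGhom.add (list_sum_homog _ _ _)
  have hG'K : ∀ w ∈ K, D w G' = 0 := by
    intro w hw
    rw [hG', map_add, hGK w hw, hsum0 L₀ w fun l hl => (hLA l (List.mem_filter.1 hl).1).1 w hw,
      zero_add]
  have hG'v : D v' G' = 0 := by
    rw [hG', map_add, hsum0 L₀ v' fun l hl => by simpa using (List.mem_filter.1 hl).2, add_zero]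
    rw [hv']; simp [hGv, hGu]
  have hlen : L₁.length ≤ L'.length := by
    rw [hL₁, List.filter_cons]
    simp only [hl₁v', not_true_eq_false, decide_false, Bool.false_eq_true, if_false]
    exact List.length_filter_le _ _
  have r1 : Rep (d + 2) (Adm K U) L'.length (L₁.map f).sum :=
    (Rep.weighted (Nat.succ_ne_zero (d + 1)) (Adm_smul K U) L₁ c
      (fun l hl => hLA l (List.mem_filter.1 hl).1)).mono le_rfl hlen
  have r2 := (slack H₂ hG'hom (K ⊔ Submodule.span k {v'}) (hkill v' G' hG'K hG'v)
    (by have := finrank_sup hv'K; omega) U hUv').mono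
      (Adm_mono le_sup_left (Finset.Subset.refl _)) le_rfl
  rw [hFG']
  refine (r1.add r2).mono le_rfl ?_
  simp only [List.length_cons] at hL1
  omega

end step2

section sextic
open Polynomial
variable {k : Type} [Field k]

lemma two_fun {E : Type*} [AddCommGroup E] [Module k E] (f g ψ : E →ₗ[k] k)
    (h : ∀ x, f x = 0 → g x = 0 → ψ x = 0) : ∃ a b : k, ∀ x, ψ x = a * f x + b * g x := by
  have := mem_span_of_iInf_ker_le_ker (L := ![f, g]) (K := ψ) (by
    intro x hx
    simp only [Submodule.mem_iInf, LinearMap.mem_ker] at hx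
    exact h x (hx 0) (hx 1))
  rw [Submodule.mem_span_range_iff_exists_fun] at this
  obtain ⟨c, hc⟩ := this
  refine ⟨c 0, c 1, fun x => ?_⟩
  rw [← hc]; simp [Fin.sum_univ_two]

lemma lin_mem (a b : k) : Polynomial.C a + Polynomial.C b * Polynomial.X ∈ degreeLT k 2 := by
  rw [mem_degreeLT]
  refine lt_of_le_of_lt (b := (1 : WithBot ℕ)) ?_ (by norm_num)
  rw [add_comm]; exact degree_linear_le

lemma mul_mem_degreeLT {p q : k[X]} {a b c : ℕ} (hp : p ∈ degreeLT k (a + 1))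
    (hq : q ∈ degreeLT k (b + 1))
    (hc : a + b < c) : p * q ∈ degreeLT k c := by
  rw [mem_degreeLT] at *
  by_cases hp0 : p = 0
  · simp [hp0]
  by_cases hq0 : q = 0
  · simp [hq0]
  rw [← natDegree_lt_iff_degree_lt hp0] at hp
  rw [← natDegree_lt_iff_degree_lt hq0] at hq
  rw [← natDegree_lt_iff_degree_lt (mul_ne_zero hp0 hq0), natDegree_mul hp0 hq0]
  omega

lemma sextic [IsAlgClosed k] [CharZero k] (φ : k[X] →ₗ[k] k)
    (hφ : ∀ h ∈ degreeLT k 3, (∀ p ∈ degreeLT k 5, φ (h * p) = 0) → h = 0)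
    (B : Set k) (hB : B.Finite) :
    ∃ S : Finset k, S.card ≤ 5 ∧ (∀ t ∈ S, t ∉ B) ∧
      ∃ c : k → k, ∀ p ∈ degreeLT k 7, φ p = ∑ t ∈ S, c t * p.eval t := by
  classical
  set φX : k[X] →ₗ[k] k := φ.comp (LinearMap.mulLeft k Polynomial.X) with hφX
  set G : Submodule k k[X] := degreeLT k 6 ⊓ (LinearMap.ker φ ⊓ LinearMap.ker φX) with hG
  have gen : ∀ ψ : k[X] →ₗ[k] k, (∀ g ∈ G, ψ g = 0) →
      ∃ a b : k, ∀ g ∈ degreeLT k 6, ψ g = φ ((Polynomial.C a + Polynomial.C b * Polynomial.X) * g) := by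
    intro ψ h
    obtain ⟨a, b, hab⟩ := two_fun (E := degreeLT k 6) (φ.comp (Submodule.subtype _))
      (φX.comp (Submodule.subtype _)) (ψ.comp (Submodule.subtype _))
      (fun x h1 h2 => h x ⟨x.2, h1, h2⟩)
    refine ⟨a, b, fun g hg => ?_⟩
    have := hab ⟨g, hg⟩
    simp only [LinearMap.comp_apply, Submodule.subtype_apply, hφX, LinearMap.mulLeft_apply] at this
    rw [this, add_mul, map_add, mul_assoc, ← Polynomial.smul_eq_C_mul, ← Polynomial.smul_eq_C_mul, map_smul, map_smul]
    rfl
  have bpf : ∀ r : k, ∃ g ∈ G, g.eval r ≠ 0 := by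
    intro r
    by_contra! hr
    obtain ⟨a, b, hab⟩ := gen (leval r) hr
    have hlin : (Polynomial.X - Polynomial.C r : k[X]) ∈ degreeLT k 2 := by
      have := lin_mem (-r) 1
      rwa [show Polynomial.C (-r) + Polynomial.C 1 * Polynomial.X = (Polynomial.X - Polynomial.C r : k[X]) by simp; ring] at this
    have h0 : (Polynomial.C a + Polynomial.C b * Polynomial.X) * (Polynomial.X - Polynomial.C r) = 0 := by
      refine hφ _ (mul_mem_degreeLT (a := 1) (b := 1) (lin_mem a b) hlin (by norm_num)) ?_
      intro p hp
      rw [mul_assoc, ← hab _ (mul_mem_degreeLT (a := 1) (b := 4) hlin hp (by norm_num))]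
      simp [leval]
    rcases mul_eq_zero.1 h0 with h | h
    · have h1 := hab 1 (by rw [mem_degreeLT]; simp)
      rw [h] at h1
      simp [leval] at h1
    · exact Polynomial.X_sub_C_ne_zero r h
  have inf : ∃ g ∈ G, g.coeff 5 ≠ 0 := by
    by_contra! hr
    obtain ⟨a, b, hab⟩ := gen (lcoeff k 5) hr
    have h0 : (Polynomial.C a + Polynomial.C b * Polynomial.X) = 0 := by
      refine hφ _ (degreeLT_mono (by norm_num) (lin_mem a b)) ?_
      intro p hp
      rw [← hab _ (degreeLT_mono (by norm_num) hp)]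
      rw [mem_degreeLT] at hp
      exact Polynomial.coeff_eq_zero_of_degree_lt hp
    have h1 := hab (Polynomial.X ^ 5) (by rw [mem_degreeLT]; simp; norm_num)
    rw [h0] at h1
    simp [Polynomial.lcoeff] at h1
  obtain ⟨g₁, hg₁, hg₁5⟩ := inf
  have hg₁0 : g₁ ≠ 0 := by rintro rfl; simp at hg₁5
  obtain ⟨g₂, hg₂⟩ := exists_avoid (M := G)
    ((fun r => LinearMap.ker ((leval r).comp G.subtype)) '' (g₁.roots.toFinset : Set k))
    (g₁.roots.toFinset.finite_toSet.image _) (by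
      rintro _ ⟨r, hr, rfl⟩ h
      obtain ⟨g, hg, hg'⟩ := bpf r
      have : (⟨g, hg⟩ : G) ∈ LinearMap.ker ((leval r).comp G.subtype) := by
        simp only [] at h; rw [h]; trivial
      exact hg' this)
  obtain ⟨g₂, hg₂G⟩ := g₂
  have hcop : ∀ r, g₁.eval r = 0 → g₂.eval r ≠ 0 := by
    intro r hr h
    exact hg₂ _ ⟨r, by simp [hg₁0, hr], rfl⟩ h
  have hcop' : IsCoprime g₁ g₂ := by
    rw [Polynomial.isCoprime_iff_aeval_ne_zero_of_isAlgClosed k k]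
    intro a
    by_cases h : g₁.eval a = 0
    · exact Or.inr (by simpa using hcop a h)
    · exact Or.inl (by simpa using h)
  have hdeg1 : g₁.natDegree ≠ 0 := by
    intro h
    exact hg₁5 (Polynomial.coeff_eq_zero_of_natDegree_lt (by omega))
  set W := derivative g₁ * g₂ - g₁ * derivative g₂ with hW
  have hW0 : W ≠ 0 := by
    intro h
    have h1 : g₁ ∣ derivative g₁ * g₂ := ⟨derivative g₂, sub_eq_zero.1 h⟩
    have h2 : g₁ ∣ derivative g₁ := hcop'.dvd_of_dvd_mul_right h1
    have h3 : derivative g₁ ≠ 0 := by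
      intro h
      exact hdeg1 (by rw [Polynomial.derivative_eq_zero.1 h])
    exact absurd (natDegree_le_of_dvd h2 h3) (not_le.2 (natDegree_derivative_lt hdeg1))
  have sub1 : ∀ a b : k, (a = 0 → b ≠ 0) → {x : k | b + x * a = 0}.Finite := by
    intro a b hab
    refine Set.Subsingleton.finite ?_
    intro x hx y hy
    simp only [Set.mem_ofPred_eq] at hx hy
    by_cases ha : a = 0
    · simp [ha] at hx; exact absurd hx (hab ha)
    · exact mul_right_cancel₀ ha (by linear_combination hx - hy)
  set B' : Set k := B ∪ (W.roots.toFinset : Set k) with hB'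
  have hfin : ({x : k | g₁.coeff 5 + x * g₂.coeff 5 = 0} ∪
      ⋃ r ∈ B', {x : k | g₁.eval r + x * g₂.eval r = 0}).Finite := by
    refine (sub1 _ _ fun _ => hg₁5).union
      ((hB.union (Finset.finite_toSet _)).biUnion fun r _ => sub1 _ _ fun h h' => hcop r h' h)
  obtain ⟨x, hx⟩ := hfin.infinite_compl.nonempty
  simp only [Set.mem_compl_iff, Set.mem_union, Set.mem_ofPred_eq, Set.mem_iUnion, not_or,
    not_exists] at hx
  obtain ⟨hx5, hxB⟩ := hx
  set g := g₁ + x • g₂ with hg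
  have hgG : g ∈ G := G.add_mem hg₁ (G.smul_mem _ hg₂G)
  have hg5 : g.coeff 5 ≠ 0 := by simpa [hg] using hx5
  have hg0 : g ≠ 0 := by intro h; rw [h] at hg5; simp at hg5
  have hgdeg : g.natDegree = 5 := by
    refine le_antisymm ?_ (le_natDegree_of_ne_zero hg5)
    have : g ∈ degreeLT k 6 := hgG.1
    rw [mem_degreeLT, ← natDegree_lt_iff_degree_lt hg0] at this
    omega
  have hroot : ∀ r, g.eval r = 0 → r ∉ B' := by
    intro r hr h
    apply hxB r h
    simpa [hg] using hr
  have hsimple : g.roots.Nodup := by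
    rw [Multiset.nodup_iff_count_le_one]
    intro r
    rw [count_roots]
    by_contra hlt
    push Not at hlt
    have hr := (one_lt_rootMultiplicity_iff_isRoot hg0).1 hlt
    refine hroot r hr.1 (Or.inr ?_)
    have e1 : g₁.eval r + x * g₂.eval r = 0 := by simpa [hg] using hr.1
    have e2 : (derivative g₁).eval r + x * (derivative g₂).eval r = 0 := by
      simpa [hg] using hr.2
    rw [Finset.mem_coe, Multiset.mem_toFinset, mem_roots hW0, IsRoot.def, hW, Polynomial.eval_sub,
      Polynomial.eval_mul, Polynomial.eval_mul]
    linear_combination g₂.eval r * e2 - (derivative g₂).eval r * e1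
  refine ⟨g.roots.toFinset, ?_, ?_, ?_⟩
  · exact (Multiset.toFinset_card_le _).trans ((card_roots' g).trans hgdeg.le)
  · intro t ht hb
    exact hroot t (by simpa [hg0] using ht) (Or.inl hb)
  · have key := mem_span_of_iInf_ker_le_ker (E := degreeLT k 7)
      (L := fun t : g.roots.toFinset => (leval t.1).comp (Submodule.subtype _))
      (K := φ.comp (Submodule.subtype _)) (by
        rintro ⟨p, hp⟩ hx
        simp only [Submodule.mem_iInf, LinearMap.mem_ker, LinearMap.comp_apply,
          Submodule.subtype_apply] at hx ⊢
        by_cases hp0 : p = 0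
        · rw [hp0, map_zero]
        have hdvd : g ∣ p := by
          have h1 := C_leadingCoeff_mul_prod_multiset_X_sub_C (p := g)
            (splits_iff_card_roots.1 (IsAlgClosed.splits g))
          have h2 : (g.roots.map fun a => Polynomial.X - Polynomial.C a).prod ∣ p := by
            rw [Multiset.prod_X_sub_C_dvd_iff_le_roots hp0, Multiset.le_iff_subset hsimple]
            intro r hr
            rw [mem_roots hp0]
            exact hx ⟨r, by simpa using hr⟩
          rw [← h1]
          exact (Polynomial.isUnit_C.2 (isUnit_iff_ne_zero.2 (leadingCoeff_ne_zero.2 hg0))).mul_left_dvd.2 h2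
        obtain ⟨q, rfl⟩ := hdvd
        have hq0 : q ≠ 0 := right_ne_zero_of_mul hp0
        rw [mem_degreeLT, ← natDegree_lt_iff_degree_lt hp0, natDegree_mul hg0 hq0] at hp
        obtain ⟨a, b, rfl⟩ := exists_eq_X_add_C_of_natDegree_le_one (p := q) (by omega)
        have h1 : φ g = 0 := hgG.2.1
        have h2 : φ (Polynomial.X * g) = 0 := hgG.2.2
        rw [show g * (Polynomial.C a * Polynomial.X + Polynomial.C b) = a • (Polynomial.X * g) + b • g by
          rw [Polynomial.smul_eq_C_mul, Polynomial.smul_eq_C_mul]; ring, map_add, map_smul, map_smul, h1, h2]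
        simp)
    rw [Submodule.mem_span_range_iff_exists_fun] at key
    obtain ⟨c, hc⟩ := key
    refine ⟨fun t => if h : t ∈ g.roots.toFinset then c ⟨t, h⟩ else 0, fun p hp => ?_⟩
    have := LinearMap.congr_fun hc ⟨p, hp⟩
    simp only [LinearMap.comp_apply, Submodule.subtype_apply, LinearMap.sum_apply,
      LinearMap.smul_apply, leval_apply, smul_eq_mul] at this
    rw [← this, ← Finset.sum_coe_sort g.roots.toFinset]
    refine Finset.sum_congr rfl fun t _ => ?_
    simp only [dif_pos t.2]

end sextic

section net
open Module
variable {k : Type} [Field k]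

lemma sym_factor [IsAlgClosed k] [CharZero k] (A : Matrix (Fin 3) (Fin 3) k) (hA : A.IsSymm) :
    ∃ E : Matrix (Fin 3) (Fin 3) k, A = E.transpose * E := by
  have : Invertible (2 : k) := invertibleOfNonzero two_ne_zero
  obtain ⟨v, hv⟩ := LinearMap.BilinForm.exists_orthogonal_basis
    (B := Matrix.toBilin' A) (LinearMap.isSymm_def.2 (by
      intro x y
      simp only [Matrix.toBilin'_apply', RingHom.id_apply]
      rw [Matrix.dotProduct_mulVec, dotProduct_comm, ← Matrix.mulVec_transpose, hA.eq]))
  set b : Basis (Fin 3) k (Fin 3 → k) := v.reindex (finCongr (by simp)) with hb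
  have hort : ∀ i j, i ≠ j → b i ⬝ᵥ A.mulVec (b j) = 0 := by
    intro i j hij
    have := hv (i := (finCongr (by simp)).symm i) (j := (finCongr (by simp)).symm j) (by simpa using hij)
    simpa [Function.onFun, Matrix.toBilin'_apply', hb] using this
  set M : Matrix (Fin 3) (Fin 3) k := (Pi.basisFun k (Fin 3)).toMatrix b with hM
  have hM' : ∀ i j, M i j = b j i := by intro i j; simp [hM, Basis.toMatrix_apply]
  choose c hc using fun i => IsAlgClosed.exists_eq_mul_self (b i ⬝ᵥ A.mulVec (b i))
  have hdiag : M.transpose * A * M = Matrix.diagonal c * Matrix.diagonal c := by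
    ext i j
    rw [Matrix.diagonal_mul_diagonal]
    have e : (M.transpose * A * M) i j = b i ⬝ᵥ A.mulVec (b j) := by
      rw [Matrix.dotProduct_mulVec]
      simp only [Matrix.mul_apply, dotProduct, Matrix.vecMul, Matrix.transpose_apply, hM']
    rw [e]
    by_cases h : i = j
    · subst h; rw [Matrix.diagonal_apply_eq, hc]
    · rw [Matrix.diagonal_apply_ne _ h, hort i j h]
  set M' := b.toMatrix (Pi.basisFun k (Fin 3)) with hM2
  have h1 : M * M' = 1 := Basis.toMatrix_mul_toMatrix_flip _ _
  have h2 : M'.transpose * M.transpose = 1 := by rw [← Matrix.transpose_mul, h1, Matrix.transpose_one]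
  refine ⟨Matrix.diagonal c * M', ?_⟩
  calc A = (M'.transpose * M.transpose) * A * (M * M') := by rw [h1, h2, one_mul, mul_one]
    _ = M'.transpose * (M.transpose * A * M) * M' := by simp only [mul_assoc]
    _ = _ := by
      rw [hdiag, Matrix.transpose_mul, Matrix.diagonal_transpose]; simp only [mul_assoc]

variable {V : Type} [AddCommGroup V] [Module k V]

def detB (x : Fin 6 → k) : k :=
  x 0 * x 3 * x 5 - x 0 * x 4 ^ 2 - x 1 ^ 2 * x 5 + 2 * x 1 * x 2 * x 4 - x 3 * x 2 ^ 2

def LB (T : V →ₗ[k] V →ₗ[k] V →ₗ[k] k) (e : Fin 3 → V) : (Fin 6 → k) →ₗ[k] (V →ₗ[k] k) where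
  toFun x := x 0 • T (e 0) (e 0) + (2 * x 1) • T (e 0) (e 1) + (2 * x 2) • T (e 0) (e 2)
    + x 3 • T (e 1) (e 1) + (2 * x 4) • T (e 1) (e 2) + x 5 • T (e 2) (e 2)
  map_add' x y := by simp only [Pi.add_apply, mul_add, add_smul]; abel
  map_smul' c x := by
    simp only [Pi.smul_apply, smul_eq_mul, RingHom.id_apply, smul_add, smul_smul]
    simp only [mul_left_comm]

lemma LB_apply (T : V →ₗ[k] V →ₗ[k] V →ₗ[k] k) (e : Fin 3 → V) (x : Fin 6 → k) :
  LB T e x = x 0 • T (e 0) (e 0) + (2 * x 1) • T (e 0) (e 1) + (2 * x 2) • T (e 0) (e 2)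
    + x 3 • T (e 1) (e 1) + (2 * x 4) • T (e 1) (e 2) + x 5 • T (e 2) (e 2) := rfl

lemma net_of_nonsing [IsAlgClosed k] [CharZero k] (T : V →ₗ[k] V →ₗ[k] V →ₗ[k] k)
    (h12 : ∀ a b, T a b = T b a) (e : Basis (Fin 3) k V) (x : Fin 6 → k)
    (hx : LB T e x = 0) (hd : detB x ≠ 0) :
    ∃ b : Basis (Fin 3) k V, T (b 0) (b 2) = T (b 1) (b 1) := by
  have : Invertible (2 : k) := invertibleOfNonzero two_ne_zero
  obtain ⟨E, hE⟩ := sym_factor !![x 0, x 1, x 2; x 1, x 3, x 4; x 2, x 4, x 5] (by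
    ext i j; fin_cases i <;> fin_cases j <;> rfl)
  have hdE : E.det ≠ 0 := by
    intro h
    apply hd
    have := congrArg Matrix.det hE
    rw [Matrix.det_mul, h, mul_zero, Matrix.det_fin_three] at this
    simp at this
    rw [detB]; linear_combination this
  obtain ⟨i, hi⟩ := IsAlgClosed.exists_pow_nat_eq (-1 : k) (n := 2) (by norm_num)
  have hent : ∀ a b, (!![x 0, x 1, x 2; x 1, x 3, x 4; x 2, x 4, x 5] : Matrix (Fin 3) (Fin 3) k) a b
      = E 0 a * E 0 b + E 1 a * E 1 b + E 2 a * E 2 b := by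
    intro a b; rw [hE, Matrix.mul_apply, Fin.sum_univ_three]; rfl
  have q0 := hent 0 0
  have q1 := hent 0 1
  have q2 := hent 0 2
  have q3 := hent 1 1
  have q4 := hent 1 2
  have q5 := hent 2 2
  simp at q0 q1 q2 q3 q4 q5
  set H : Matrix (Fin 3) (Fin 3) k := Matrix.of ![E 0 + i • E 1, E 2, i • E 1 - E 0] with hH
  have hdH : H.det ≠ 0 := by
    have : H.det = - 2 * i * E.det := by
      rw [Matrix.det_fin_three, Matrix.det_fin_three]; simp [hH]; ring
    rw [this]
    have hi0 : i ≠ 0 := by rintro rfl; norm_num at hi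
    exact mul_ne_zero (mul_ne_zero (by norm_num) hi0) hdE
  set g : Fin 3 → V := fun m => H m 0 • e 0 + H m 1 • e 1 + H m 2 • e 2 with hg
  have hli : LinearIndependent k g := by
    rw [Fintype.linearIndependent_iff]
    intro c hc
    have h0 : Matrix.vecMul c H = 0 := by
      ext j
      have := congrArg (fun v => e.repr v j) hc
      simp [hg, Fin.sum_univ_three] at this
      simp only [Matrix.vecMul, dotProduct, Fin.sum_univ_three, Pi.zero_apply]
      rw [← this]
      fin_cases j <;> simp
    exact fun i => congrFun (Matrix.eq_zero_of_vecMul_eq_zero hdH h0) i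
  have : FiniteDimensional k V := e.finiteDimensional_of_finite
  have hfr : Fintype.card (Fin 3) = finrank k V := by rw [finrank_eq_card_basis e]
  refine ⟨basisOfLinearIndependentOfCardEqFinrank hli hfr, ?_⟩
  simp only [coe_basisOfLinearIndependentOfCardEqFinrank]
  ext w
  have hw := LinearMap.congr_fun hx w
  rw [LB_apply] at hw
  simp only [LinearMap.add_apply, LinearMap.smul_apply, smul_eq_mul, LinearMap.zero_apply] at hw
  simp only [hg, hH, map_add, map_smul, LinearMap.add_apply, LinearMap.smul_apply, smul_eq_mul,
    Matrix.of_apply, Matrix.cons_val]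
  simp only [Pi.add_apply, Pi.sub_apply, Pi.smul_apply, smul_eq_mul]
  rw [h12 (e 1) (e 0), h12 (e 2) (e 0), h12 (e 2) (e 1)]
  rw [q0, q1, q2, q3, q4, q5] at hw
  linear_combination (-1 : k) * hw + (2 * E 1 0 * E 1 1 * T (e 0) (e 1) w
    + 2 * E 1 0 * E 1 2 * T (e 0) (e 2) w + E 1 0 ^ 2 * T (e 0) (e 0) w
    + 2 * E 1 1 * E 1 2 * T (e 1) (e 2) w + E 1 1 ^ 2 * T (e 1) (e 1) w
    + E 1 2 ^ 2 * T (e 2) (e 2) w) * hi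

lemma prod_lin {E : Type*} [AddCommGroup E] [Module k E] (N : Submodule k E) (f g : E →ₗ[k] k)
    (h : ∀ x ∈ N, f x * g x = 0) : (∀ x ∈ N, f x = 0) ∨ (∀ x ∈ N, g x = 0) := by
  by_contra! hc
  obtain ⟨⟨x, hx, hfx⟩, y, hy, hgy⟩ := hc
  have h1 := h x hx
  have h2 := h y hy
  have h3 := h _ (N.add_mem hx hy)
  have gx : g x = 0 := (mul_eq_zero.1 h1).resolve_left hfx
  have fy : f y = 0 := (mul_eq_zero.1 h2).resolve_right hgy
  rw [map_add, map_add, gx, fy, add_zero, zero_add] at h3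
  exact mul_ne_zero hfx hgy h3

lemma span3 (N : Submodule k (Fin 6 → k)) (hN : 3 ≤ finrank k N) (a b c : Fin 6 → k)
    (h : ∀ x ∈ N, ∃ r s t : k, x = r • a + s • b + t • c) : a ∈ N ∧ b ∈ N ∧ c ∈ N := by
  have hle : N ≤ Submodule.span k (Set.range ![a, b, c]) := by
    intro x hx
    obtain ⟨r, s, t, rfl⟩ := h x hx
    rw [Submodule.mem_span_range_iff_exists_fun]
    exact ⟨![r, s, t], by simp [Fin.sum_univ_three]⟩
  have heq := Submodule.eq_of_le_of_finrank_le hle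
    ((finrank_range_le_card (R := k) ![a, b, c]).trans (by simpa using hN))
  rw [heq]
  exact ⟨Submodule.subset_span ⟨0, rfl⟩, Submodule.subset_span ⟨1, rfl⟩,
    Submodule.subset_span ⟨2, rfl⟩⟩

lemma net_case1 [IsAlgClosed k] [CharZero k] (T : V →ₗ[k] V →ₗ[k] V →ₗ[k] k)
    (h12 : ∀ a b, T a b = T b a) (h23 : ∀ a b c, T a b c = T a c b)
    (hnd : ∀ a, (∀ b c, T a b c = 0) → a = 0) (e : Basis (Fin 3) k V)
    (h01 : T (e 0) (e 1) = 0) :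
    ∃ b : Basis (Fin 3) k V, T (b 0) (b 2) = T (b 1) (b 1) := by
  by_contra hcon
  have hsing : ∀ x ∈ LinearMap.ker (LB T e), detB x = 0 := by
    intro x hx
    by_contra h
    exact hcon (net_of_nonsing T h12 e x hx h)
  have : FiniteDimensional k V := e.finiteDimensional_of_finite
  have hfr : finrank k V = 3 := by rw [finrank_eq_card_basis e]; simp
  set N := LinearMap.ker (LB T e) with hN
  have hN3 : 3 ≤ finrank k N := by
    have h1 := LinearMap.finrank_range_add_finrank_ker (LB T e)
    have h2 := Submodule.finrank_le (LinearMap.range (LB T e))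
    have h3 : finrank k (V →ₗ[k] k) = 3 := by
      rw [← hfr]; exact Subspace.dual_finrank_eq
    rw [h3] at h2
    rw [finrank_fin_fun] at h1
    rw [hN]; omega
  have hA0 : ∀ t : k, Pi.single 1 t ∈ N := by
    intro t
    rw [hN, LinearMap.mem_ker, LB_apply]
    simp [h01]
  have hq : ∀ x ∈ N, x 5 = 0 ∧ x 2 * x 4 = 0 := by
    intro x hx
    have d0 := hsing x hx
    have d1 := hsing _ (N.add_mem hx (hA0 1))
    have d2 := hsing _ (N.add_mem hx (hA0 (-1)))
    simp [detB] at d0 d1 d2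
    have z : x 5 = 0 := by
      have : 2 * x 5 = 0 := by linear_combination 2 * d0 - d1 - d2
      simpa using this
    refine ⟨z, ?_⟩
    have : (4 : k) * (x 2 * x 4) = 0 := by linear_combination d1 - d2 + 4 * x 1 * z
    simpa using this
  have hnd' : ∀ a, (∀ i j, T a (e i) (e j) = 0) → a = 0 := by
    intro a h
    apply hnd
    have : T a = 0 := e.ext fun i => e.ext fun j => h i j
    intro b c; rw [this]; rfl
  have smem : ∀ i, Pi.single i 1 ∈ N → LB T e (Pi.single i 1) = 0 := fun i h => h
  have F := fun (i : Fin 6) => (LinearMap.proj i : (Fin 6 → k) →ₗ[k] k)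
  have exp : ∀ x : Fin 6 → k, x = x 0 • Pi.single 0 1 + x 1 • Pi.single 1 1 + x 2 • Pi.single 2 1
      + x 3 • Pi.single 3 1 + x 4 • Pi.single 4 1 + x 5 • Pi.single 5 1 := by
    intro x; ext i; fin_cases i <;> simp
  have fin1 : ∀ i, T (e i) (e 0) = 0 → T (e i) (e 1) = 0 → T (e i) (e 2) = 0 → False := by
    intro i a b c
    apply e.ne_zero i
    apply hnd'
    intro j l
    fin_cases j
    · exact LinearMap.congr_fun a _
    · exact LinearMap.congr_fun b _
    · exact LinearMap.congr_fun c _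
  have fin2 : (∀ x ∈ N, x 2 = 0) → (∀ x ∈ N, x 4 = 0) → False := by
    intro h2 h4
    obtain ⟨a, b, c⟩ := span3 N hN3 (Pi.single 0 1) (Pi.single 1 1) (Pi.single 3 1) (by
      intro x hx
      refine ⟨x 0, x 1, x 3, ?_⟩
      conv_lhs => rw [exp x, h4 x hx, h2 x hx, (hq x hx).1]
      simp)
    have a' := smem _ a
    have c' := smem _ c
    rw [LB_apply] at a' c'
    simp at a' c'
    have h10 : T (e 1) (e 0) = 0 := by rw [h12, h01]
    have t0 : ∀ i j, (i = 2 → j ≠ 2) → T (e 0) (e i) (e j) = 0 := by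
      intro i j h
      fin_cases i
      · exact LinearMap.congr_fun a' _
      · exact LinearMap.congr_fun h01 _
      · rw [h23]
        fin_cases j
        · exact LinearMap.congr_fun a' _
        · exact LinearMap.congr_fun h01 _
        · simp at h
    have t1 : ∀ i j, (i = 2 → j ≠ 2) → T (e 1) (e i) (e j) = 0 := by
      intro i j h
      fin_cases i
      · exact LinearMap.congr_fun h10 _
      · exact LinearMap.congr_fun c' _
      · rw [h23]
        fin_cases j
        · exact LinearMap.congr_fun h10 _
        · exact LinearMap.congr_fun c' _
        · simp at h
    have hv := hnd' (T (e 1) (e 2) (e 2) • e 0 - T (e 0) (e 2) (e 2) • e 1) (by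
      intro i j
      simp only [map_sub, map_smul, LinearMap.sub_apply, LinearMap.smul_apply, smul_eq_mul]
      by_cases h : i = 2 ∧ j = 2
      · rw [h.1, h.2]; ring
      · rw [t0 i j (fun h1 h2 => h ⟨h1, h2⟩), t1 i j (fun h1 h2 => h ⟨h1, h2⟩)]; ring)
    have hv1 := congrArg (fun v => e.repr v 1) hv
    simp at hv1
    apply e.ne_zero 0
    apply hnd'
    intro i j
    by_cases h : i = 2 ∧ j = 2
    · rw [h.1, h.2, hv1]
    · exact t0 i j (fun h1 h2 => h ⟨h1, h2⟩)
  rcases prod_lin N (LinearMap.proj 2) (LinearMap.proj 4) (fun x hx => (hq x hx).2) with h2 | h4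
  · have h2 : ∀ x ∈ N, x 2 = 0 := h2
    rcases prod_lin N (LinearMap.proj 0) (LinearMap.proj 4) (fun x hx => by
      have d0 := hsing x hx
      have : x 0 * x 4 * x 4 = 0 := by
        rw [detB, h2 x hx, (hq x hx).1] at d0
        linear_combination -d0
      simp only [LinearMap.proj_apply]
      rcases mul_eq_zero.1 this with h | h
      · exact h
      · rw [h, mul_zero]) with h0 | h4
    · have h0 : ∀ x ∈ N, x 0 = 0 := h0
      obtain ⟨a, b, c⟩ := span3 N hN3 (Pi.single 1 1) (Pi.single 3 1) (Pi.single 4 1) (by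
        intro x hx
        refine ⟨x 1, x 3, x 4, ?_⟩
        conv_lhs => rw [exp x, h0 x hx, h2 x hx, (hq x hx).1]
        simp)
      have b' := smem _ b
      have c' := smem _ c
      rw [LB_apply] at b' c'
      simp at b' c'
      exact fin1 1 (by rw [h12, h01]) b' c'
    · have h4 : ∀ x ∈ N, x 4 = 0 := h4
      exact fin2 h2 h4
  · have h4 : ∀ x ∈ N, x 4 = 0 := h4
    rcases prod_lin N (LinearMap.proj 3) (LinearMap.proj 2) (fun x hx => by
      have d0 := hsing x hx
      have : x 3 * x 2 * x 2 = 0 := by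
        rw [detB, h4 x hx, (hq x hx).1] at d0
        linear_combination -d0
      simp only [LinearMap.proj_apply]
      rcases mul_eq_zero.1 this with h | h
      · exact h
      · rw [h, mul_zero]) with h3 | h2
    · have h3 : ∀ x ∈ N, x 3 = 0 := h3
      obtain ⟨a, b, c⟩ := span3 N hN3 (Pi.single 0 1) (Pi.single 1 1) (Pi.single 2 1) (by
        intro x hx
        refine ⟨x 0, x 1, x 2, ?_⟩
        conv_lhs => rw [exp x, h3 x hx, h4 x hx, (hq x hx).1]
        simp)
      have a' := smem _ a
      have c' := smem _ c
      rw [LB_apply] at a' c'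
      simp at a' c'
      exact fin1 0 a' h01 c'
    · exact fin2 h2 h4

lemma ext_basis (hfr : finrank k V = 3) (v w : V) (h : LinearIndependent k ![v, w]) :
    ∃ e : Basis (Fin 3) k V, e 0 = v ∧ e 1 = w := by
  obtain ⟨x, hx⟩ := exists_linearIndependent_snoc_of_lt_finrank h (by rw [hfr]; norm_num)
  refine ⟨basisOfLinearIndependentOfCardEqFinrank hx (by simp [hfr]), ?_, ?_⟩
  · rw [coe_basisOfLinearIndependentOfCardEqFinrank]; rfl
  · rw [coe_basisOfLinearIndependentOfCardEqFinrank]; rfl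

lemma net_case2 [IsAlgClosed k] [CharZero k] (T : V →ₗ[k] V →ₗ[k] V →ₗ[k] k)
    (h12 : ∀ a b, T a b = T b a) (h23 : ∀ a b c, T a b c = T a c b)
    (hnd : ∀ a, (∀ b c, T a b c = 0) → a = 0) (e : Basis (Fin 3) k V)
    (h00 : T (e 0) (e 0) = 0) :
    ∃ b : Basis (Fin 3) k V, T (b 0) (b 2) = T (b 1) (b 1) := by
  have : FiniteDimensional k V := e.finiteDimensional_of_finite
  have hfr : finrank k V = 3 := by rw [finrank_eq_card_basis e]; simp
  have c1 : ∀ α β : k, (α ≠ 0 ∨ β ≠ 0) → T (e 0) (α • e 1 + β • e 2) = 0 →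
      ∃ b : Basis (Fin 3) k V, T (b 0) (b 2) = T (b 1) (b 1) := by
    intro α β hαβ h
    obtain ⟨f, h0, h1⟩ := ext_basis hfr (e 0) (α • e 1 + β • e 2) (by
      rw [LinearIndependent.pair_iff]
      intro s t hst
      have g0 := congrArg (fun v => e.repr v 0) hst
      have g1 := congrArg (fun v => e.repr v 1) hst
      have g2 := congrArg (fun v => e.repr v 2) hst
      simp at g0 g1 g2
      refine ⟨g0, ?_⟩
      rcases hαβ with h | h
      · exact g1.resolve_right h
      · exact g2.resolve_right h)
    exact net_case1 T h12 h23 hnd f (by rw [h0, h1, h])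
  have z0 : ∀ v, T (e 0) v (e 0) = 0 := by
    intro v; rw [h23, h00]; rfl
  have z1 : T (e 0) (e 2) (e 1) = T (e 0) (e 1) (e 2) := h23 _ _ _
  by_cases hdet : T (e 0) (e 1) (e 1) * T (e 0) (e 2) (e 2) = T (e 0) (e 1) (e 2) ^ 2
  · by_cases hpq : T (e 0) (e 1) (e 1) = 0 ∧ T (e 0) (e 1) (e 2) = 0
    · refine c1 1 0 (Or.inl one_ne_zero) (e.ext fun i => ?_)
      rw [one_smul, zero_smul, add_zero]
      fin_cases i
      · exact z0 _
      · exact hpq.1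
      · exact hpq.2
    · refine c1 (T (e 0) (e 1) (e 2)) (- T (e 0) (e 1) (e 1)) ?_ (e.ext fun i => ?_)
      · by_contra! h
        exact hpq ⟨neg_eq_zero.1 h.2, h.1⟩
      · simp only [map_add, map_smul, LinearMap.add_apply, LinearMap.smul_apply, smul_eq_mul]
        fin_cases i
        · simp [z0]
        · simp [z1]; ring
        · simp; linear_combination -hdet
  · set p := T (e 0) (e 1) (e 1) with hp
    set q := T (e 0) (e 1) (e 2) with hq
    set r := T (e 0) (e 2) (e 2) with hr
    have swz : ∃ s w z : k, s * p + 2 * w * q + z * r = 0 ∧ s * z - w ^ 2 ≠ 0 := by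
      by_cases hp0 : p = 0
      · have hq0 : q ≠ 0 := by
          intro h; apply hdet; rw [hp0, h]; ring
        refine ⟨(r / (2 * q)) ^ 2 + 1, - r / (2 * q), 1, ?_, ?_⟩
        · rw [hp0]; field_simp; ring
        · have : ((r / (2 * q)) ^ 2 + 1) * 1 - (- r / (2 * q)) ^ 2 = 1 := by ring
          rw [this]; exact one_ne_zero
      · by_cases hr0 : r = 0
        · have hq0 : q ≠ 0 := by
            intro h; apply hdet; rw [hr0, h]; ring
          refine ⟨1, - p / (2 * q), (p / (2 * q)) ^ 2 + 1, ?_, ?_⟩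
          · rw [hr0]; field_simp; ring
          · have : 1 * ((p / (2 * q)) ^ 2 + 1) - (- p / (2 * q)) ^ 2 = 1 := by ring
            rw [this]; exact one_ne_zero
        · refine ⟨r, 0, -p, by ring, ?_⟩
          have : r * -p - 0 ^ 2 = - (r * p) := by ring
          rw [this]; exact neg_ne_zero.2 (mul_ne_zero hr0 hp0)
    obtain ⟨s, w, z, h1, h2⟩ := swz
    set Φ : V →ₗ[k] k := s • T (e 1) (e 1) + (2 * w) • T (e 1) (e 2) + z • T (e 2) (e 2) with hΦ
    have hΔ : p * r - q ^ 2 ≠ 0 := sub_ne_zero.2 hdet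
    set y : k := - (Φ (e 1) * r - Φ (e 2) * q) / (p * r - q ^ 2) / 2 with hy
    set y' : k := - (Φ (e 2) * p - Φ (e 1) * q) / (p * r - q ^ 2) / 2 with hy'
    have hy2 : 2 * y * (p * r - q ^ 2) = - (Φ (e 1) * r - Φ (e 2) * q) := by
      rw [hy, mul_div_cancel₀ _ two_ne_zero, div_mul_cancel₀ _ hΔ]
    have hy2' : 2 * y' * (p * r - q ^ 2) = - (Φ (e 2) * p - Φ (e 1) * q) := by
      rw [hy', mul_div_cancel₀ _ two_ne_zero, div_mul_cancel₀ _ hΔ]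
    clear_value y y'
    have L0 : ∀ t : k, LB T e ![t, y, y', s, w, z] = 0 := by
      intro t
      have hL : LB T e ![t, y, y', s, w, z] = (2 * y) • T (e 0) (e 1) + (2 * y') • T (e 0) (e 2) + Φ := by
        rw [LB_apply, hΦ, h00]; simp; abel
      rw [hL]
      refine e.ext fun i => ?_
      simp only [LinearMap.add_apply, LinearMap.smul_apply, smul_eq_mul, LinearMap.zero_apply]
      fin_cases i
      · have e1 : T (e 1) (e 1) (e 0) = p := by rw [h23, h12]
        have e2 : T (e 1) (e 2) (e 0) = q := by rw [h23, h12]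
        have e3 : T (e 2) (e 2) (e 0) = r := by rw [h23, h12]
        simp [z0, hΦ, e1, e2, e3]
        linear_combination h1
      · simp only [Fin.mk_one, z1, ← hp]
        apply mul_right_cancel₀ hΔ
        linear_combination p * hy2 + q * hy2'
      · simp only [Fin.reduceFinMk, ← hq, ← hr]
        apply mul_right_cancel₀ hΔ
        linear_combination q * hy2 + r * hy2'
    by_cases hd0 : detB ![0, y, y', s, w, z] = 0
    · refine net_of_nonsing T h12 e _ (L0 1) ?_
      intro hd1
      apply h2
      simp [detB] at hd0 hd1
      linear_combination hd1 - hd0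
    · exact net_of_nonsing T h12 e _ (L0 0) hd0

lemma net [IsAlgClosed k] [CharZero k] (hfr : finrank k V = 3)
    (T : V →ₗ[k] V →ₗ[k] V →ₗ[k] k)
    (h12 : ∀ a b, T a b = T b a) (h23 : ∀ a b c, T a b c = T a c b)
    (hnd : ∀ a, (∀ b c, T a b c = 0) → a = 0) :
    ∃ b : Basis (Fin 3) k V, T (b 0) (b 2) = T (b 1) (b 1) := by
  have : FiniteDimensional k V := FiniteDimensional.of_finrank_pos (by omega)
  have : Nontrivial V := Module.nontrivial_of_finrank_pos (R := k) (by omega)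
  set e := finBasisOfFinrankEq k V hfr with he
  have N1 : ∃ v w : V, v ≠ 0 ∧ w ≠ 0 ∧ T v w = 0 := by
    by_cases hinj : Function.Injective (T (e 0))
    · set M := LinearEquiv.ofInjectiveOfFinrankEq (T (e 0)) hinj
        (Subspace.dual_finrank_eq (K := k) (V := V)).symm with hM
      have hMa : ∀ v, M v = T (e 0) v := by intro v; rfl
      obtain ⟨μ, hμ⟩ := Module.End.exists_eigenvalue (M.symm.toLinearMap.comp (T (e 1)))
      obtain ⟨w, hw⟩ := hμ.exists_hasEigenvector
      have h1 := hw.apply_eq_smul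
      refine ⟨e 1 - μ • e 0, w, ?_, hw.2, ?_⟩
      · intro h
        have := congrArg (fun v => e.repr v 1) h
        simp at this
      · have h2 := congrArg M h1
        rw [LinearMap.comp_apply, LinearEquiv.coe_coe, LinearEquiv.apply_symm_apply, map_smul,
          hMa] at h2
        rw [map_sub, map_smul, LinearMap.sub_apply, LinearMap.smul_apply, h2, sub_self]
    · rw [← LinearMap.ker_eq_bot, Submodule.eq_bot_iff] at hinj
      push Not at hinj
      obtain ⟨w, hw, hw0⟩ := hinj
      exact ⟨e 0, w, e.ne_zero 0, hw0, hw⟩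
  obtain ⟨v, w, hv, hw, hvw⟩ := N1
  by_cases hli : LinearIndependent k ![v, w]
  · obtain ⟨f, rfl, rfl⟩ := ext_basis hfr v w hli
    exact net_case1 T h12 h23 hnd f hvw
  · rw [LinearIndependent.pair_iff' hv] at hli
    push Not at hli
    obtain ⟨a, rfl⟩ := hli
    have ha : a ≠ 0 := by rintro rfl; simp at hw
    obtain ⟨x, hx⟩ := exists_linearIndependent_snoc_of_lt_finrank (R := k) (v := ![v])
      (by simpa using hv) (by rw [hfr]; norm_num)
    have hx' : LinearIndependent k ![v, x] := by
      have hfun : ![v, x] = Fin.snoc (α := fun _ => V) ![v] x := by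
        ext i; fin_cases i <;> rfl
      rw [hfun]; exact hx
    obtain ⟨f, h0, -⟩ := ext_basis hfr v x hx'
    refine net_case2 T h12 h23 hnd f ?_
    rw [h0]
    rw [map_smul] at hvw
    exact (smul_eq_zero.1 hvw).resolve_left ha
end net

section cubic
open Module
variable {k : Type} [Field k]

lemma curve [IsAlgClosed k] [CharZero k] {V : Type} [AddCommGroup V] [Module k V]
    (T : V →ₗ[k] V →ₗ[k] V →ₗ[k] k)
    (h12 : ∀ a b, T a b = T b a) (h23 : ∀ a b c, T a b c = T a c b)
    (hnd : ∀ a, (∀ b c, T a b c = 0) → a = 0) (b : Basis (Fin 3) k V)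
    (hb : T (b 0) (b 2) = T (b 1) (b 1)) (B : Set k) (hB : B.Finite) :
    ∃ S : Finset k, S.card ≤ 5 ∧ (∀ t ∈ S, t ∉ B) ∧ ∃ c : k → k, ∀ i j m : Fin 3,
      T (b i) (b j) (b m) = ∑ t ∈ S, c t * t ^ (i.val + j.val + m.val) := by
  set f : ℕ → k := fun s => match s with
    | 0 => T (b 0) (b 0) (b 0)
    | 1 => T (b 0) (b 0) (b 1)
    | 2 => T (b 0) (b 0) (b 2)
    | 3 => T (b 0) (b 1) (b 2)
    | 4 => T (b 0) (b 2) (b 2)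
    | 5 => T (b 1) (b 2) (b 2)
    | _ => T (b 2) (b 2) (b 2) with hf
  have hb' : ∀ w, T (b 1) (b 1) w = T (b 0) (b 2) w := fun w => by rw [hb]
  have h10 : ∀ w, T (b 1) (b 0) w = T (b 0) (b 1) w := fun w => by rw [h12]
  have h20 : ∀ w, T (b 2) (b 0) w = T (b 0) (b 2) w := fun w => by rw [h12]
  have h21 : ∀ w, T (b 2) (b 1) w = T (b 1) (b 2) w := fun w => by rw [h12]
  have hT : ∀ i j m : Fin 3, T (b i) (b j) (b m) = f (i.val + j.val + m.val) := by
    have a1 : T (b 0) (b 1) (b 0) = T (b 0) (b 0) (b 1) := h23 _ _ _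
    have a2 : T (b 0) (b 2) (b 0) = T (b 0) (b 0) (b 2) := h23 _ _ _
    have a3 : T (b 0) (b 2) (b 1) = T (b 0) (b 1) (b 2) := h23 _ _ _
    have a4 : T (b 0) (b 1) (b 1) = T (b 0) (b 0) (b 2) := by rw [← h10, h23, hb', a2]
    have a5 : T (b 1) (b 2) (b 0) = T (b 0) (b 1) (b 2) := by rw [h23, h10]
    have a6 : T (b 1) (b 2) (b 1) = T (b 0) (b 2) (b 2) := by rw [h23, hb']
    have a7 : T (b 2) (b 2) (b 0) = T (b 0) (b 2) (b 2) := by rw [h23, h20]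
    have a8 : T (b 2) (b 2) (b 1) = T (b 1) (b 2) (b 2) := by rw [h23, h21]
    intro i j m
    fin_cases i <;> fin_cases j <;> fin_cases m <;>
      simp [hf, h10, h20, h21, hb', a1, a2, a3, a4, a5, a6, a7, a8]
  set Φ : Polynomial k →ₗ[k] k := ∑ s ∈ Finset.range 7, f s • Polynomial.lcoeff k s with hΦ
  have hΦX : ∀ s < 7, Φ (Polynomial.X ^ s) = f s := by
    intro s hs
    simp only [hΦ, LinearMap.sum_apply, LinearMap.smul_apply, Polynomial.lcoeff_apply,
      Polynomial.coeff_X_pow, smul_eq_mul, mul_ite, mul_one, mul_zero]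
    rw [Finset.sum_ite_eq' (Finset.range 7) s f]
    simp [hs]
  obtain ⟨S, h1, h2, c, hc⟩ := sextic Φ (by
    intro h hh hp
    have hexp : h = h.coeff 0 • Polynomial.X ^ 0 + h.coeff 1 • Polynomial.X ^ 1
        + h.coeff 2 • Polynomial.X ^ 2 := by
      ext i
      rw [Polynomial.mem_degreeLT] at hh
      simp only [Polynomial.coeff_add, Polynomial.coeff_smul, Polynomial.coeff_X_pow, smul_eq_mul,
        mul_ite, mul_one, mul_zero]
      by_cases hi : i < 3
      · interval_cases i <;> simp
      · rw [Polynomial.coeff_eq_zero_of_degree_lt (lt_of_lt_of_le hh (by exact_mod_cast not_lt.1 hi))]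
        rw [if_neg (by omega), if_neg (by omega), if_neg (by omega)]; simp
    have hrec : ∀ m < 5, h.coeff 0 * f m + h.coeff 1 * f (m + 1) + h.coeff 2 * f (m + 2) = 0 := by
      intro m hm
      have := hp (Polynomial.X ^ m) (by
        rw [Polynomial.mem_degreeLT, Polynomial.degree_X_pow]; exact_mod_cast hm)
      rw [hexp, add_mul, add_mul, smul_mul_assoc, smul_mul_assoc, smul_mul_assoc, ← pow_add,
        ← pow_add, ← pow_add, map_add, map_add, map_smul, map_smul, map_smul,
        hΦX _ (by omega), hΦX _ (by omega), hΦX _ (by omega)] at this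
      simp only [smul_eq_mul, zero_add] at this
      rw [add_comm m 1, add_comm m 2]
      exact this
    have ha : h.coeff 0 • b 0 + h.coeff 1 • b 1 + h.coeff 2 • b 2 = 0 := by
      apply hnd
      have : T (h.coeff 0 • b 0 + h.coeff 1 • b 1 + h.coeff 2 • b 2) = 0 := by
        refine b.ext fun i => b.ext fun j => ?_
        simp only [map_add, map_smul, LinearMap.add_apply, LinearMap.smul_apply, hT, smul_eq_mul,
          LinearMap.zero_apply]
        rw [← hrec (i.val + j.val) (by omega)]
        simp only [Fin.val_zero, Fin.val_one, Fin.val_two, zero_add]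
        rw [show 1 + i.val + j.val = i.val + j.val + 1 by ring,
          show 2 + i.val + j.val = i.val + j.val + 2 by ring]
      intro x y; rw [this]; rfl
    have c0 := congrArg (fun v => b.repr v 0) ha
    have c1 := congrArg (fun v => b.repr v 1) ha
    have c2 := congrArg (fun v => b.repr v 2) ha
    simp at c0 c1 c2
    rw [hexp, c0, c1, c2]; simp) B hB
  refine ⟨S, h1, h2, c, fun i j m => ?_⟩
  rw [hT, ← hΦX _ (by omega), hc _ (by
    rw [Polynomial.mem_degreeLT, Polynomial.degree_X_pow]
    have : i.val + j.val + m.val < 7 := by omega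
    exact_mod_cast this)]
  simp

variable {N : ℕ}

lemma Rep.wsum [IsAlgClosed k] {d : ℕ} (hd : d ≠ 0) {A : Set (Fin N → k)}
    (hA : ∀ c : k, c ≠ 0 → ∀ l ∈ A, c • l ∈ A) {ι : Type} (S : Finset ι) (l : ι → Fin N → k)
    (c : ι → k) (hl : ∀ t ∈ S, l t ∈ A) :
    Rep d A S.card (∑ t ∈ S, c t • linForm (l t) ^ d) := by
  classical
  induction S using Finset.induction_on with
  | empty => simpa using Rep.zero d A 0
  | insert a S ha ih =>
    rw [Finset.sum_insert ha, Finset.card_insert_of_notMem ha, add_comm S.card]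
    refine Rep.add ?_ (ih fun t ht => hl t (Finset.mem_insert_of_mem ht))
    have := Rep.weighted hd hA [l a] (fun _ => c a) (by simpa using hl a (Finset.mem_insert_self _ _))
    simpa using this

lemma zero_of_killed [CharZero k] {d : ℕ} {Kf : Submodule k (Fin N → k)} {X : Set (Fin N → k)}
    (hX : Kf ⊔ Submodule.span k X = ⊤) {G : MvPolynomial (Fin N) k} (hG : G.IsHomogeneous (d + 1))
    (h1 : ∀ w ∈ Kf, D w G = 0) (h2 : ∀ w ∈ X, D w G = 0) : G = 0 := by
  refine eq_zero_of_D hG fun v => ?_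
  have : Kf ⊔ Submodule.span k X ≤ LinearMap.ker (D.flip G) :=
    sup_le (fun w hw => h1 w hw) (Submodule.span_le.2 fun w hw => h2 w hw)
  exact this (by rw [hX]; trivial)

lemma zero_of_killed2 [CharZero k] {Kf : Submodule k (Fin N → k)} {X : Set (Fin N → k)}
    (hX : Kf ⊔ Submodule.span k X = ⊤) {G : MvPolynomial (Fin N) k} (hG : G.IsHomogeneous 2)
    (h1 : ∀ w ∈ Kf, D w G = 0) (h2 : ∀ u ∈ X, ∀ v ∈ X, coeff 0 (D u (D v G)) = 0) : G = 0 := by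
  refine zero_of_killed hX hG h1 fun v hv => ?_
  refine zero_of_killed hX (D_homog hG v) (fun w hw => by rw [D_comm, h1 w hw, map_zero])
    fun u hu => ?_
  have h0 := D_homog (D_homog hG v) u
  rw [← totalDegree_zero_iff_isHomogeneous, totalDegree_eq_zero_iff_eq_C] at h0
  rw [h0, h2 u hu v hv, map_zero]

lemma zero_of_killed3 [CharZero k] {Kf : Submodule k (Fin N → k)} {X : Set (Fin N → k)}
    (hX : Kf ⊔ Submodule.span k X = ⊤) {G : MvPolynomial (Fin N) k} (hG : G.IsHomogeneous 3)
    (h1 : ∀ w ∈ Kf, D w G = 0)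
    (h2 : ∀ u ∈ X, ∀ v ∈ X, ∀ w ∈ X, coeff 0 (D u (D v (D w G))) = 0) : G = 0 := by
  refine zero_of_killed hX hG h1 fun v hv => ?_
  exact zero_of_killed2 hX (D_homog hG v) (fun w hw => by rw [D_comm, h1 w hw, map_zero])
    fun u hu w hw => h2 u hu w hw v hv

def T3 (F : MvPolynomial (Fin N) k) (Cc : Submodule k (Fin N → k)) :
    Cc →ₗ[k] Cc →ₗ[k] Cc →ₗ[k] k :=
  LinearMap.mk₂ k (fun u v => ((MvPolynomial.lcoeff k 0).comp ((D u.1).comp ((D v.1).comp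
    (D.flip F)))).comp Cc.subtype)
    (by intros; ext; simp) (by intros; ext; simp) (by intros; ext; simp) (by intros; ext; simp)

lemma T3_apply (F : MvPolynomial (Fin N) k) (Cc : Submodule k (Fin N → k)) (u v w : Cc) :
    T3 F Cc u v w = coeff 0 (D u.1 (D v.1 (D w.1 F))) := rfl

lemma D3_linForm (u v w l : Fin N → k) : coeff 0 (D u (D v (D w (linForm l ^ 3)))) =
    6 * (l ⬝ᵥ u) * (l ⬝ᵥ v) * (l ⬝ᵥ w) := by
  have h := D_linForm_pow w l 2
  have h' := D_linForm_pow v l 1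
  have h'' := D_linForm_pow u l 0
  norm_num at h h' h''
  simp only [h, map_smul, h', h'']
  rw [coeff_smul, coeff_smul, coeff_smul]
  simp
  ring

lemma P335 [IsAlgClosed k] [CharZero k] (H : P k N 2 3 3) : P k N 3 3 5 := by
  classical
  intro F hF K hK hn U hU
  set Kf : Submodule k (Fin N → k) := LinearMap.ker (D.flip F) with hKf
  have hKf' : ∀ w ∈ Kf, D w F = 0 := fun w hw => hw
  have hle : K ≤ Kf := fun w hw => hK w hw
  by_cases hc : N ≤ finrank k Kf + 2
  · exact (H F hF Kf hKf' hc U hU).mono (Adm_mono hle subset_rfl) (by norm_num)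
  obtain ⟨Cc, hCc⟩ := Submodule.exists_isCompl Kf
  have hfr : finrank k Cc = 3 := by
    have h1 := Submodule.finrank_add_eq_of_isCompl hCc
    have h2 := Submodule.finrank_mono hle
    rw [finrank_fin_fun] at h1
    omega
  have hnd : ∀ a, (∀ b c, T3 F Cc a b c = 0) → a = 0 := by
    intro a ha
    have hz : D a.1 F = 0 := by
      refine zero_of_killed2 (X := (Cc : Set (Fin N → k))) (by rw [Submodule.span_eq]; exact hCc.sup_eq_top)
        (D_homog hF a.1) (fun w hw => by rw [D_comm, hKf' w hw, map_zero]) fun u hu v hv => ?_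
      have := ha ⟨u, hu⟩ ⟨v, hv⟩
      rw [T3_apply] at this
      rw [D_comm v, D_comm u]
      exact this
    have : (a : Fin N → k) ∈ Kf ⊓ Cc := ⟨hz, a.2⟩
    rw [hCc.inf_eq_bot] at this
    exact Subtype.ext this
  have h12 : ∀ a b, T3 F Cc a b = T3 F Cc b a := by
    intro a b; ext c; rw [T3_apply, T3_apply, D_comm]
  have h23 : ∀ a b c, T3 F Cc a b c = T3 F Cc a c b := by
    intro a b c; rw [T3_apply, T3_apply, D_comm b.1]
  obtain ⟨b, hb⟩ := net hfr (T3 F Cc) h12 h23 hnd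
  choose ξ hξ using fun i => exists_dot ((b.coord i).comp (Cc.projectionOnto Kf hCc.symm))
  have hξK : ∀ i, ∀ w ∈ Kf, ξ i ⬝ᵥ w = 0 := by
    intro i w hw
    rw [hξ, LinearMap.comp_apply, (Submodule.projectionOnto_apply_eq_zero_iff _).2 hw, map_zero]
  have hξb : ∀ i j, ξ i ⬝ᵥ (b j : Fin N → k) = if j = i then 1 else 0 := by
    intro i j
    rw [hξ, LinearMap.comp_apply, Submodule.projectionOnto_apply_left]
    simp [Finsupp.single_apply]
  set l : k → Fin N → k := fun t => ξ 0 + t • ξ 1 + t ^ 2 • ξ 2 with hl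
  have hlw : ∀ t w, l t ⬝ᵥ w = ξ 0 ⬝ᵥ w + t * (ξ 1 ⬝ᵥ w) + t ^ 2 * (ξ 2 ⬝ᵥ w) := by
    intro t w; simp [hl, add_dotProduct, smul_dotProduct]
  have hlK : ∀ t, ∀ w ∈ Kf, l t ⬝ᵥ w = 0 := by
    intro t w hw; rw [hlw, hξK _ _ hw, hξK _ _ hw, hξK _ _ hw]; ring
  have hlb : ∀ t (j : Fin 3), l t ⬝ᵥ (b j : Fin N → k) = t ^ j.val := by
    intro t j; rw [hlw, hξb, hξb, hξb]
    fin_cases j <;> simp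
  have hBfin : (⋃ u ∈ U, {t | l t ⬝ᵥ u = 0}).Finite := by
    refine Set.Finite.biUnion U.finite_toSet fun u hu => ?_
    set q : Polynomial k := Polynomial.C (ξ 0 ⬝ᵥ u) + Polynomial.C (ξ 1 ⬝ᵥ u) * Polynomial.X
      + Polynomial.C (ξ 2 ⬝ᵥ u) * Polynomial.X ^ 2 with hq
    have hq0 : q ≠ 0 := by
      intro h
      have c0 := congrArg (fun p => Polynomial.coeff p 0) h
      have c1 := congrArg (fun p => Polynomial.coeff p 1) h
      have c2 := congrArg (fun p => Polynomial.coeff p 2) h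
      simp [hq, Polynomial.coeff_X, Polynomial.coeff_C] at c0 c1 c2
      apply hU u hu
      apply hKf'
      rw [← Submodule.projectionOnto_apply_eq_zero_iff hCc.symm]
      refine b.ext_elem fun i => ?_
      have e : ∀ i, b.repr (Cc.projectionOnto Kf hCc.symm u) i = ξ i ⬝ᵥ u := fun i => by
        rw [hξ]; rfl
      rw [e]
      fin_cases i
      · simpa using c0
      · simpa using c1
      · simpa using c2
    refine (q.roots.toFinset.finite_toSet).subset fun t ht => ?_
    have ht : l t ⬝ᵥ u = 0 := ht
    rw [hlw] at ht
    simp only [Finset.mem_coe, Multiset.mem_toFinset, Polynomial.mem_roots hq0,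
      Polynomial.IsRoot.def]
    rw [hq]
    simp only [Polynomial.eval_add, Polynomial.eval_mul, Polynomial.eval_C, Polynomial.eval_X,
      Polynomial.eval_pow]
    linear_combination ht
  obtain ⟨S, hS, hSB, c, hcS⟩ := curve (T3 F Cc) h12 h23 hnd b hb _ hBfin
  have hrep := Rep.wsum (d := 3) (by norm_num) (Adm_smul K U) S l (fun t => c t / 6) (by
    intro t ht
    refine ⟨fun w hw => hlK t w (hle hw), fun u hu h0 => hSB t ht ?_⟩
    exact Set.mem_biUnion hu h0)
  have hspan : Kf ⊔ Submodule.span k (Set.range fun j => (b j : Fin N → k)) = ⊤ := by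
    have : Submodule.span k (Set.range fun j => (b j : Fin N → k)) = Cc := by
      have h := congrArg (Submodule.map Cc.subtype) b.span_eq
      rw [Submodule.map_span, Submodule.map_top, Submodule.range_subtype, ← Set.range_comp] at h
      exact h
    rw [this]; exact hCc.sup_eq_top
  have hz : F - ∑ t ∈ S, (c t / 6) • linForm (l t) ^ 3 = 0 := by
    refine zero_of_killed3 hspan ?_ ?_ ?_
    · exact hF.sub (IsHomogeneous.sum _ _ _ fun t _ => smul_homog _ (linForm_pow_homog _ _))
    · intro w hw
      rw [map_sub, hKf' w hw, map_sum, zero_sub, neg_eq_zero]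
      refine Finset.sum_eq_zero fun t _ => ?_
      rw [map_smul, D_linForm_pow, hlK t w hw]; simp
    · rintro _ ⟨i, rfl⟩ _ ⟨j, rfl⟩ _ ⟨m, rfl⟩
      have := hcS i j m
      rw [T3_apply] at this
      simp only [map_sub, map_sum, map_smul, coeff_sub, this, coeff_sum, coeff_smul, D3_linForm, hlb]
      rw [sub_eq_zero]
      refine Finset.sum_congr rfl fun t _ => ?_
      simp only [smul_eq_mul]
      ring
  rw [sub_eq_zero.1 hz]
  exact hrep.mono subset_rfl hS
end cubic

section assembly
variable {k : Type} [Field k] [IsAlgClosed k] [CharZero k] {N : ℕ}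

lemma P_vars1 (d : ℕ) : P k N 1 (d + 1) 1 := by
  induction d with
  | zero => exact P_one 1
  | succ d ih => exact P_step ih (P_zero (d + 1))

lemma P_vars2 (d : ℕ) : P k N 2 (d + 1) (d + 1) := by
  induction d with
  | zero => exact P_one 2
  | succ d ih => exact P_step ih (P_vars1 (d + 1))

lemma P_deg2 (n : ℕ) : P k N n 2 n := by
  induction n with
  | zero => exact P_zero 1
  | succ n ih =>
    rw [add_comm n 1]
    have := P_step (P_one (k := k) (N := N) (n + 1)) ih
    rwa [add_comm n 1] at this

lemma P_main (s n d : ℕ) (hs : n + d = s) : ∃ b, b + (n + d).choose d = (n + d + 4).choose (d + 2) ∧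
    P k N (n + 3) (d + 3) b := by
  induction s generalizing n d with
  | zero =>
    obtain rfl : n = 0 := by omega
    obtain rfl : d = 0 := by omega
    exact ⟨5, by decide, P335 (P_vars2 2)⟩
  | succ s ih =>
    have A : ∃ b, (b + if d = 0 then 0 else (n + d - 1).choose (d - 1)) = (n + d + 3).choose (d + 1) ∧
        P k N (n + 3) (d + 2) b := by
      cases d with
      | zero => exact ⟨n + 3, by simp, P_deg2 (n + 3)⟩
      | succ d =>
        obtain ⟨b, h1, h2⟩ := ih n d (by omega)
        refine ⟨b, ?_, h2⟩
        rw [if_neg (by omega), show n + (d + 1) - 1 = n + d by omega, Nat.add_sub_cancel, h1]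
        congr 1
    have B : ∃ b, (b + if n = 0 then 0 else (n + d - 1).choose d) = (n + d + 3).choose (d + 2) ∧
        P k N (n + 2) (d + 3) b := by
      cases n with
      | zero =>
        refine ⟨d + 3, ?_, P_vars2 (d + 2)⟩
        simp [Nat.choose_succ_self_right]
      | succ n =>
        obtain ⟨b, h1, h2⟩ := ih n d (by omega)
        refine ⟨b, ?_, h2⟩
        rw [if_neg (by omega), show n + 1 + d - 1 = n + d by omega, h1]
        congr 1; omega
    obtain ⟨a, ha, hPa⟩ := A
    obtain ⟨b, hb, hPb⟩ := B
    refine ⟨a + b, ?_, P_step hPa hPb⟩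
    have hp : (n + d + 4).choose (d + 2) = (n + d + 3).choose (d + 1) + (n + d + 3).choose (d + 2) :=
      Nat.choose_succ_succ _ _
    have hq : (n + d).choose d = (if d = 0 then 0 else (n + d - 1).choose (d - 1)) +
        (if n = 0 then 0 else (n + d - 1).choose d) := by
      cases d with
      | zero =>
        have : n ≠ 0 := by omega
        simp [this]
      | succ d =>
        cases n with
        | zero => simp
        | succ n =>
          simp only [Nat.add_eq_zero_iff, one_ne_zero, and_false, if_false]
          exact Nat.choose_succ_succ _ _
    omega
end assembly

end WaringProof

end WaringProof

/-- Every homogeneous form of degree `d ≥ 3` in `n ≥ 3` variables over an algebraically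
closed field of characteristic `0` is a sum of at most
`binom(n+d-2, d-1) − binom(n+d-6, d-3)` `d`-th powers of linear forms. -/
theorem stmt_6 (k : Type) [Field k] [IsAlgClosed k] [CharZero k]
    (n d : ℕ) (hn : 3 ≤ n) (hd : 3 ≤ d)
    (F : MvPolynomial (Fin n) k) (hF : F.IsHomogeneous d) :
    ∃ m ≤ (n + d - 2).choose (d - 1) - (n + d - 6).choose (d - 3),
      ∃ l : Fin m → (Fin n → k), F = ∑ i, linForm (l i) ^ d := by
  obtain ⟨n, rfl⟩ := Nat.exists_eq_add_of_le' hn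
  obtain ⟨d, rfl⟩ := Nat.exists_eq_add_of_le' hd
  obtain ⟨b, hb, hP⟩ := WaringProof.P_main (k := k) (N := n + 3) _ n d rfl
  obtain ⟨L, h1, -, h3⟩ := hP F hF ⊥ (by simp) (by simp) ∅ (by simp)
  have e1 : n + 3 + (d + 3) - 2 = n + d + 4 := by omega
  have e2 : n + 3 + (d + 3) - 6 = n + d := by omega
  have e3 : d + 3 - 1 = d + 2 := by omega
  have e4 : d + 3 - 3 = d := by omega
  rw [e1, e2, e3, e4]
  refine ⟨L.length, by omega, fun i => L[i], ?_⟩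
  rw [h3]
  exact (Fin.sum_univ_fun_getElem L fun l => linForm l ^ (d + 3)).symm
end

section
/- Let G and H be homogeneous forms in three variables that intersect transversally in the points a_1,…,a_k of the projective plane P², i.e., their common projective zero locus is exactly {a_1,…,a_k} and at each a_i the gradients of G and H are linearly independent. Then the intersection of the homogeneous ideals of the points a_1,…,a_k equals the ideal (G, H). -/
open MvPolynomial

theorem hom_scale {k R : Type} [Field k] [CommRing R] [Algebra k R] {n e : ℕ}
    {p : MvPolynomial (Fin n) k} (hp : p.IsHomogeneous e) (t : R) (b : Fin n → R) :
    aeval (fun i => t * b i) p = t ^ e * aeval b p := by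
  rw [aeval_def, aeval_def, eval₂_eq', eval₂_eq', Finset.mul_sum]
  refine Finset.sum_congr rfl fun d hd => ?_
  have h1 : ∑ i, d i = e := by
    have := hp (mem_support_iff.mp hd)
    rw [← this, Finsupp.weight_apply, Finsupp.sum_fintype _ _ (by simp)]
    simp
  simp only [mul_pow, Finset.prod_mul_distrib, Finset.prod_pow_eq_pow_sum, h1]
  ring

theorem hom_eval_smul {k : Type} [Field k] {n e : ℕ}
    {p : MvPolynomial (Fin n) k} (hp : p.IsHomogeneous e) (c : k) (b : Fin n → k) :
    eval (c • b) p = c ^ e * eval b p := by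
  have := hom_scale hp c b
  rw [MvPolynomial.aeval_eq_eval, MvPolynomial.aeval_eq_eval] at this
  exact this

theorem congr_mod {k : Type} [Field k] {n : ℕ} (I : Ideal (MvPolynomial (Fin n) k))
    (g : Fin n → MvPolynomial (Fin n) k) (hg : ∀ i, X i - g i ∈ I)
    (p : MvPolynomial (Fin n) k) : p - aeval g p ∈ I := by
  rw [← Ideal.Quotient.eq]
  have : Ideal.Quotient.mkₐ k I = (Ideal.Quotient.mkₐ k I).comp (aeval g) := by
    apply MvPolynomial.algHom_ext
    intro i
    simpa using! (Ideal.Quotient.eq.mpr (hg i))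
  exact DFunLike.congr_fun this p

/-- Two linear forms cutting out the line through `a`. -/
theorem exists_line {k : Type} [Field k] (a : Fin 3 → k) (ha : a ≠ 0) :
    ∃ l m : MvPolynomial (Fin 3) k, eval a l = 0 ∧ eval a m = 0 ∧
      ∀ p e, p.IsHomogeneous e → eval a p = 0 → p ∈ Ideal.span {l, m} := by
  obtain ⟨j, hj⟩ : ∃ j, a j ≠ 0 := by
    by_contra! h
    exact ha (funext h)
  obtain ⟨u, v, huv⟩ : ∃ u v : Fin 3, ∀ i, i = j ∨ i = u ∨ i = v := by
    clear hj; revert j; decide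
  refine ⟨X u - C ((a j)⁻¹) * X j * C (a u), X v - C ((a j)⁻¹) * X j * C (a v), ?_, ?_, ?_⟩
  · simp [hj]
  · simp [hj]
  intro p e hp h0
  have h := congr_mod (Ideal.span {X u - C ((a j)⁻¹) * X j * C (a u),
    X v - C ((a j)⁻¹) * X j * C (a v)}) (fun i => C ((a j)⁻¹) * X j * C (a i)) ?_ p
  · rw [hom_scale hp (C ((a j)⁻¹) * X j : MvPolynomial (Fin 3) k) (fun i => C (a i))] at h
    have h2 : aeval (fun i => (C (a i) : MvPolynomial (Fin 3) k)) p = 0 := by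
      have : (aeval (fun i => (C (a i) : MvPolynomial (Fin 3) k)) : _ →ₐ[k] _)
          = (Algebra.ofId k _).comp (aeval a) := by
        apply MvPolynomial.algHom_ext
        intro i
        simp [Algebra.ofId_apply, MvPolynomial.algebraMap_eq]
      rw [this]
      simp [MvPolynomial.aeval_eq_eval, h0]
    rw [h2, mul_zero, sub_zero] at h
    exact h
  · intro i
    rcases huv i with rfl | rfl | rfl
    · have : (X i - C ((a i)⁻¹) * X i * C (a i) : MvPolynomial (Fin 3) k) = 0 := by
        have : (C ((a i)⁻¹) * C (a i) : MvPolynomial (Fin 3) k) = 1 := by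
          rw [← C_mul, inv_mul_cancel₀ hj, C_1]
        linear_combination (-X i) * this
      simp [this]
    · exact Ideal.subset_span (by simp)
    · exact Ideal.subset_span (by simp)

/-- Local step: at a transversal point some `D` with `D(a) ≠ 0` multiplies into `(G, H)`. -/
theorem local_step {k : Type} [Field k] (G H : MvPolynomial (Fin 3) k) (dG dH : ℕ)
    (hG : G.IsHomogeneous dG) (hH : H.IsHomogeneous dH) (a : Fin 3 → k) (ha : a ≠ 0)
    (hGa : eval a G = 0) (hHa : eval a H = 0)
    (ht : LinearIndependent k
      ![fun j => eval a (pderiv j G), fun j => eval a (pderiv j H)])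
    (f : MvPolynomial (Fin 3) k) (e : ℕ) (hf : f.IsHomogeneous e) (hfa : eval a f = 0) :
    ∃ D, eval a D ≠ 0 ∧ D * f ∈ Ideal.span {G, H} := by
  obtain ⟨l, m, hl, hm, hlm⟩ := exists_line a ha
  obtain ⟨α, β, h1⟩ := Ideal.mem_span_pair.mp (hlm G dG hG hGa)
  obtain ⟨γ, δ, h2⟩ := Ideal.mem_span_pair.mp (hlm H dH hH hHa)
  obtain ⟨u, v, h3⟩ := Ideal.mem_span_pair.mp (hlm f e hf hfa)
  refine ⟨α * δ - β * γ, ?_, ?_⟩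
  · intro h0
    simp only [map_sub, map_mul] at h0
    have dG' : ∀ j, eval a (pderiv j G) =
        eval a α * eval a (pderiv j l) + eval a β * eval a (pderiv j m) := by
      intro j
      rw [← h1]
      simp [Derivation.leibniz, hl, hm]
    have dH' : ∀ j, eval a (pderiv j H) =
        eval a γ * eval a (pderiv j l) + eval a δ * eval a (pderiv j m) := by
      intro j
      rw [← h2]
      simp [Derivation.leibniz, hl, hm]
    rw [LinearIndependent.pair_iff] at ht
    have r1 := ht (eval a γ) (-eval a α) (by
      funext j
      simp only [Pi.add_apply, Pi.smul_apply, smul_eq_mul, Pi.zero_apply, dG', dH']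
      linear_combination (-eval a (pderiv j m)) * h0)
    have r2 := ht (eval a δ) (-eval a β) (by
      funext j
      simp only [Pi.add_apply, Pi.smul_apply, smul_eq_mul, Pi.zero_apply, dG', dH']
      linear_combination (eval a (pderiv j l)) * h0)
    have r3 := ht 1 0 (by
      funext j
      have e1 := neg_eq_zero.mp r1.2
      have e2 := neg_eq_zero.mp r2.2
      simp [dG', e1, e2])
    exact one_ne_zero r3.1
  · rw [Ideal.mem_span_pair]
    refine ⟨u * δ - v * γ, v * α - u * β, ?_⟩
    rw [← h1, ← h2, ← h3]
    ring

theorem relPrime_of_zeros {k : Type} [Field k] [IsAlgClosed k]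
    (A B : MvPolynomial (Fin 2) k)
    (h : ∀ x, eval x A = 0 → eval x B = 0 → x = 0) : IsRelPrime A B := by
  intro D hA hB
  have key : ∀ i, ∃ N : ℕ, D ∣ (X i : MvPolynomial (Fin 2) k) ^ N := by
    intro i
    have : (X i : MvPolynomial (Fin 2) k) ∈ (Ideal.span {D}).radical := by
      rw [← vanishingIdeal_zeroLocus_eq_radical (K := k), mem_vanishingIdeal_iff]
      intro x hx
      rw [mem_zeroLocus_iff] at hx
      have h1 := hx A (Ideal.mem_span_singleton.mpr hA)
      have h2 := hx B (Ideal.mem_span_singleton.mpr hB)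
      rw [MvPolynomial.aeval_eq_eval] at h1 h2
      have := h x h1 h2
      simp [this]
    obtain ⟨N, hN⟩ := this
    exact ⟨N, Ideal.mem_span_singleton.mp hN⟩
  obtain ⟨N, hN⟩ := key 0
  obtain ⟨M, hM⟩ := key 1
  have hp : IsRelPrime (X 0 : MvPolynomial (Fin 2) k) (X 1) := by
    rw [X_prime.irreducible.isRelPrime_iff_not_dvd, X_dvd_X]
    decide
  exact (hp.pow (m := N) (n := M)) hN hM

/-- A linear form with no zero among the common zeros is a nonzerodivisor mod `(G, H)`. -/
theorem nzd_step {k : Type} [Field k] [IsAlgClosed k] (G H : MvPolynomial (Fin 3) k) (s t : k)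
    (h : ∀ x : Fin 3 → k, eval x G = 0 → eval x H = 0 → x 2 = s * x 0 + t * x 1 → x = 0)
    (f : MvPolynomial (Fin 3) k)
    (hf : (X 2 - (C s * X 0 + C t * X 1)) * f ∈ Ideal.span {G, H}) :
    f ∈ Ideal.span {G, H} := by
  set L : MvPolynomial (Fin 3) k := X 2 - (C s * X 0 + C t * X 1) with hL
  let φ : MvPolynomial (Fin 3) k →ₐ[k] MvPolynomial (Fin 2) k :=
    aeval ![X 0, X 1, C s * X 0 + C t * X 1]
  let ψ : MvPolynomial (Fin 2) k →ₐ[k] MvPolynomial (Fin 3) k := aeval ![X 0, X 1]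
  have hφψ : ∀ q, φ (ψ q) = q := by
    intro q
    have : φ.comp ψ = AlgHom.id k _ := by
      apply MvPolynomial.algHom_ext
      intro i
      fin_cases i <;> simp [φ, ψ]
    exact DFunLike.congr_fun this q
  have hφL : φ L = 0 := by
    simp [hL, φ, ← MvPolynomial.algebraMap_eq]
  have hker : ∀ q, φ q = 0 → L ∣ q := by
    intro q hq
    have := congr_mod (Ideal.span {L}) ![X 0, X 1, C s * X 0 + C t * X 1] (by
      intro i
      fin_cases i
      · simp
      · simp
      · exact Ideal.mem_span_singleton.mpr (by simp [hL])) q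
    have h2 : aeval ![X 0, X 1, C s * X 0 + C t * X 1] q = ψ (φ q) := by
      have : (aeval ![X 0, X 1, C s * X 0 + C t * X 1] :
          MvPolynomial (Fin 3) k →ₐ[k] MvPolynomial (Fin 3) k) = ψ.comp φ := by
        apply MvPolynomial.algHom_ext
        intro i
        fin_cases i <;> simp [φ, ψ, ← MvPolynomial.algebraMap_eq]
      exact DFunLike.congr_fun this q
    rw [h2, hq, map_zero, sub_zero] at this
    exact Ideal.mem_span_singleton.mp this
  have hev : ∀ (x : Fin 2 → k) q, eval x (φ q) =
      eval ![x 0, x 1, s * x 0 + t * x 1] q := by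
    intro x q
    have : (aeval x).comp φ = (aeval ![x 0, x 1, s * x 0 + t * x 1] :
        MvPolynomial (Fin 3) k →ₐ[k] k) := by
      apply MvPolynomial.algHom_ext
      intro i
      fin_cases i <;> simp [φ]
    simpa [MvPolynomial.aeval_eq_eval] using DFunLike.congr_fun this q
  have hrel : IsRelPrime (φ G) (φ H) := by
    apply relPrime_of_zeros
    intro x h1 h2
    rw [hev] at h1 h2
    have := h _ h1 h2 (by simp)
    funext i
    fin_cases i
    · simpa using congrFun this 0
    · simpa using congrFun this 1
  obtain ⟨A, B, hAB⟩ := Ideal.mem_span_pair.mp hf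
  have h0 : φ A * φ G + φ B * φ H = 0 := by
    have := congrArg φ hAB
    simpa [hφL] using this
  obtain ⟨c, hcA, hcB⟩ : ∃ c, φ A = c * φ H ∧ φ B = - (c * φ G) := by
    by_cases hH0 : φ H = 0
    · have hu : IsUnit (φ G) := hrel dvd_rfl (by simp [hH0])
      obtain ⟨w, hw⟩ := hu.exists_right_inv
      have : φ A = 0 := by
        rw [hH0, mul_zero, add_zero] at h0
        exact (mul_eq_zero.mp h0).resolve_right hu.ne_zero
      refine ⟨- (φ B * w), by simp [this, hH0], ?_⟩
      linear_combination (-φ B) * hw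
    · have hd : φ H ∣ φ A * φ G := ⟨-φ B, by linear_combination h0⟩
      obtain ⟨c, hc⟩ := hrel.symm.dvd_of_dvd_mul_right hd
      refine ⟨c, by rw [hc, mul_comm], ?_⟩
      apply mul_right_cancel₀ hH0
      rw [hc] at h0
      linear_combination h0
  obtain ⟨A', hA'⟩ := hker (A - ψ c * H) (by simp [hφψ, hcA])
  obtain ⟨B', hB'⟩ := hker (B + ψ c * G) (by simp [hφψ, hcB])
  have hL0 : L ≠ 0 := by
    intro h00
    have := congrArg (eval ![0, 0, 1]) h00
    simp [hL] at this
  rw [Ideal.mem_span_pair]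
  refine ⟨A', B', ?_⟩
  apply mul_left_cancel₀ hL0
  rw [← hAB]
  linear_combination (-G) * hA' - H * hB'

theorem exists_linear {k : Type} [Field k] [Infinite k] {r : ℕ} (a : Fin r → (Fin 3 → k))
    (ha : ∀ i, a i ≠ 0) : ∃ s t : k, ∀ i, a i 2 ≠ s * a i 0 + t * a i 1 := by
  let q : Fin r → Polynomial k := fun i =>
    Polynomial.C (a i 2) - Polynomial.X * Polynomial.C (a i 0)
      - Polynomial.X ^ 2 * Polynomial.C (a i 1)
  have hq : ∀ i, q i ≠ 0 := by
    intro i h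
    apply ha i
    funext j
    have c0 := congrArg (fun p => Polynomial.coeff p 0) h
    have c1 := congrArg (fun p => Polynomial.coeff p 1) h
    have c2 := congrArg (fun p => Polynomial.coeff p 2) h
    simp [q, Polynomial.coeff_X, Polynomial.coeff_C, Polynomial.coeff_X_pow] at c0 c1 c2
    fin_cases j
    · simpa using c1
    · simpa using c2
    · simpa using c0
  have hprod : ∏ i, q i ≠ 0 := Finset.prod_ne_zero_iff.mpr fun i _ => hq i
  obtain ⟨s, hs⟩ : ∃ s, Polynomial.eval s (∏ i, q i) ≠ 0 := by
    by_contra! hc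
    exact hprod (Polynomial.funext (by simpa using hc))
  refine ⟨s, s ^ 2, fun i hi => ?_⟩
  rw [Polynomial.eval_prod] at hs
  apply Finset.prod_ne_zero_iff.mp hs i (Finset.mem_univ i)
  simp only [q, Polynomial.eval_sub, Polynomial.eval_mul, Polynomial.eval_C, Polynomial.eval_X,
    Polynomial.eval_pow]
  linear_combination hi

attribute [local instance] MvPolynomial.gradedAlgebra

theorem component_mem {k : Type} [Field k] (G H : MvPolynomial (Fin 3) k) (dG dH : ℕ)
    (hG : G.IsHomogeneous dG) (hH : H.IsHomogeneous dH) (p : MvPolynomial (Fin 3) k)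
    (hp : p ∈ Ideal.span {G, H}) (e : ℕ) :
    homogeneousComponent e p ∈ Ideal.span {G, H} := by
  have h : (Ideal.span {G, H}).IsHomogeneous (homogeneousSubmodule (Fin 3) k) := by
    apply Ideal.homogeneous_span
    rintro x (rfl | rfl)
    · exact ⟨dG, hG⟩
    · exact ⟨dH, hH⟩
  have := h e hp
  rwa [show ((DirectSum.decompose (homogeneousSubmodule (Fin 3) k) p e :
    homogeneousSubmodule (Fin 3) k e) : MvPolynomial (Fin 3) k) = homogeneousComponent e p from
    decomposition.decompose'_apply p e] at this

/-- If two homogeneous forms `G, H` in three variables intersect transversally exactly in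
the points `a₁, …, a_r` of `ℙ²`, then the intersection of the homogeneous ideals of
these points equals the ideal `(G, H)`. -/
theorem stmt_11 (k : Type) [Field k] [IsAlgClosed k] [CharZero k]
    (G H : MvPolynomial (Fin 3) k) (dG dH : ℕ)
    (hG : G.IsHomogeneous dG) (hH : H.IsHomogeneous dH)
    (r : ℕ) (a : Fin r → (Fin 3 → k)) (ha : ∀ i, a i ≠ 0)
    (hdistinct : ∀ i j, i ≠ j → ∀ c : k, a i ≠ c • a j)
    (hzeros : ∀ x : Fin 3 → k, x ≠ 0 →
      ((eval x G = 0 ∧ eval x H = 0) ↔ ∃ i, ∃ c : k, x = c • a i))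
    (htransversal : ∀ i, LinearIndependent k
      ![fun j => eval (a i) (pderiv j G), fun j => eval (a i) (pderiv j H)]) :
    {p : MvPolynomial (Fin 3) k |
        ∀ i, ∀ e : ℕ, eval (a i) (homogeneousComponent e p) = 0}
      = ↑(Ideal.span {G, H}) := by
  ext p
  simp only [Set.mem_setOf_eq, SetLike.mem_coe]
  have haz : ∀ i, eval (a i) G = 0 ∧ eval (a i) H = 0 := fun i =>
    (hzeros (a i) (ha i)).mpr ⟨i, 1, by simp⟩
  constructor
  · intro hp
    rw [← sum_homogeneousComponent p]
    refine Ideal.sum_mem _ fun e _ => ?_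
    have hf : (homogeneousComponent e p).IsHomogeneous e := homogeneousComponent_isHomogeneous e p
    have hfa : ∀ i, eval (a i) (homogeneousComponent e p) = 0 := fun i => hp i e
    generalize homogeneousComponent e p = f at hf hfa
    obtain ⟨s, t, hst⟩ := exists_linear a ha
    have hnz := nzd_step G H s t (by
      intro x h1 h2 h3
      by_contra hx
      obtain ⟨i, c, rfl⟩ := (hzeros x hx).mp ⟨h1, h2⟩
      have hc : c ≠ 0 := by
        rintro rfl
        simp at hx
      apply hst i
      simp only [Pi.smul_apply, smul_eq_mul] at h3
      apply mul_left_cancel₀ hc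
      linear_combination h3)
    set L : MvPolynomial (Fin 3) k := X 2 - (C s * X 0 + C t * X 1) with hL
    let K : Ideal (MvPolynomial (Fin 3) k) :=
      Submodule.comap (LinearMap.mulRight (MvPolynomial (Fin 3) k) f) (Ideal.span {G, H})
    have hK : ∀ q, q ∈ K ↔ q * f ∈ Ideal.span {G, H} := fun q => Iff.rfl
    have hLK : L ∈ K.radical := by
      rw [← vanishingIdeal_zeroLocus_eq_radical (K := k), mem_vanishingIdeal_iff]
      intro x hx
      rw [mem_zeroLocus_iff] at hx
      have hx0 : x = 0 := by
        by_contra hx0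
        have h1 := hx G ((hK G).mpr (Ideal.mul_mem_right _ _ (Ideal.subset_span (by simp))))
        have h2 := hx H ((hK H).mpr (Ideal.mul_mem_right _ _ (Ideal.subset_span (by simp))))
        rw [MvPolynomial.aeval_eq_eval] at h1 h2
        obtain ⟨i, c, rfl⟩ := (hzeros x hx0).mp ⟨h1, h2⟩
        have hc : c ≠ 0 := by
          rintro rfl
          simp at hx0
        obtain ⟨D, hD, hDf⟩ := local_step G H dG dH hG hH (c • a i) hx0 h1 h2 (by
          have ht := htransversal i
          rw [LinearIndependent.pair_iff] at ht ⊢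
          intro u v huv
          have := ht (u * c ^ (dG - 1)) (v * c ^ (dH - 1)) (by
            rw [← huv]
            funext j
            simp only [Pi.add_apply, Pi.smul_apply, smul_eq_mul]
            rw [hom_eval_smul hG.pderiv, hom_eval_smul hH.pderiv]
            ring)
          simpa [hc] using this) f e hf (by rw [hom_eval_smul hf, hfa i, mul_zero])
        exact hD (hx D ((hK D).mpr hDf))
      simp [hx0, hL]
    obtain ⟨N, hN⟩ := hLK
    rw [hK] at hN
    induction N with
    | zero => simpa using hN
    | succ N ih =>
      apply ih
      apply hnz
      rwa [← mul_assoc, ← pow_succ']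
  · intro hp i e
    obtain ⟨A, B, hAB⟩ := Ideal.mem_span_pair.mp (component_mem G H dG dH hG hH p hp e)
    rw [← hAB]
    simp [haz i]
end

section
/- Fix integers d ≥ e ≥ 1, and let Ess_{d,e} denote the set of forms F ∈ S_d that are not annihilated by any nonzero element of S*_e; Ess_{d,e} is Zariski open in S_d. Then the subset of those F ∈ Ess_{d,e} for which the linear system (F^⊥)_{d-e} has a base point in P(S_1) is Zariski closed in Ess_{d,e}. -/
open MvPolynomial

namespace Stmt13

/-- exponents of degree `m` -/
abbrev Ex (n m : ℕ) : Type := {s : Fin n →₀ ℕ // s.degree = m}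

noncomputable instance (n m : ℕ) : Fintype (Ex n m) := by
  have : Set.Finite {s : Fin n →₀ ℕ | s.degree = m} := by
    refine Set.Finite.subset (Finset.finite_toSet (Finset.finsuppAntidiag Finset.univ m)) ?_
    intro s hs
    replace hs : s.degree = m := hs
    simp only [Finset.mem_coe, Finset.mem_finsuppAntidiag, Finset.subset_univ, and_true]
    rw [← hs, Finsupp.degree_eq_sum]
  exact this.fintype

variable {k : Type} [Field k] {n : ℕ}

/-- product of factorials -/
def fac (s : Fin n →₀ ℕ) : ℕ := ∏ i, (s i).factorial

lemma fac_ne [CharZero k] (s : Fin n →₀ ℕ) : (fac s : k) ≠ 0 := by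
  unfold fac
  exact_mod_cast Finset.prod_ne_zero_iff.2 fun i _ => Nat.factorial_ne_zero _

lemma fac_single (s : Fin n →₀ ℕ) (i : Fin n) :
    fac (s + Finsupp.single i 1) = (s i + 1) * fac s := by
  classical
  unfold fac
  rw [← Finset.mul_prod_erase _ _ (Finset.mem_univ i),
    ← Finset.mul_prod_erase _ (fun j => (s j).factorial) (Finset.mem_univ i)]
  simp only [Finsupp.add_apply, Finsupp.single_eq_same, Nat.factorial_succ]
  rw [mul_assoc]
  congr 2
  refine Finset.prod_congr rfl fun j hj => ?_
  have : j ≠ i := Finset.ne_of_mem_erase hj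
  simp [Finsupp.single_apply, this.symm]

/-- normalized coefficients -/
def nc (F : MvPolynomial (Fin n) k) (s : Fin n →₀ ℕ) : k := (fac s : k) * coeff s F

lemma nc_pderiv (F : MvPolynomial (Fin n) k) (s : Fin n →₀ ℕ) (i : Fin n) :
    nc (pderiv i F) s = nc F (s + Finsupp.single i 1) := by
  unfold nc
  rw [coeff_pderiv, fac_single]
  push_cast
  ring

lemma nc_iter (F : MvPolynomial (Fin n) k) (s : Fin n →₀ ℕ) (i : Fin n) (m : ℕ) :
    nc ((fun H => pderiv i H)^[m] F) s = nc F (s + Finsupp.single i m) := by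
  induction m generalizing s with
  | zero => simp
  | succ m ih =>
    rw [Function.iterate_succ_apply', nc_pderiv, ih, add_assoc, ← Finsupp.single_add, add_comm 1 m]

lemma nc_foldr (F : MvPolynomial (Fin n) k) (t : Fin n →₀ ℕ) (l : List (Fin n))
    (s : Fin n →₀ ℕ) :
    nc (l.foldr (fun i G => (fun H => pderiv i H)^[t i] G) F) s =
      nc F (s + (l.map fun i => Finsupp.single i (t i)).sum) := by
  induction l generalizing s with
  | nil => simp
  | cons a l ih =>
    rw [List.foldr_cons, nc_iter, ih, List.map_cons, List.sum_cons, add_assoc]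

lemma sum_finRange (t : Fin n →₀ ℕ) :
    ((List.finRange n).map fun i => Finsupp.single i (t i)).sum = t := by
  rw [← List.ofFn_eq_map, List.sum_ofFn]
  exact Finsupp.univ_sum_single t

lemma sum_ex (m : ℕ) {D : MvPolynomial (Fin n) k} (hD : D.IsHomogeneous m)
    {A : Type} [AddCommMonoid A] (f : (Fin n →₀ ℕ) → A) (hf : ∀ s, coeff s D = 0 → f s = 0) :
    ∑ s ∈ D.support, f s = ∑ b : Ex n m, f b.1 := by
  classical
  refine Finset.sum_bij_ne_zero (fun s hs _ => ⟨s, ?_⟩) ?_ ?_ ?_ ?_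
  · have := hD (mem_support_iff.1 hs)
    rwa [Pi.one_def, ← Finsupp.degree_eq_weight_one] at this
  · simp
  · intro a _ _ b _ _ h
    simpa using h
  · intro b _ hb
    refine ⟨b.1, ?_, hb, rfl⟩
    rw [mem_support_iff]
    exact fun h => hb (hf _ h)
  · simp

lemma nc_contract {m : ℕ} {D : MvPolynomial (Fin n) k} (hD : D.IsHomogeneous m)
    (F : MvPolynomial (Fin n) k) (s : Fin n →₀ ℕ) :
    nc (contract D F) s = ∑ b : Ex n m, coeff b.1 D * nc F (s + b.1) := by
  rw [← sum_ex m hD (fun t => coeff t D * nc F (s + t)) (by intro s hs; simp [hs])]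
  unfold contract
  conv_lhs => rw [nc, coeff_sum, Finset.mul_sum]
  refine Finset.sum_congr rfl fun t _ => ?_
  have := nc_foldr F t (List.finRange n) s
  rw [sum_finRange] at this
  rw [← this, nc, coeff_smul, smul_eq_mul]
  ring

lemma contract_eq_zero_iff [CharZero k] {c e : ℕ} {D : MvPolynomial (Fin n) k}
    (hD : D.IsHomogeneous c) {F : MvPolynomial (Fin n) k} (hF : F.IsHomogeneous (e + c)) :
    contract D F = 0 ↔ ∀ t : Ex n e, ∑ b : Ex n c, coeff b.1 D * nc F (t.1 + b.1) = 0 := by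
  constructor
  · intro h t
    rw [← nc_contract hD, h]
    simp [nc]
  · intro h
    ext s
    rw [coeff_zero]
    have key : nc (contract D F) s = 0 := by
      rw [nc_contract hD]
      by_cases hs : s.degree = e
      · exact h ⟨s, hs⟩
      · refine Finset.sum_eq_zero fun b _ => ?_
        have : coeff (s + b.1) F = 0 := by
          apply hF.coeff_eq_zero
          rw [map_add, b.2]
          omega
        simp [nc, this]
    exact (mul_eq_zero.1 key).resolve_left (fac_ne s)

/-- polynomial with given coefficients -/
noncomputable def toP {m : ℕ} (v : Ex n m → k) : MvPolynomial (Fin n) k := ∑ b, monomial b.1 (v b)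

lemma coeff_toP {m : ℕ} (v : Ex n m → k) (b : Ex n m) : coeff b.1 (toP v) = v b := by
  classical
  simp only [toP, coeff_sum, coeff_monomial]
  rw [Finset.sum_eq_single b]
  · simp
  · intro c _ hc
    rw [if_neg]
    exact fun h => hc (Subtype.ext h)
  · simp

lemma toP_hom {m : ℕ} (v : Ex n m → k) : (toP v).IsHomogeneous m :=
  IsHomogeneous.sum _ _ _ fun b _ => isHomogeneous_monomial _ b.2

lemma toP_coeff {m : ℕ} {D : MvPolynomial (Fin n) k} (hD : D.IsHomogeneous m) :
    toP (fun b : Ex n m => coeff b.1 D) = D := by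
  unfold toP
  rw [← sum_ex m hD (fun s => monomial s (coeff s D)) (by intro s hs; simp [hs])]
  exact D.support_sum_monomial_coeff

/-- kernel vectors -/
def Ker (F : MvPolynomial (Fin n) k) (c e : ℕ) : Set (Ex n c → k) :=
  {v | ∀ t : Ex n e, ∑ b : Ex n c, v b * nc F (t.1 + b.1) = 0}

open Classical in
/-- the big matrix -/
noncomputable def Mat (c e r : ℕ) (F : MvPolynomial (Fin n) k) :
    Matrix (Ex n (r + c) ⊕ (Ex n r × Ex n e)) (Ex n r × Ex n c) k :=
  fun j p => match j with
  | Sum.inl g => if p.1.1 + p.2.1 = g.1 then 1 else 0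
  | Sum.inr q => if q.1 = p.1 then nc F (q.2.1 + p.2.1) else 0

lemma nc_mem (s : Fin n →₀ ℕ) : (fun F : MvPolynomial (Fin n) k => nc F s) ∈ PolyFun n k := by
  have h : (fun F : MvPolynomial (Fin n) k => coeff s F) ∈ PolyFun n k :=
    Algebra.subset_adjoin ⟨s, rfl⟩
  have := (PolyFun n k).smul_mem h (fac s : k)
  exact this

lemma Mat_mem (c e r : ℕ) (j) (p) :
    (fun F : MvPolynomial (Fin n) k => Mat c e r F j p) ∈ PolyFun n k := by
  classical
  cases j with
  | inl g =>
    by_cases h : p.1.1 + p.2.1 = g.1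
    · simp only [Mat, h, if_true]; exact one_mem _
    · simp only [Mat, h, if_false]; exact zero_mem _
  | inr q =>
    by_cases h : q.1 = p.1
    · simp only [Mat, h, if_true]; exact nc_mem _
    · simp only [Mat, h, if_false]; exact zero_mem _

lemma det_mem {X I J : Type} [Fintype I] [Fintype J] [DecidableEq J]
    (A : Subalgebra k (X → k)) (M : X → Matrix J I k)
    (hM : ∀ j i, (fun x => M x j i) ∈ A) (N : Matrix I J k) :
    (fun x => (M x * N).det) ∈ A := by
  have : (fun x => (M x * N).det) = ∑ σ : Equiv.Perm J,
      (((Equiv.Perm.sign σ : ℤ) : k)) • ∏ i, ∑ p, N p i • (fun x => M x (σ i) p) := by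
    funext x
    rw [Matrix.det_apply']
    simp only [Finset.sum_apply, Finset.prod_apply, Matrix.mul_apply, Pi.smul_apply, smul_eq_mul]
    refine Finset.sum_congr rfl fun σ _ => ?_
    congr 1
    refine Finset.prod_congr rfl fun i _ => Finset.sum_congr rfl fun p _ => mul_comm _ _
  rw [this]
  exact sum_mem fun σ _ => A.smul_mem (prod_mem fun i _ => sum_mem fun p _ =>
    A.smul_mem (hM _ _) _) _

open Classical in
/-- The equations -/
noncomputable def eqn (c e r : ℕ) (N : Matrix (Ex n r × Ex n c) (Ex n (r + c) ⊕ (Ex n r × Ex n e)) k) :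
    MvPolynomial (Fin n) k → k := fun F => (Mat c e r F * N).det

lemma eqn_mem (c e r : ℕ)
    (N : Matrix (Ex n r × Ex n c) (Ex n (r + c) ⊕ (Ex n r × Ex n e)) k) :
    eqn c e r N ∈ PolyFun n k := by
  classical
  exact det_mem _ (fun F => Mat c e r F) (Mat_mem c e r) N

lemma surj_iff (c e r : ℕ) (F : MvPolynomial (Fin n) k) :
    (∀ y, ∃ w, (Mat c e r F).mulVec w = y) ↔ ∃ N, eqn c e r N F ≠ 0 := by
  classical
  constructor
  · intro h
    choose g hg using h
    refine ⟨Matrix.of fun p j => g (Pi.single j 1) p, ?_⟩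
    have : Mat c e r F * (Matrix.of fun p j => g (Pi.single j 1) p) = 1 := by
      ext i j
      have := congrFun (hg (Pi.single j 1)) i
      rw [Matrix.mul_apply, Matrix.one_apply, ]
      simp only [Matrix.mulVec, dotProduct, Pi.single_apply] at this
      simpa using this
    have h2 : (Mat c e r F * (Matrix.of fun p j => g (Pi.single j 1) p)).det = 1 := by
      rw [this, Matrix.det_one]
    unfold eqn
    intro h0
    apply one_ne_zero (α := k)
    rw [← h2]
    convert h0
  · rintro ⟨N, hN⟩ y
    have hu : IsUnit (Mat c e r F * N).det := by
      refine IsUnit.mk0 _ ?_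
      unfold eqn at hN
      convert hN
    refine ⟨N.mulVec ((Mat c e r F * N)⁻¹.mulVec y), ?_⟩
    rw [Matrix.mulVec_mulVec, Matrix.mulVec_mulVec, Matrix.mul_nonsing_inv _ hu, Matrix.one_mulVec]

lemma mulVec_inr (c e r : ℕ) (F : MvPolynomial (Fin n) k) (w) (a : Ex n r) (t : Ex n e) :
    (Mat c e r F).mulVec w (Sum.inr (a, t)) = ∑ b : Ex n c, w (a, b) * nc F (t.1 + b.1) := by
  classical
  simp only [Matrix.mulVec, dotProduct, Mat, Fintype.sum_prod_type]
  rw [Finset.sum_eq_single a]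
  · simp [mul_comm]
  · intro b _ hb
    simp [hb.symm]
  · simp

/-- the product polynomial -/
noncomputable def mu {c r : ℕ} (w : Ex n r × Ex n c → k) : MvPolynomial (Fin n) k :=
  ∑ a : Ex n r, monomial a.1 1 * toP fun b => w (a, b)

lemma mu_hom {c r : ℕ} (w : Ex n r × Ex n c → k) : (mu w).IsHomogeneous (r + c) :=
  IsHomogeneous.sum _ _ _ fun a _ => (isHomogeneous_monomial _ a.2).mul (toP_hom _)

lemma mulVec_inl (c e r : ℕ) (F : MvPolynomial (Fin n) k) (w) (g : Ex n (r + c)) :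
    (Mat c e r F).mulVec w (Sum.inl g) = coeff g.1 (mu w) := by
  classical
  simp only [Matrix.mulVec, dotProduct, Mat, Fintype.sum_prod_type, mu, toP, Finset.mul_sum,
    monomial_mul, coeff_sum, coeff_monomial]
  refine Finset.sum_congr rfl fun a _ => Finset.sum_congr rfl fun b _ => ?_
  simp

lemma mu_add {c r : ℕ} (w w' : Ex n r × Ex n c → k) : mu (w + w') = mu w + mu w' := by
  simp [mu, toP, Finset.sum_add_distrib, mul_add]

lemma mu_zero {c r : ℕ} : mu (0 : Ex n r × Ex n c → k) = 0 := by
  simp [mu, toP]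

/-- no base point if surjective -/
lemma no_base (c e r : ℕ) (F : MvPolynomial (Fin n) k)
    (h : ∀ y, ∃ w, (Mat c e r F).mulVec w = y) (x : Fin n → k) (hx : x ≠ 0)
    (hb : ∀ v ∈ Ker F c e, eval x (toP v) = 0) : False := by
  classical
  obtain ⟨i, hi⟩ : ∃ i, x i ≠ 0 := by
    by_contra! h
    exact hx (funext h)
  let g : Ex n (r + c) := ⟨Finsupp.single i (r + c), by simp⟩
  obtain ⟨w, hw⟩ := h (Pi.single (Sum.inl g) 1)
  have h1 : mu w = monomial g.1 1 := by
    rw [← toP_coeff (mu_hom w), ← toP_coeff (isHomogeneous_monomial (1 : k) g.2)]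
    congr 1
    funext b
    rw [← mulVec_inl c e r F, hw]
    by_cases hbg : b = g
    · subst hbg; simp
    · have : g.1 ≠ b.1 := fun h => hbg (Subtype.ext h.symm)
      simp [coeff_monomial, hbg, this]
  have h2 : eval x (mu w) = 0 := by
    rw [mu, map_sum]
    refine Finset.sum_eq_zero fun a _ => ?_
    rw [map_mul, hb, mul_zero]
    intro t
    rw [← mulVec_inr c e r F w a t, hw]
    simp
  rw [h1] at h2
  rw [eval_monomial, one_mul] at h2
  replace h2 : (Finsupp.single i (r + c)).prod (fun n e => x n ^ e) = 0 := h2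
  rw [Finsupp.prod_single_index (by simp)] at h2
  exact pow_ne_zero _ hi h2

lemma exists_mu (F : MvPolynomial (Fin n) k) (c e r : ℕ) (p : MvPolynomial (Fin n) k)
    (hp : p ∈ Ideal.span (toP '' Ker F c e)) :
    ∃ w : Ex n r × Ex n c → k, (∀ a, (fun b => w (a, b)) ∈ Ker F c e) ∧
      mu w = homogeneousComponent (r + c) p := by
  classical
  have hz : (0 : Ex n c → k) ∈ Ker F c e := by intro t; simp
  have hadd : ∀ p q : MvPolynomial (Fin n) k,
    (∃ w : Ex n r × Ex n c → k, (∀ a, (fun b => w (a, b)) ∈ Ker F c e) ∧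
      mu w = homogeneousComponent (r + c) p) →
    (∃ w : Ex n r × Ex n c → k, (∀ a, (fun b => w (a, b)) ∈ Ker F c e) ∧
      mu w = homogeneousComponent (r + c) q) →
    (∃ w : Ex n r × Ex n c → k, (∀ a, (fun b => w (a, b)) ∈ Ker F c e) ∧
      mu w = homogeneousComponent (r + c) (p + q)) := by
    rintro p q ⟨w, h1, h2⟩ ⟨w', h3, h4⟩
    refine ⟨w + w', fun a t => ?_, ?_⟩
    · simp only [Pi.add_apply, add_mul, Finset.sum_add_distrib]
      rw [h1 a t, h3 a t, add_zero]
    · rw [mu_add, h2, h4, map_add]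
  refine Submodule.closure_induction (p := fun p _ => ∃ w : Ex n r × Ex n c → k,
    (∀ a, (fun b => w (a, b)) ∈ Ker F c e) ∧ mu w = homogeneousComponent (r + c) p)
    ?_ (fun p q _ _ => hadd p q) ?_ hp
  · exact ⟨0, fun a => hz, by rw [mu_zero, map_zero]⟩
  · rintro q _ ⟨v, hv, rfl⟩
    rw [smul_eq_mul]
    induction q using MvPolynomial.induction_on' with
    | add p q hp hq => rw [add_mul]; exact hadd _ _ hp hq
    | monomial s u =>
      have hh : (monomial s u * toP v).IsHomogeneous (s.degree + c) :=
        (isHomogeneous_monomial u rfl).mul (toP_hom v)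
      rw [homogeneousComponent_of_mem hh]
      by_cases hs : s.degree = r
      · rw [if_pos (by omega)]
        refine ⟨fun p => if p.1 = ⟨s, hs⟩ then u * v p.2 else 0, fun a t => ?_, ?_⟩
        · by_cases ha : a = ⟨s, hs⟩
          · simp only [ha, if_true, mul_assoc, ← Finset.mul_sum]
            rw [hv t, mul_zero]
          · simp [ha]
        · rw [mu, Finset.sum_eq_single ⟨s, hs⟩]
          · simp [toP, Finset.mul_sum, monomial_mul]
          · intro a _ ha
            simp [ha, toP]
          · simp
      · rw [if_neg (by omega)]
        exact ⟨0, fun a => hz, mu_zero⟩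

lemma exists_surj [IsAlgClosed k] (c e : ℕ) (F : MvPolynomial (Fin n) k)
    (hH : ∀ z : Ex n e → k, ∃ v : Ex n c → k, ∀ t, ∑ b : Ex n c, v b * nc F (t.1 + b.1) = z t)
    (hb : ∀ x : Fin n → k, (∀ v ∈ Ker F c e, eval x (toP v) = 0) → x = 0) :
    ∃ r, ∀ y, ∃ w, (Mat c e r F).mulVec w = y := by
  classical
  set I := Ideal.span (toP '' Ker F c e) with hI
  have h1 : idealOfVars (Fin n) k ≤ I.radical := by
    rw [← vanishingIdeal_zeroLocus_eq_radical (K := k), idealOfVars, Ideal.span_le]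
    rintro _ ⟨i, rfl⟩
    rw [SetLike.mem_coe, mem_vanishingIdeal_iff]
    intro x hx
    rw [hI, zeroLocus_span] at hx
    have : x = 0 := hb x fun v hv => by
      have := hx _ ⟨v, hv, rfl⟩
      simpa [aeval_eq_eval] using this
    simp [this]
  obtain ⟨r, hr⟩ := Ideal.exists_pow_le_of_le_radical_of_fg h1 (idealOfVars_fg _ _)
  refine ⟨r, fun y => ?_⟩
  choose v0 hv0 using fun a : Ex n r => hH fun t => y (Sum.inr (a, t))
  let w0 : Ex n r × Ex n c → k := fun p => v0 p.1 p.2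
  let u : MvPolynomial (Fin n) k := toP (fun g : Ex n (r + c) => y (Sum.inl g)) - mu w0
  have hu : u.IsHomogeneous (r + c) := (toP_hom _).sub (mu_hom _)
  have huI : u ∈ I := by
    apply hr
    rw [mem_pow_idealOfVars_iff']
    intro s hs
    apply hu.coeff_eq_zero
    omega
  obtain ⟨w, hw, hw2⟩ := exists_mu F c e r u huI
  rw [homogeneousComponent_of_mem hu, if_pos rfl] at hw2
  refine ⟨w0 + w, ?_⟩
  ext j
  cases j with
  | inl g =>
    rw [mulVec_inl, mu_add, hw2]
    simp only [u, add_sub_cancel]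
    rw [coeff_toP (fun g : Ex n (r + c) => y (Sum.inl g))]
  | inr q =>
    obtain ⟨a, t⟩ := q
    rw [mulVec_inr]
    simp only [Pi.add_apply, add_mul, Finset.sum_add_distrib]
    rw [hw a t, add_zero]
    exact hv0 a t

lemma hankel_surj [CharZero k] (c e : ℕ) (F : MvPolynomial (Fin n) k)
    (hF : F.IsHomogeneous (c + e))
    (h : ∀ D : MvPolynomial (Fin n) k, D.IsHomogeneous e → contract D F = 0 → D = 0)
    (z : Ex n e → k) :
    ∃ v : Ex n c → k, ∀ t, ∑ b : Ex n c, v b * nc F (t.1 + b.1) = z t := by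
  classical
  let H : Matrix (Ex n c) (Ex n e) k := Matrix.of fun b t => nc F (t.1 + b.1)
  have hinj : LinearMap.ker H.mulVecLin = ⊥ := by
    rw [LinearMap.ker_eq_bot']
    intro v hv
    have h0 : toP v = 0 := by
      refine h _ (toP_hom v) ((contract_eq_zero_iff (toP_hom v) hF).2 fun b => ?_)
      have := congrFun hv b
      simp only [Matrix.mulVecLin_apply, Matrix.mulVec, dotProduct, H, Matrix.of_apply,
        Pi.zero_apply] at this
      rw [← this]
      refine Finset.sum_congr rfl fun t _ => ?_
      rw [coeff_toP, mul_comm, add_comm]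
    funext t
    rw [← coeff_toP v t, h0]
    simp
  obtain ⟨g, hg⟩ := LinearMap.exists_leftInverse_of_injective _ hinj
  have hL : LinearMap.toMatrix' g * H = 1 := by
    have := congrArg LinearMap.toMatrix' hg
    rw [LinearMap.toMatrix'_comp, LinearMap.toMatrix'_id] at this
    rw [← this]
    congr 1
    exact (LinearMap.toMatrix'_toLin' H).symm
  refine ⟨Matrix.vecMul z (LinearMap.toMatrix' g), fun t => ?_⟩
  have : Matrix.vecMul (Matrix.vecMul z (LinearMap.toMatrix' g)) H t = z t := by
    rw [Matrix.vecMul_vecMul, hL, Matrix.vecMul_one]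
  exact this

end Stmt13

/-- Fix `d ≥ e ≥ 1`. Within the set `Ess_{d,e}` of degree-`d` forms not annihilated by any
nonzero element of `S*_e`, the subset of forms `F` such that `(F^⊥)_{d-e}` has a base
point in `ℙ(S₁)` is Zariski closed (it is `Ess_{d,e}` intersected with the common zero
locus of a family of polynomial functions on `S_d`). -/
theorem stmt_13 (k : Type) [Field k] [IsAlgClosed k] [CharZero k]
    (n d e : ℕ) (he : 1 ≤ e) (hed : e ≤ d) :
    ∃ P : Set (MvPolynomial (Fin n) k → k), (∀ f ∈ P, f ∈ PolyFun n k) ∧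
      {F : MvPolynomial (Fin n) k |
          (F.IsHomogeneous d ∧
            ∀ D : MvPolynomial (Fin n) k, D.IsHomogeneous e → contract D F = 0 → D = 0) ∧
          ∃ a : Fin n → k, a ≠ 0 ∧
            ∀ D : MvPolynomial (Fin n) k,
              D.IsHomogeneous (d - e) → contract D F = 0 → eval a D = 0}
        = {F : MvPolynomial (Fin n) k |
            (F.IsHomogeneous d ∧
              ∀ D : MvPolynomial (Fin n) k, D.IsHomogeneous e → contract D F = 0 → D = 0) ∧
            ∀ f ∈ P, f F = 0} := by
  obtain ⟨c, rfl⟩ := Nat.exists_eq_add_of_le hed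
  rw [Nat.add_sub_cancel_left]
  refine ⟨{f | ∃ r N, f = Stmt13.eqn c e r N}, ?_, ?_⟩
  · rintro _ ⟨r, N, rfl⟩
    exact Stmt13.eqn_mem c e r N
  · ext F
    refine and_congr_right ?_
    rintro ⟨hF, hess⟩
    constructor
    · rintro ⟨a, ha, hb⟩ _ ⟨r, N, rfl⟩
      by_contra hne
      refine Stmt13.no_base c e r F ((Stmt13.surj_iff c e r F).2 ⟨N, hne⟩) a ha fun v hv => ?_
      refine hb _ (Stmt13.toP_hom v) ((Stmt13.contract_eq_zero_iff (Stmt13.toP_hom v) hF).2 ?_)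
      intro t
      simp only [Stmt13.coeff_toP]
      exact hv t
    · intro h
      by_contra hno
      have hsurj := Stmt13.hankel_surj c e F (by rwa [add_comm]) hess
      obtain ⟨r, hr⟩ := Stmt13.exists_surj c e F hsurj (by
        intro x hx
        by_contra hx0
        refine hno ⟨x, hx0, fun D hD hDF => ?_⟩
        rw [← Stmt13.toP_coeff hD]
        exact hx _ ((Stmt13.contract_eq_zero_iff hD hF).1 hDF))
      obtain ⟨N, hN⟩ := (Stmt13.surj_iff c e r F).1 hr
      exact hN (h _ ⟨r, N, rfl⟩)
end

section
/- Let S = k[x_1, x_2, x_3] and let F ∈ S_3 be a cubic form such that the degree-2 part (F^⊥)_2 of its apolar ideal has empty common zero locus in P(S_1). Then for every homogeneous Zariski-closed proper subset V ⊊ S_1 there exist an integer m ≤ 4 and linear forms l_1,…,l_m ∈ S_1 \ V with F = Σ_{i=1}^m l_i³. -/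
open MvPolynomial

/-- A binary quadratic form over an algebraically closed field has a nontrivial zero. -/
lemma exists_quad_zero {k : Type} [Field k] [IsAlgClosed k] [CharZero k] (A B C : k) :
    ∃ x y : k, (x ≠ 0 ∨ y ≠ 0) ∧ A * x ^ 2 + B * x * y + C * y ^ 2 = 0 := by
  by_cases hA : A = 0
  · exact ⟨1, 0, Or.inl one_ne_zero, by simp [hA]⟩
  · obtain ⟨s, hs⟩ := IsAlgClosed.exists_pow_nat_eq (B ^ 2 - 4 * A * C) (n := 2) (by norm_num)
    refine ⟨-B + s, 2 * A, Or.inr (by simp [hA]), ?_⟩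
    linear_combination A * hs

/-- A singular symmetric `2 × 2` matrix has a nontrivial kernel. -/
lemma exists_ker_two {k : Type} [Field k] (p q r : k) (h : p * r = q ^ 2) :
    ∃ x y : k, (x ≠ 0 ∨ y ≠ 0) ∧ p * x + q * y = 0 ∧ q * x + r * y = 0 := by
  by_cases hp : p = 0
  · have hq : q = 0 := by
      have : q ^ 2 = 0 := by rw [← h, hp, zero_mul]
      exact pow_eq_zero_iff (two_ne_zero) |>.1 this
    exact ⟨1, 0, Or.inl one_ne_zero, by simp [hp], by simp [hq]⟩
  · exact ⟨q, -p, Or.inr (by simpa using hp), by ring, by linear_combination -h⟩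

/-- The binary cubic `αx³ + 3δx²z + 3εxz² + cz³` with `αε ≠ δ²` is, for all but finitely many
`c`, a sum of two cubes of linear forms `s(x + τz)` with `s ≠ 0` and `τ` not a root of `g`. -/
lemma binary_cubic {k : Type} [Field k] [IsAlgClosed k] [CharZero k] (α δ ε : k)
    (h : α * ε - δ ^ 2 ≠ 0) (g : Polynomial k) (hg : g ≠ 0) :
    ∃ E : Set k, E.Finite ∧ ∀ c, c ∉ E → ∃ s₁ τ₁ s₂ τ₂ : k,
      s₁ ≠ 0 ∧ s₂ ≠ 0 ∧ g.eval τ₁ ≠ 0 ∧ g.eval τ₂ ≠ 0 ∧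
      α = s₁ ^ 3 + s₂ ^ 3 ∧ δ = s₁ ^ 3 * τ₁ + s₂ ^ 3 * τ₂ ∧
      ε = s₁ ^ 3 * τ₁ ^ 2 + s₂ ^ 3 * τ₂ ^ 2 ∧ c = s₁ ^ 3 * τ₁ ^ 3 + s₂ ^ 3 * τ₂ ^ 3 := by
  classical
  set Δ := α * ε - δ ^ 2 with hΔ
  let d : Polynomial k := (Polynomial.C α * Polynomial.X - Polynomial.C (δ * ε)) ^ 2
    - 4 * (Polynomial.C δ * Polynomial.X - Polynomial.C (ε ^ 2)) * Polynomial.C Δ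
  have hde : ∀ c, d.eval c = (α * c - δ * ε) ^ 2 - 4 * (δ * c - ε ^ 2) * Δ := by
    intro c; simp [d]
  have hd : d ≠ 0 := by
    intro hd0
    have e : ∀ c, (α * c - δ * ε) ^ 2 - 4 * (δ * c - ε ^ 2) * Δ = 0 := by
      intro c; rw [← hde, hd0, Polynomial.eval_zero]
    have e0 := e 0
    have e1 := e 1
    have e2 := e (-1)
    have hα : α = 0 := by
      have : 2 * α ^ 2 = 0 := by linear_combination e1 + e2 - 2 * e0
      simpa using this
    have hδ : δ ≠ 0 := by
      rintro rfl
      exact h (by simp [hΔ, hα])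
    have : δ ^ 3 = 0 := by
      have : 8 * δ ^ 3 = 0 := by
        rw [hΔ, hα] at e1 e2
        linear_combination e1 - e2
      simpa using this
    exact hδ (by simpa using this)
  let ℓ : k → Polynomial k := fun τ => Polynomial.C (δ - α * τ) * Polynomial.X +
    Polynomial.C (-ε ^ 2 + δ * ε * τ + Δ * τ ^ 2)
  have hℓe : ∀ τ c, (ℓ τ).eval c = Δ * τ ^ 2 - (α * c - δ * ε) * τ + (δ * c - ε ^ 2) := by
    intro τ c; simp [ℓ]; ring
  have hℓ : ∀ τ, ℓ τ ≠ 0 := by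
    intro τ h0
    have e : ∀ c, Δ * τ ^ 2 - (α * c - δ * ε) * τ + (δ * c - ε ^ 2) = 0 := by
      intro c; rw [← hℓe, h0, Polynomial.eval_zero]
    have e0 := e 0
    have e1 := e 1
    have h1 : δ = α * τ := by linear_combination e1 - e0
    have h2 : Δ ^ 2 = 0 := by
      have : α * Δ * τ ^ 2 + α * δ * ε * τ  - α * ε ^ 2 = 0 := by linear_combination α * e0
      rw [hΔ] at this ⊢
      rw [h1] at this ⊢
      linear_combination -α * this
    exact h (by simpa using h2)
  refine ⟨{c | d.eval c = 0} ∪ ⋃ τ ∈ (g.roots.toFinset : Set k), {c | (ℓ τ).eval c = 0}, ?_, ?_⟩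
  · refine Set.Finite.union ?_ (Set.Finite.biUnion (Finset.finite_toSet _) fun τ _ => ?_)
    · exact Polynomial.finite_setOfPred_isRoot hd
    · exact Polynomial.finite_setOfPred_isRoot (hℓ τ)
  intro c hc
  simp only [Set.mem_union, Set.mem_ofPred_eq, Set.mem_iUnion, not_or, not_exists] at hc
  obtain ⟨hc1, hc2⟩ := hc
  obtain ⟨r, hr⟩ := IsAlgClosed.exists_pow_nat_eq (d.eval c) (n := 2) (by norm_num)
  have hr0 : r ≠ 0 := by
    rintro rfl
    exact hc1 (by rw [← hr]; ring)
  rw [hde] at hr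
  have key : ∀ τ, Δ * τ ^ 2 - (α * c - δ * ε) * τ + (δ * c - ε ^ 2) = 0 → g.eval τ ≠ 0 := by
    intro τ hτ hgτ
    refine hc2 τ ?_ (by rw [hℓe, hτ])
    simp [hg, hgτ]
  obtain ⟨τ₁, hτ₁⟩ : ∃ τ, τ = ((α * c - δ * ε) + r) / (2 * Δ) := ⟨_, rfl⟩
  obtain ⟨τ₂, hτ₂⟩ : ∃ τ, τ = ((α * c - δ * ε) - r) / (2 * Δ) := ⟨_, rfl⟩
  have q₁ : Δ * τ₁ ^ 2 - (α * c - δ * ε) * τ₁ + (δ * c - ε ^ 2) = 0 := by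
    rw [hτ₁]; clear_value Δ; field_simp; linear_combination hr
  have q₂ : Δ * τ₂ ^ 2 - (α * c - δ * ε) * τ₂ + (δ * c - ε ^ 2) = 0 := by
    rw [hτ₂]; clear_value Δ; field_simp; linear_combination hr
  have hne : τ₁ - τ₂ ≠ 0 := by
    have : τ₁ - τ₂ = r / Δ := by rw [hτ₁, hτ₂]; clear_value Δ; field_simp; ring
    rw [this]; exact div_ne_zero hr0 h
  obtain ⟨r₁, hr₁⟩ : ∃ x, x = (δ - α * τ₂) / (τ₁ - τ₂) := ⟨_, rfl⟩
  obtain ⟨r₂, hr₂⟩ : ∃ x, x = (α * τ₁ - δ) / (τ₁ - τ₂) := ⟨_, rfl⟩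
  have eα : α = r₁ + r₂ := by rw [hr₁, hr₂]; field_simp; ring
  have eδ : δ = r₁ * τ₁ + r₂ * τ₂ := by rw [hr₁, hr₂]; field_simp; ring
  have eε : ε = r₁ * τ₁ ^ 2 + r₂ * τ₂ ^ 2 := by
    apply mul_left_cancel₀ h
    rw [hΔ] at q₁ q₂ ⊢
    linear_combination -r₁ * q₁ - r₂ * q₂ + (α * c - δ * ε) * eδ - (δ * c - ε ^ 2) * eα
  have ec : c = r₁ * τ₁ ^ 3 + r₂ * τ₂ ^ 3 := by
    apply mul_left_cancel₀ h
    rw [hΔ] at q₁ q₂ ⊢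
    linear_combination -r₁ * τ₁ * q₁ - r₂ * τ₂ * q₂ + (α * c - δ * ε) * eε - (δ * c - ε ^ 2) * eδ
  obtain ⟨s₁, hs₁⟩ := IsAlgClosed.exists_pow_nat_eq r₁ (n := 3) (by norm_num)
  obtain ⟨s₂, hs₂⟩ := IsAlgClosed.exists_pow_nat_eq r₂ (n := 3) (by norm_num)
  refine ⟨s₁, τ₁, s₂, τ₂, ?_, ?_, key _ q₁, key _ q₂, by rw [hs₁, hs₂, eα], by rw [hs₁, hs₂, eδ],
    by rw [hs₁, hs₂, eε], by rw [hs₁, hs₂, ec]⟩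
  · rintro rfl
    have : r₁ = 0 := by rw [← hs₁]; ring
    apply h
    rw [hΔ, eα, eδ, eε, this]; ring
  · rintro rfl
    have : r₂ = 0 := by rw [← hs₂]; ring
    apply h
    rw [hΔ, eα, eδ, eε, this]; ring

/-- Trilinear forms on `k³`. -/
abbrev Tri (k : Type) [Field k] : Type :=
  (Fin 3 → k) →ₗ[k] (Fin 3 → k) →ₗ[k] (Fin 3 → k) →ₗ[k] k

/-- Symmetric trilinear forms none of whose polars is a nonzero square. -/
structure GoodTri {k : Type} [Field k] (T : Tri k) : Prop where
  s12 : ∀ u v w, T u v w = T v u w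
  s23 : ∀ u v w, T u v w = T u w v
  nr : ∀ u (a : (Fin 3 → k) →ₗ[k] k), (∀ v w, T u v w = a v * a w) → a = 0

lemma exists_basis_pair {k : Type} [Field k] {v w : Fin 3 → k}
    (h : LinearIndependent k ![v, w]) :
    ∃ b : Module.Basis (Fin 3) k (Fin 3 → k), b 0 = v ∧ b 1 = w := by
  obtain ⟨z, hz⟩ := exists_linearIndependent_snoc_of_lt_finrank h (by simp)
  refine ⟨basisOfLinearIndependentOfCardEqFinrank hz (by simp), ?_, ?_⟩
  · rw [coe_basisOfLinearIndependentOfCardEqFinrank]; rfl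
  · rw [coe_basisOfLinearIndependentOfCardEqFinrank]; rfl

lemma basis_expand {k : Type} [Field k] (b : Module.Basis (Fin 3) k (Fin 3 → k))
    (u : Fin 3 → k) : u = b.coord 0 u • b 0 + b.coord 1 u • b 1 + b.coord 2 u • b 2 := by
  conv_lhs => rw [← b.sum_repr u]
  rw [Fin.sum_univ_three]; rfl

lemma indep_symm {k : Type} [Field k] {v w : Fin 3 → k}
    (h : LinearIndependent k ![v, w]) : LinearIndependent k ![w, v] :=
  LinearIndependent.pair_symm_iff.1 h

/-- A polar with two independent kernel vectors vanishes. -/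
lemma GoodTri.rank {k : Type} [Field k] [IsAlgClosed k] {T : Tri k} (hT : GoodTri T)
    {u v w : Fin 3 → k} (hvw : LinearIndependent k ![v, w]) (hv : T u v = 0) (hw : T u w = 0) :
    T u = 0 := by
  obtain ⟨b, rfl, rfl⟩ := exists_basis_pair hvw
  obtain ⟨d, hd⟩ := IsAlgClosed.exists_pow_nat_eq (T u (b 2) (b 2)) (n := 2) (by norm_num)
  have e : ∀ x y, T u x y = (d • b.coord 2) x * (d • b.coord 2) y := by
    intro x y
    have h1 : T u (b 2) (b 0) = 0 := by rw [hT.s23, hv]; rfl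
    have h2 : T u (b 2) (b 1) = 0 := by rw [hT.s23, hw]; rfl
    conv_lhs => rw [basis_expand b x, basis_expand b y]
    simp only [map_add, map_smul, LinearMap.add_apply, LinearMap.smul_apply, hv, hw, h1, h2, ← hd,
      LinearMap.zero_apply, smul_eq_mul]
    ring
  have h0 := hT.nr u _ e
  refine LinearMap.ext fun x => ?_
  refine LinearMap.ext fun y => ?_
  rw [e, h0]; simp

lemma GoodTri.concise {k : Type} [Field k] [IsAlgClosed k] [CharZero k] {T : Tri k}
    (hT : GoodTri T) {u : Fin 3 → k} (hu : u ≠ 0) (h : T u = 0) : T = 0 := by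
  obtain ⟨v, hv⟩ := exists_linearIndependent_pair_of_one_lt_finrank (R := k) (by simp) hu
  obtain ⟨b, rfl, -⟩ := exists_basis_pair hv
  obtain ⟨l, m, hlm, hq⟩ := exists_quad_zero
    (T (b 1) (b 1) (b 1) * T (b 1) (b 2) (b 2) - T (b 1) (b 1) (b 2) ^ 2)
    (T (b 1) (b 1) (b 1) * T (b 2) (b 2) (b 2) - T (b 1) (b 1) (b 2) * T (b 1) (b 2) (b 2))
    (T (b 1) (b 1) (b 2) * T (b 2) (b 2) (b 2) - T (b 1) (b 2) (b 2) ^ 2)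
  obtain ⟨x, y, hxy, h1, h2⟩ := exists_ker_two
    (l * T (b 1) (b 1) (b 1) + m * T (b 1) (b 1) (b 2))
    (l * T (b 1) (b 1) (b 2) + m * T (b 1) (b 2) (b 2))
    (l * T (b 1) (b 2) (b 2) + m * T (b 2) (b 2) (b 2)) (by linear_combination hq)
  have ind : ∀ c d : k, (c ≠ 0 ∨ d ≠ 0) → LinearIndependent k ![b 0, c • b 1 + d • b 2] := by
    intro c d hcd
    rw [LinearIndependent.pair_iff]
    intro s t hst
    have e0 := congrArg (b.coord 0) hst
    have e1 := congrArg (b.coord 1) hst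
    have e2 := congrArg (b.coord 2) hst
    simp at e0 e1 e2
    refine ⟨e0, ?_⟩
    rcases hcd with hc | hd
    · exact e1.resolve_right hc
    · exact e2.resolve_right hd
  have z0 : ∀ p, T p (b 0) = 0 := by
    intro p; refine LinearMap.ext fun q => ?_; rw [hT.s12, h]; rfl
  have s1 : T (b 2) (b 1) (b 1) = T (b 1) (b 1) (b 2) := by rw [hT.s12, hT.s23]
  have s2 : T (b 1) (b 2) (b 1) = T (b 1) (b 1) (b 2) := by rw [hT.s23]
  have s3 : T (b 2) (b 1) (b 2) = T (b 1) (b 2) (b 2) := by rw [hT.s12]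
  have s4 : T (b 2) (b 2) (b 1) = T (b 1) (b 2) (b 2) := by rw [hT.s23, hT.s12]
  have hz : T (l • b 1 + m • b 2) = 0 := by
    refine hT.rank (ind x y hxy) (z0 _) ?_
    apply b.ext
    intro i
    fin_cases i
    · simp only [Fin.zero_eta]
      rw [hT.s23, z0]; rfl
    · simp [s1, s2, s4]
      linear_combination h1
    · simp [s3]
      linear_combination h2
  refine LinearMap.ext fun p => ?_
  refine hT.rank (ind l m hlm) (z0 _) ?_
  refine LinearMap.ext fun q => ?_
  rw [hT.s12, hz]; rfl

/-- Uniqueness of the kernel of a degenerate polar. -/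
lemma GoodTri.ker_unique {k : Type} [Field k] [IsAlgClosed k] [CharZero k] {T : Tri k}
    (hT : GoodTri T) (hT0 : T ≠ 0) {u v w : Fin 3 → k} (hu : u ≠ 0) (hv : T u v = 0)
    (hw : T u w = 0) : ¬ LinearIndependent k ![v, w] :=
  fun hvw => hT0 (hT.concise hu (hT.rank hvw hv hw))

lemma GoodTri.comm0 {k : Type} [Field k] {T : Tri k}
    (hT : GoodTri T) {u v : Fin 3 → k} (h : T u v = 0) : T v u = 0 := by
  refine LinearMap.ext fun w => ?_; rw [hT.s12, h]

/-- Degenerate polars exist outside any finite set. -/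
lemma exists_hess {k : Type} [Field k] [IsAlgClosed k] [CharZero k] (T : Tri k)
    (B : Finset (Fin 3 → k)) (hB : ∀ b ∈ B, b ≠ 0) :
    ∃ u u' : Fin 3 → k, u ≠ 0 ∧ u' ≠ 0 ∧ T u u' = 0 ∧ ∀ b ∈ B, LinearIndependent k ![b, u] := by
  obtain ⟨f, hf⟩ := Module.exists_dual_forall_apply_ne_zero (K := k) (fun b : B => (b : Fin 3 → k))
    (fun b => hB b b.2)
  have hr : 1 < Module.finrank k (LinearMap.ker f) := by
    have h1 := LinearMap.finrank_range_add_finrank_ker f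
    have h2 : Module.finrank k (LinearMap.range f) ≤ 1 := by
      simpa using Submodule.finrank_le (LinearMap.range f)
    simp at h1
    omega
  have : Nontrivial (LinearMap.ker f) := Module.nontrivial_of_finrank_pos (R := k) (by omega)
  obtain ⟨v, hv⟩ := exists_ne (0 : LinearMap.ker f)
  obtain ⟨w, hvw⟩ := exists_linearIndependent_pair_of_one_lt_finrank hr hv
  suffices h : ∃ u : LinearMap.ker f, ∃ u', u ≠ 0 ∧ u' ≠ 0 ∧ T u u' = 0 by
    obtain ⟨u, u', hu, hu', h⟩ := h
    refine ⟨u, u', by simpa using hu, hu', h, fun b hb => ?_⟩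
    rw [LinearIndependent.pair_iff]
    intro s t hst
    have e := congrArg f hst
    have hu0 : f u = 0 := u.2
    simp [hu0] at e
    have hs : s = 0 := e.resolve_right (hf ⟨b, hb⟩)
    subst hs
    simp at hst
    exact ⟨rfl, hst.resolve_right hu⟩
  by_cases hw : Function.Injective (T w)
  · let e := LinearEquiv.ofInjectiveOfFinrankEq (T w) hw (by
      exact (Subspace.dual_finrank_eq (K := k) (V := Fin 3 → k)).symm)
    have he : ∀ x, e x = T w x := fun x => rfl
    obtain ⟨μ, hμ⟩ := Module.End.exists_eigenvalue (e.symm.toLinearMap ∘ₗ T v)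
    obtain ⟨x, hx⟩ := hμ.exists_hasEigenvector
    have h1 := hx.apply_eq_smul
    simp at h1
    rw [LinearEquiv.symm_apply_eq, map_smul, he] at h1
    refine ⟨v - μ • w, x, ?_, hx.2, by simp [h1]⟩
    intro h0
    have := LinearIndependent.pair_iff.1 hvw 1 (-μ) (by rw [← h0]; module)
    exact one_ne_zero this.1
  · rw [← LinearMap.ker_eq_bot, ← ne_eq, Submodule.ne_bot_iff] at hw
    obtain ⟨x, hx, hx0⟩ := hw
    refine ⟨w, x, ?_, hx0, hx⟩
    have := hvw.ne_zero 1
    simpa using this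

/-- `u` is good for `p` if `p` does not vanish identically on the plane orthogonal to `u`. -/
def GoodFor {k : Type} [Field k] (p : MvPolynomial (Fin 3) k) (u : Fin 3 → k) : Prop :=
  ∃ a : Fin 3 → k, a ⬝ᵥ u = 0 ∧ eval a p ≠ 0

lemma eval_linForm {k : Type} [Field k] (c a : Fin 3 → k) : eval a (linForm c) = c ⬝ᵥ a := by
  simp [linForm, dotProduct]

lemma exists_eval_ne {k : Type} [Field k] [Infinite k] {p : MvPolynomial (Fin 3) k} (hp : p ≠ 0)
    {c : Fin 3 → k} (hc : c ≠ 0) : ∃ a : Fin 3 → k, eval a p ≠ 0 ∧ c ⬝ᵥ a ≠ 0 := by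
  have hl : linForm c ≠ 0 := by
    intro h
    apply hc
    funext i
    have := congrArg (eval (Pi.single i 1)) h
    rw [eval_linForm] at this
    simpa using this
  by_contra! hcon
  apply mul_ne_zero hp hl
  apply MvPolynomial.funext
  intro a
  rw [map_mul, map_zero, eval_linForm]
  by_cases h : eval a p = 0
  · rw [h, zero_mul]
  · rw [hcon a h, mul_zero]

/-- The restriction of `p` to the parametrised line `a + t b`. -/
noncomputable def restr {k : Type} [Field k] (p : MvPolynomial (Fin 3) k) (a b : Fin 3 → k) :
    Polynomial k :=
  aeval (fun i => Polynomial.C (a i) + Polynomial.C (b i) * Polynomial.X) p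

lemma restr_eval {k : Type} [Field k] (p : MvPolynomial (Fin 3) k) (a b : Fin 3 → k) (t : k) :
    (restr p a b).eval t = eval (a + t • b) p := by
  have h : ((Polynomial.aeval t).comp (aeval (fun i => Polynomial.C (a i) +
      Polynomial.C (b i) * Polynomial.X) : MvPolynomial (Fin 3) k →ₐ[k] Polynomial k)) =
      aeval (a + t • b) := by
    apply MvPolynomial.algHom_ext
    intro i
    simp; ring
  have := DFunLike.congr_fun h p
  simpa [restr, aeval_eq_eval, Polynomial.aeval_def, Polynomial.eval₂_eq_eval_map] using this

lemma bad_finite {k : Type} [Field k] [Infinite k] {p : MvPolynomial (Fin 3) k} (hp : p ≠ 0) :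
    ∃ B : Finset (Fin 3 → k), (∀ b ∈ B, b ≠ 0) ∧
      ∀ u, u ≠ 0 → ¬ GoodFor p u → ∃ b ∈ B, ¬ LinearIndependent k ![b, u] := by
  classical
  obtain ⟨a, ha, ha0⟩ := exists_eval_ne hp (c := ![1, 0, 0]) (by intro h; simpa using congrFun h 0)
  obtain ⟨v, hv, hv0⟩ := exists_eval_ne hp (c := ![-a 1, a 0, 0]) (by
    intro h
    have := congrFun h 1
    simp at this
    exact ha0 (by simp [dotProduct, Fin.sum_univ_three, this]))
  obtain ⟨w, hw, hw0⟩ := exists_eval_ne hp (c := crossProduct a v) (by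
    intro h
    have := congrFun h 2
    simp [cross_apply] at this
    exact hv0 (by simp [dotProduct, Fin.sum_univ_three]; linear_combination this))
  refine ⟨(((restr p a v).roots.toFinset ×ˢ (restr p a w).roots.toFinset).image
    (fun x => crossProduct (a + x.1 • v) (a + x.2 • w))).filter (· ≠ 0),
    fun b hb => (Finset.mem_filter.1 hb).2, ?_⟩
  intro u hu hbad
  have hbad' : ∀ x : Fin 3 → k, x ⬝ᵥ u = 0 → eval x p = 0 := by
    intro x hx
    by_contra h
    exact hbad ⟨x, hx, h⟩
  have key : ∀ y : Fin 3 → k, eval y p ≠ 0 → ∃ t, t ≠ 0 ∧ (a + t • y) ⬝ᵥ u = 0 ∧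
      t ∈ (restr p a y).roots.toFinset := by
    intro y hy
    have h1 : a ⬝ᵥ u ≠ 0 := fun h => ha (hbad' _ h)
    have h2 : y ⬝ᵥ u ≠ 0 := fun h => hy (hbad' _ h)
    have h3 : (a + (-(a ⬝ᵥ u) / (y ⬝ᵥ u)) • y) ⬝ᵥ u = 0 := by
      rw [add_dotProduct, smul_dotProduct, smul_eq_mul]; field_simp; ring
    refine ⟨-(a ⬝ᵥ u) / (y ⬝ᵥ u), div_ne_zero (neg_ne_zero.2 h1) h2, h3, ?_⟩
    rw [Multiset.mem_toFinset, Polynomial.mem_roots, Polynomial.IsRoot, restr_eval]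
    · exact hbad' _ h3
    · intro h0
      have := restr_eval p a y 0
      rw [h0] at this
      simp at this
      exact ha this.symm
  obtain ⟨t, ht, htu, htr⟩ := key v hv
  obtain ⟨s, hs, hsu, hsr⟩ := key w hw
  refine ⟨crossProduct (a + t • v) (a + s • w), Finset.mem_filter.2
    ⟨Finset.mem_image.2 ⟨(t, s), Finset.mem_product.2 ⟨htr, hsr⟩, rfl⟩, ?_⟩, ?_⟩
  · intro h
    have e : crossProduct (a + t • v) (a + s • w) ⬝ᵥ w = -t * (crossProduct a v ⬝ᵥ w) := by
      simp [cross_apply, dotProduct, Fin.sum_univ_three]; ring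
    rw [h, zero_dotProduct] at e
    rcases mul_eq_zero.1 e.symm with h | h
    · exact ht (by simpa using h)
    · exact hw0 h
  · rw [← crossProduct_ne_zero_iff_linearIndependent, not_not, cross_cross_eq_smul_sub_smul]
    rw [htu, hsu]; simp

lemma exists_pair {k : Type} [Field k] [IsAlgClosed k] [CharZero k] {T : Tri k}
    (hT : GoodTri T) (hT0 : T ≠ 0) {p : MvPolynomial (Fin 3) k} (hp : p ≠ 0) :
    ∃ u v, LinearIndependent k ![u, v] ∧ T u v = 0 ∧ GoodFor p u ∧ GoodFor p v := by
  classical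
  have : Infinite k := IsAlgClosed.instInfinite
  obtain ⟨B, hB0, hB⟩ := bad_finite hp
  have hκ : ∀ b : Fin 3 → k, ∃ c, (b ≠ 0 → c ≠ 0) ∧
      ∀ u, b ≠ 0 → u ≠ 0 → T b u = 0 → ¬ LinearIndependent k ![c, u] := by
    intro b
    by_cases h : ∃ c, c ≠ 0 ∧ T b c = 0
    · obtain ⟨c, hc, hbc⟩ := h
      exact ⟨c, fun _ => hc, fun u hb hu h => hT.ker_unique hT0 hb hbc h⟩
    · exact ⟨b, id, fun u _ hu h' => absurd ⟨u, hu, h'⟩ h⟩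
  choose κ hκ0 hκ using hκ
  by_contra! hcon
  -- all degenerate polars outside a finite set come from singular points
  have sing : ∀ B' : Finset (Fin 3 → k), (∀ b ∈ B', b ≠ 0) → ∃ u, u ≠ 0 ∧ T u u = 0 ∧
      ∀ b ∈ B', LinearIndependent k ![b, u] := by
    intro B' hB'
    obtain ⟨u, v, hu, hv, huv, hi⟩ := exists_hess T (B' ∪ (B ∪ B.image κ)) (by
      intro b hb
      simp only [Finset.mem_union, Finset.mem_image] at hb
      rcases hb with hb | hb | ⟨c, hc, rfl⟩
      · exact hB' b hb
      · exact hB0 b hb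
      · exact hκ0 c (hB0 c hc))
    refine ⟨u, hu, ?_, fun b hb => hi b (by simp [hb])⟩
    have gu : GoodFor p u := by
      by_contra h
      obtain ⟨b, hb, hbu⟩ := hB u hu h
      exact hbu (hi b (by simp [hb]))
    have gv : GoodFor p v := by
      by_contra h
      obtain ⟨b, hb, hbv⟩ := hB v hv h
      have hb0 := hB0 b hb
      rw [LinearIndependent.pair_iff' hb0] at hbv
      push Not at hbv
      obtain ⟨a, ha⟩ := hbv
      have ha0 : a ≠ 0 := by rintro rfl; exact hv (by rw [← ha]; simp)
      refine hκ b u hb0 hu ?_ (hi (κ b) (by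
        simp only [Finset.mem_union, Finset.mem_image]; exact Or.inr (Or.inr ⟨b, hb, rfl⟩)))
      have := hT.comm0 huv
      rw [← ha, map_smul, LinearMap.smul_apply] at this
      exact (smul_eq_zero.1 this).resolve_left ha0
    have hd : ¬ LinearIndependent k ![v, u] := by
      intro h
      exact hcon u v (indep_symm h) huv gu gv
    rw [LinearIndependent.pair_iff' hv] at hd
    push Not at hd
    obtain ⟨a, ha⟩ := hd
    rw [← ha, map_smul, ha, huv, smul_zero]
  obtain ⟨s₁, h₁, t₁, -⟩ := sing ∅ (by simp)
  obtain ⟨s₂, h₂, t₂, i₂⟩ := sing {s₁} (by simpa using h₁)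
  have i12 := i₂ s₁ (by simp)
  obtain ⟨s₃, h₃, t₃, i₃⟩ := sing {s₁, s₂} (by simp [h₁, h₂])
  have i13 := i₃ s₁ (by simp)
  have i23 := i₃ s₂ (by simp)
  obtain ⟨s₄, h₄, t₄, i₄⟩ := sing {s₁, s₂, s₃} (by simp [h₁, h₂, h₃])
  have i14 := i₄ s₁ (by simp)
  have i24 := i₄ s₂ (by simp)
  have i34 := i₄ s₃ (by simp)
  -- two singular points have nonzero mutual polar
  have n12 : T s₁ s₂ ≠ 0 := fun h => hT.ker_unique hT0 h₁ t₁ h i12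
  have s21 : T s₂ s₁ = T s₁ s₂ := LinearMap.ext fun w => hT.s12 _ _ _
  have s31 : T s₃ s₁ = T s₁ s₃ := LinearMap.ext fun w => hT.s12 _ _ _
  have s32 : T s₃ s₂ = T s₂ s₃ := LinearMap.ext fun w => hT.s12 _ _ _
  have li : LinearIndependent k ![s₁, s₂, s₃] := by
    rw [LinearIndependent.pair_iff] at i13 i23
    rw [Fintype.linearIndependent_iff]
    intro g hg
    rw [Fin.sum_univ_three] at hg
    simp at hg
    by_cases g2 : g 2 = 0
    · rw [g2, zero_smul, add_zero] at hg
      obtain ⟨a, b⟩ := LinearIndependent.pair_iff.1 i12 _ _ hg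
      intro i; fin_cases i <;> assumption
    · exfalso
      have e : g 2 • s₃ = -(g 0 • s₁ + g 1 • s₂) := by
        rw [eq_neg_iff_add_eq_zero, add_comm]; exact hg
      have q : T (g 2 • s₃) (g 2 • s₃) = 0 := by simp [t₃]
      rw [e] at q
      simp [t₁, t₂, s21] at q
      have q' : (2 * g 0 * g 1) • T s₁ s₂ = 0 := by rw [← q]; module
      rcases smul_eq_zero.1 q' with h | h
      · simp at h
        rcases h with h | h
        · rw [h] at hg
          exact g2 (i23 (g 1) (g 2) (by simpa using hg)).2
        · rw [h] at hg
          exact g2 (i13 (g 0) (g 2) (by simpa using hg)).2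
      · exact n12 h
  let b := basisOfLinearIndependentOfCardEqFinrank li (by simp)
  have b0 : b 0 = s₁ := by simp [b]
  have b1 : b 1 = s₂ := by simp [b]
  have b2 : b 2 = s₃ := by simp [b]
  have hs₄ := basis_expand b s₄
  rw [b0, b1, b2] at hs₄
  generalize b.coord 0 s₄ = α, b.coord 1 s₄ = β, b.coord 2 s₄ = γ at hs₄
  have r1 : ∀ w, T s₁ w s₁ = 0 := fun w => by rw [hT.s23, t₁]; rfl
  have r2 : ∀ w, T s₂ w s₂ = 0 := fun w => by rw [hT.s23, t₂]; rfl
  have r3 : ∀ w, T s₃ w s₃ = 0 := fun w => by rw [hT.s23, t₃]; rfl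
  have t123 : T s₁ s₂ s₃ ≠ 0 := by
    intro h
    apply n12
    apply b.ext
    intro i
    fin_cases i
    · simpa [b0] using r1 s₂
    · rw [← s21]; simpa [b1] using r2 s₁
    · simpa [b2] using h
  have c1 : T s₁ s₃ s₂ = T s₁ s₂ s₃ := hT.s23 _ _ _
  have c2 : T s₂ s₃ s₁ = T s₁ s₂ s₃ := by rw [hT.s23, s21]
  have u1 : T s₁ s₂ s₁ = 0 := r1 _
  have u2 : T s₁ s₃ s₁ = 0 := r1 _
  have u3 : T s₁ s₂ s₂ = 0 := by rw [← s21]; exact r2 _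
  have u4 : T s₂ s₃ s₂ = 0 := r2 _
  have u5 : T s₂ s₃ s₃ = 0 := by rw [← s32]; exact r3 _
  have u6 : T s₁ s₃ s₃ = 0 := by rw [← s31]; exact r3 _
  have e1 := DFunLike.congr_fun t₄ s₁
  have e2 := DFunLike.congr_fun t₄ s₂
  have e3 := DFunLike.congr_fun t₄ s₃
  rw [hs₄] at e1 e2 e3
  simp [t₁, t₂, t₃, s21, s31, s32, c1, c2, u1, u2, u3, u4, u5, u6] at e1 e2 e3
  have f1 : (2 * β * γ) * T s₁ s₂ s₃ = 0 := by linear_combination e1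
  have f2 : (2 * α * γ) * T s₁ s₂ s₃ = 0 := by linear_combination e2
  have f3 : (2 * α * β) * T s₁ s₂ s₃ = 0 := by linear_combination e3
  simp [t123] at f1 f2 f3
  rw [LinearIndependent.pair_iff] at i14 i24 i34
  by_cases hα : α = 0
  · by_cases hβ : β = 0
    · have := i34 γ (-1) (by rw [hs₄, hα, hβ]; module)
      simp at this
    · have hγ : γ = 0 := f1.resolve_left hβ
      have := i24 β (-1) (by rw [hs₄, hα, hγ]; module)
      simp at this
  · have hβ : β = 0 := f3.resolve_left hα
    have hγ : γ = 0 := f2.resolve_left hα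
    have := i14 α (-1) (by rw [hs₄, hβ, hγ]; module)
    simp at this

lemma hom_eval {k : Type} [Field k] {p : MvPolynomial (Fin 3) k} {e : ℕ} (hp : p.IsHomogeneous e)
    (c : k) (a : Fin 3 → k) : eval (c • a) p = c ^ e * eval a p := by
  rw [eval_eq, eval_eq, Finset.mul_sum]
  refine Finset.sum_congr rfl fun d hd => ?_
  have h1 : ∑ i ∈ d.support, d i = e := by
    have := hp (mem_support_iff.1 hd)
    rw [Finsupp.weight_apply, Finsupp.sum] at this
    simpa using this
  simp only [Pi.smul_apply, smul_eq_mul, mul_pow, Finset.prod_mul_distrib, Finset.prod_pow_eq_pow_sum]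
  rw [h1]; ring

lemma restr_ne_zero {k : Type} [Field k] [Infinite k] {p : MvPolynomial (Fin 3) k} {e : ℕ}
    (hp : p.IsHomogeneous e) (A B : Fin 3 → k) (s t : k) (h : eval (s • A + t • B) p ≠ 0) :
    restr p A B ≠ 0 := by
  have h1 : restr p (t • B) A * Polynomial.X ≠ 0 := by
    refine mul_ne_zero ?_ Polynomial.X_ne_zero
    intro h0
    have := restr_eval p (t • B) A s
    rw [h0, add_comm] at this
    exact h (by simpa using this.symm)
  obtain ⟨l, hl⟩ : ∃ l, (restr p (t • B) A * Polynomial.X).eval l ≠ 0 := by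
    by_contra! hcon
    exact h1 (Polynomial.funext fun r => by rw [hcon, Polynomial.eval_zero])
  rw [Polynomial.eval_mul, Polynomial.eval_X, restr_eval] at hl
  have hl0 : l ≠ 0 := right_ne_zero_of_mul hl
  have e1 : t • B + l • A = l • (A + (t / l) • B) := by
    rw [smul_add, smul_smul, mul_div_cancel₀ _ hl0, add_comm]
  rw [e1, hom_eval hp] at hl
  intro h0
  have := restr_eval p A B (t / l)
  rw [h0] at this
  simp at this
  rw [← this] at hl
  simp at hl

/-- If `b 0`, `b 1` are conjugate, the polar of `b 0` is nondegenerate on `b 0`, `b 2`. -/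
lemma GoodTri.nondeg {k : Type} [Field k] [IsAlgClosed k] [CharZero k] {T : Tri k}
    (hT : GoodTri T) (hT0 : T ≠ 0) {u v w : Fin 3 → k} (b : Module.Basis (Fin 3) k (Fin 3 → k))
    (i j l : Fin 3) (hij : i ≠ j) (hil : i ≠ l) (hjl : j ≠ l)
    (hu : b i = u) (hv : b j = v) (hw : b l = w) (h : T u v = 0) :
    T u u u * T u w w - T u u w ^ 2 ≠ 0 := by
  subst hu hv hw
  intro h0
  obtain ⟨x, y, hxy, h1, h2⟩ := exists_ker_two (T (b i) (b i) (b i)) (T (b i) (b i) (b l))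
    (T (b i) (b l) (b l)) (by linear_combination h0)
  have hk : T (b i) (x • b i + y • b l) = 0 := by
    apply b.ext
    intro m
    have hm : m = i ∨ m = j ∨ m = l := by omega
    rcases hm with rfl | rfl | rfl
    · have := hT.s23 (b m) (b l) (b m)
      simp [this]
      linear_combination h1
    · rw [hT.s23, h]; rfl
    · simp
      linear_combination h2
  refine hT.ker_unique hT0 (b.ne_zero i) h hk ?_
  rw [LinearIndependent.pair_iff]
  intro s t hst
  have e0 := congrArg (b.coord i) hst
  have e1 := congrArg (b.coord j) hst
  have e2 := congrArg (b.coord l) hst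
  simp [hij, hij.symm, hil, hil.symm, hjl, hjl.symm] at e0 e1 e2
  refine ⟨e1, ?_⟩
  rcases hxy with hx | hy
  · exact e0.resolve_right hx
  · exact e2.resolve_right hy

theorem core {k : Type} [Field k] [IsAlgClosed k] [CharZero k] {T : Tri k}
    (hT : GoodTri T) (hT0 : T ≠ 0) {p : MvPolynomial (Fin 3) k} {e : ℕ} (hp : p.IsHomogeneous e)
    (hp0 : p ≠ 0) :
    ∃ l : Fin 4 → (Fin 3 → k), (∀ i, eval (l i) p ≠ 0) ∧
      ∀ u v w, T u v w = ∑ i, (l i ⬝ᵥ u) * (l i ⬝ᵥ v) * (l i ⬝ᵥ w) := by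
  classical
  have : Infinite k := IsAlgClosed.instInfinite
  obtain ⟨u₁, u₂, hi, h12, ⟨a₁, ha₁, pa₁⟩, ⟨a₂, ha₂, pa₂⟩⟩ := exists_pair hT hT0 hp0
  obtain ⟨b, rfl, rfl⟩ := exists_basis_pair hi
  have h21 := hT.comm0 h12
  let E : Fin 3 → Fin 3 → k := fun i j => b.coord i (Pi.single j 1)
  have hE : ∀ i u, E i ⬝ᵥ u = b.coord i u := by
    intro i u
    conv_rhs => rw [pi_eq_sum_univ' u]
    rw [map_sum]
    refine Finset.sum_congr rfl fun j _ => ?_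
    rw [map_smul, smul_eq_mul, mul_comm]
  have hexp : ∀ a : Fin 3 → k, a = (a ⬝ᵥ b 0) • E 0 + (a ⬝ᵥ b 1) • E 1 + (a ⬝ᵥ b 2) • E 2 := by
    intro a
    apply dotProduct_eq
    intro u
    simp only [add_dotProduct, smul_dotProduct, hE]
    conv_lhs => rw [basis_expand b u]
    simp only [dotProduct_add, dotProduct_smul, smul_eq_mul]
    ring
  have g0 : restr p (E 0) (E 2) ≠ 0 := by
    refine restr_ne_zero hp _ _ (a₂ ⬝ᵥ b 0) (a₂ ⬝ᵥ b 2) ?_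
    have := hexp a₂
    rw [ha₂, zero_smul, add_zero] at this
    rwa [← this]
  have g1 : restr p (E 1) (E 2) ≠ 0 := by
    refine restr_ne_zero hp _ _ (a₁ ⬝ᵥ b 1) (a₁ ⬝ᵥ b 2) ?_
    have := hexp a₁
    rw [ha₁, zero_smul, zero_add] at this
    rwa [← this]
  obtain ⟨E₀, fE₀, hE₀⟩ := binary_cubic _ _ _
    (hT.nondeg hT0 b 0 1 2 (by decide) (by decide) (by decide) rfl rfl rfl h12) _ g0
  obtain ⟨E₁, fE₁, hE₁⟩ := binary_cubic _ _ _
    (hT.nondeg hT0 b 1 0 2 (by decide) (by decide) (by decide) rfl rfl rfl h21) _ g1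
  obtain ⟨c, hc⟩ : ∃ c, c ∉ E₀ ∪ (fun c => T (b 2) (b 2) (b 2) - c) '' E₁ :=
    (fE₀.union (fE₁.image _)).infinite_compl.nonempty
  simp only [Set.mem_union, not_or] at hc
  obtain ⟨hc0, hc1⟩ := hc
  obtain ⟨s₁, τ₁, s₂, τ₂, n1, n2, p1, p2, eq1, eq2, eq3, eq4⟩ := hE₀ c hc0
  obtain ⟨s₃, τ₃, s₄, τ₄, n3, n4, p3, p4, eq5, eq6, eq7, eq8⟩ :=
    hE₁ (T (b 2) (b 2) (b 2) - c) (fun h => hc1 ⟨_, h, by ring⟩)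
  rw [restr_eval] at p1 p2 p3 p4
  refine ⟨![s₁ • (E 0 + τ₁ • E 2), s₂ • (E 0 + τ₂ • E 2), s₃ • (E 1 + τ₃ • E 2),
    s₄ • (E 1 + τ₄ • E 2)], ?_, ?_⟩
  · have hs : ∀ (s : k) (a : Fin 3 → k), s ≠ 0 → eval a p ≠ 0 → eval (s • a) p ≠ 0 := by
      intro s a h1 h2
      rw [hom_eval hp]
      exact mul_ne_zero (pow_ne_zero _ h1) h2
    intro i
    fin_cases i
    · exact hs _ _ n1 p1
    · exact hs _ _ n2 p2
    · exact hs _ _ n3 p3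
    · exact hs _ _ n4 p4
  · intro u v w
    have eγ : T (b 2) (b 2) (b 2) = s₁ ^ 3 * τ₁ ^ 3 + s₂ ^ 3 * τ₂ ^ 3 +
        (s₃ ^ 3 * τ₃ ^ 3 + s₄ ^ 3 * τ₄ ^ 3) := by rw [← eq4, ← eq8]; ring
    have z1 : T (b 0) (b 2) (b 1) = 0 := by rw [hT.s23, h12]; rfl
    have z2 : T (b 1) (b 2) (b 0) = 0 := by rw [hT.s23, h21]; rfl
    have z3 : T (b 2) (b 0) (b 1) = 0 := by rw [hT.s12, z1]
    have z4 : T (b 2) (b 1) (b 0) = 0 := by rw [hT.s12, z2]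
    have z5 : T (b 0) (b 0) (b 1) = 0 := by rw [hT.s23, h12]; rfl
    have z6 : T (b 1) (b 1) (b 0) = 0 := by rw [hT.s23, h21]; rfl
    have y1 : T (b 0) (b 2) (b 0) = T (b 0) (b 0) (b 2) := hT.s23 _ _ _
    have y2 : T (b 2) (b 0) (b 0) = T (b 0) (b 0) (b 2) := by rw [hT.s12, y1]
    have y3 : T (b 2) (b 0) (b 2) = T (b 0) (b 2) (b 2) := hT.s12 _ _ _
    have y4 : T (b 2) (b 2) (b 0) = T (b 0) (b 2) (b 2) := by rw [hT.s23, y3]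
    have x1 : T (b 1) (b 2) (b 1) = T (b 1) (b 1) (b 2) := hT.s23 _ _ _
    have x2 : T (b 2) (b 1) (b 1) = T (b 1) (b 1) (b 2) := by rw [hT.s12, x1]
    have x3 : T (b 2) (b 1) (b 2) = T (b 1) (b 2) (b 2) := hT.s12 _ _ _
    have x4 : T (b 2) (b 2) (b 1) = T (b 1) (b 2) (b 2) := by rw [hT.s23, x3]
    conv_lhs => rw [basis_expand b u, basis_expand b v, basis_expand b w]
    simp only [map_add, map_smul, LinearMap.add_apply, LinearMap.smul_apply, h12, h21, z1, z2, z3,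
      z4, z5, z6, y1, y2, y3, y4, x1, x2, x3, x4, LinearMap.zero_apply, smul_eq_mul]
    rw [eq1, eq2, eq3, eq5, eq6, eq7, eγ]
    simp only [Fin.sum_univ_four, Matrix.cons_val, smul_dotProduct, add_dotProduct, hE, smul_eq_mul]
    ring

lemma pderiv_comm' {k : Type} [Field k] (i j : Fin 3) (F : MvPolynomial (Fin 3) k) :
    pderiv i (pderiv j F) = pderiv j (pderiv i F) := by
  have h : ⁅pderiv (R := k) i, pderiv (R := k) j⁆ = 0 := by
    apply MvPolynomial.derivation_ext
    intro m
    rw [Derivation.commutator_apply]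
    simp [pderiv_X, Pi.single_apply, apply_ite]
  have := DFunLike.congr_fun h F
  rw [Derivation.commutator_apply] at this
  exact sub_eq_zero.1 this

/-- The contraction by `D` as a linear map. -/
noncomputable def contrLin {k : Type} [Field k] (D : MvPolynomial (Fin 3) k) :
    Module.End k (MvPolynomial (Fin 3) k) :=
  ∑ s ∈ D.support, D.coeff s • ((pderiv (R := k) (0 : Fin 3)).toLinearMap ^ s 0 *
    ((pderiv (R := k) (1 : Fin 3)).toLinearMap ^ s 1 *
      (pderiv (R := k) (2 : Fin 3)).toLinearMap ^ s 2) : Module.End k (MvPolynomial (Fin 3) k))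

lemma contract_eq {k : Type} [Field k] (D F : MvPolynomial (Fin 3) k) :
    contract D F = contrLin D F := by
  unfold contract contrLin
  rw [LinearMap.sum_apply]
  refine Finset.sum_congr rfl fun s _ => ?_
  rw [LinearMap.smul_apply, Module.End.mul_apply, Module.End.mul_apply, Module.End.pow_apply,
    Module.End.pow_apply, Module.End.pow_apply]
  rfl

lemma contrLin_comm {k : Type} [Field k] (D : MvPolynomial (Fin 3) k) (i : Fin 3)
    (G : MvPolynomial (Fin 3) k) : contrLin D (pderiv i G) = pderiv i (contrLin D G) := by
  have hc : ∀ j : Fin 3, Commute ((pderiv (R := k) j).toLinearMap : Module.End k _)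
      ((pderiv (R := k) i).toLinearMap) := fun j => LinearMap.ext fun G => pderiv_comm' _ _ _
  have : Commute (contrLin D) ((pderiv (R := k) i).toLinearMap) := by
    unfold contrLin
    refine Commute.sum_left _ _ _ fun s _ => ?_
    exact (((hc 0).pow_left _).mul_left (((hc 1).pow_left _).mul_left
      ((hc 2).pow_left _))).smul_left _
  exact DFunLike.congr_fun this.eq G

lemma pderiv_linForm {k : Type} [Field k] (a : Fin 3 → k) (i : Fin 3) :
    pderiv i (linForm a) = C (a i) := by
  simp [linForm, pderiv_X, Pi.single_apply]

lemma contrLin_sq {k : Type} [Field k] (D : MvPolynomial (Fin 3) k) (hD : D.IsHomogeneous 2)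
    (a : Fin 3 → k) : contrLin D (linForm a ^ 2) = C (2 * eval a D) := by
  have h1 : ∀ i, pderiv i (linForm a ^ 2) = C (2 * a i) * linForm a := by
    intro i
    rw [pow_two, pderiv_mul, pderiv_linForm, map_mul, map_ofNat]; ring
  rw [eval_eq', Finset.mul_sum, map_sum]
  unfold contrLin
  rw [LinearMap.sum_apply]
  refine Finset.sum_congr rfl fun s hs => ?_
  rw [LinearMap.smul_apply, Module.End.mul_apply, Module.End.mul_apply, Module.End.pow_apply,
    Module.End.pow_apply, Module.End.pow_apply, Fin.prod_univ_three]
  have hs2 : s 0 + s 1 + s 2 = 2 := by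
    have := hD (mem_support_iff.1 hs)
    rw [Finsupp.weight_apply, Finsupp.sum_fintype _ _ (by simp), Fin.sum_univ_three] at this
    simpa using this
  generalize coeff s D = c
  generalize s 0 = x, s 1 = y, s 2 = z at *
  have hx : x ≤ 2 := by omega
  have hy : y ≤ 2 := by omega
  obtain rfl : z = 2 - x - y := by omega
  interval_cases x <;> interval_cases y <;> first | omega | skip
  all_goals (simp [h1, pderiv_linForm, smul_eq_C_mul]; try ring)

/-- The symmetric tensor of a cubic form. -/
noncomputable def tens {k : Type} [Field k] (F : MvPolynomial (Fin 3) k) (i j l : Fin 3) : k :=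
  coeff 0 (pderiv i (pderiv j (pderiv l F))) / 6

lemma tens_two {k : Type} [Field k] [CharZero k] {F : MvPolynomial (Fin 3) k}
    (hF : F.IsHomogeneous 3) (i : Fin 3) :
    pderiv i F = 3 * ∑ j, ∑ l, C (tens F l j i) * (X j * X l) := by
  have h1 : (pderiv i F).IsHomogeneous 2 := hF.pderiv
  have h2 : ∀ j, (pderiv j (pderiv i F)).IsHomogeneous 1 := fun j => h1.pderiv
  have h3 : ∀ l j, (pderiv l (pderiv j (pderiv i F))).IsHomogeneous 0 := fun l j => (h2 j).pderiv
  have h4 : ∀ l j, pderiv l (pderiv j (pderiv i F)) = C (6 * tens F l j i) := by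
    intro l j
    have := totalDegree_eq_zero_iff_eq_C.1 ((totalDegree_zero_iff_isHomogeneous _).2 (h3 l j))
    rw [this, tens, mul_div_cancel₀ _ (by norm_num)]
  have e1 := h1.sum_X_mul_pderiv
  have e2 := fun j => (h2 j).sum_X_mul_pderiv
  simp only [h4, one_smul] at e2
  simp only [← e2] at e1
  have h20 : (2 : MvPolynomial (Fin 3) k) ≠ 0 := two_ne_zero
  apply mul_left_cancel₀ h20
  rw [nsmul_eq_mul] at e1
  rw [show ((2 : ℕ) : MvPolynomial (Fin 3) k) = 2 by norm_num] at e1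
  rw [← e1, ← mul_assoc, Finset.mul_sum]
  refine Finset.sum_congr rfl fun j _ => ?_
  rw [Finset.mul_sum, Finset.mul_sum]
  refine Finset.sum_congr rfl fun l _ => ?_
  rw [map_mul, map_ofNat]
  ring

lemma tens_three {k : Type} [Field k] [CharZero k] {F : MvPolynomial (Fin 3) k}
    (hF : F.IsHomogeneous 3) :
    F = ∑ i, ∑ j, ∑ l, C (tens F l j i) * (X i * X j * X l) := by
  have e := hF.sum_X_mul_pderiv
  have h20 : (3 : MvPolynomial (Fin 3) k) ≠ 0 := by
    exact_mod_cast (Nat.cast_ne_zero (R := MvPolynomial (Fin 3) k)).2 (by norm_num : (3:ℕ) ≠ 0)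
  apply mul_left_cancel₀ h20
  rw [nsmul_eq_mul] at e
  rw [show ((3 : ℕ) : MvPolynomial (Fin 3) k) = 3 by norm_num] at e
  rw [← e, Finset.mul_sum]
  refine Finset.sum_congr rfl fun i _ => ?_
  rw [tens_two hF, ← mul_assoc, Finset.mul_sum, Finset.mul_sum]
  refine Finset.sum_congr rfl fun j _ => ?_
  rw [Finset.mul_sum, Finset.mul_sum]
  refine Finset.sum_congr rfl fun l _ => ?_
  ring

lemma linForm_cube {k : Type} [Field k] (a : Fin 3 → k) :
    linForm a ^ 3 = ∑ i, ∑ j, ∑ l, C (a l * a j * a i) * (X i * X j * X l) := by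
  simp only [linForm, Fin.sum_univ_three, map_mul]
  ring

lemma linForm_sq {k : Type} [Field k] (a : Fin 3 → k) :
    linForm a ^ 2 = ∑ j, ∑ l, C (a l * a j) * (X j * X l) := by
  simp only [linForm, Fin.sum_univ_three, map_mul]
  ring

/-- The trilinear form of a cubic form. -/
noncomputable def tri {k : Type} [Field k] (F : MvPolynomial (Fin 3) k) : Tri k :=
  ∑ i, ∑ j, ∑ l, (LinearMap.proj i : (Fin 3 → k) →ₗ[k] k).smulRight
    ((LinearMap.proj j : (Fin 3 → k) →ₗ[k] k).smulRight
      (tens F i j l • (LinearMap.proj l : (Fin 3 → k) →ₗ[k] k)))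

lemma tri_apply {k : Type} [Field k] (F : MvPolynomial (Fin 3) k) (u v w : Fin 3 → k) :
    tri F u v w = ∑ i, ∑ j, ∑ l, u i * (v j * (tens F i j l * w l)) := by
  simp [tri, LinearMap.sum_apply]

lemma tri_single {k : Type} [Field k] (F : MvPolynomial (Fin 3) k) (i j l : Fin 3) :
    tri F (Pi.single i 1) (Pi.single j 1) (Pi.single l 1) = tens F i j l := by
  rw [tri_apply, Finset.sum_eq_single i, Finset.sum_eq_single j, Finset.sum_eq_single l] <;>
    simp +contextual [Pi.single_apply]

lemma tri_good {k : Type} [Field k] [CharZero k] {F : MvPolynomial (Fin 3) k}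
    (hF : F.IsHomogeneous 3)
    (hnobp : ∀ a : Fin 3 → k, a ≠ 0 →
      ∃ D : MvPolynomial (Fin 3) k, D.IsHomogeneous 2 ∧ contract D F = 0 ∧ eval a D ≠ 0) :
    GoodTri (tri F) := by
  have t12 : ∀ i j l, tens F i j l = tens F j i l := by
    intro i j l
    rw [tens, tens, pderiv_comm']
  have t23 : ∀ i j l, tens F i j l = tens F i l j := by
    intro i j l
    rw [tens, tens, pderiv_comm' j l]
  refine ⟨fun u v w => ?_, fun u v w => ?_, fun u a h => ?_⟩
  · rw [tri_apply, tri_apply, Finset.sum_comm]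
    refine Finset.sum_congr rfl fun i _ => Finset.sum_congr rfl fun j _ =>
      Finset.sum_congr rfl fun l _ => ?_
    rw [t12]; ring
  · rw [tri_apply, tri_apply]
    refine Finset.sum_congr rfl fun i _ => ?_
    rw [Finset.sum_comm]
    refine Finset.sum_congr rfl fun j _ => Finset.sum_congr rfl fun l _ => ?_
    rw [t23]; ring
  · by_contra ha
    let b : Fin 3 → k := fun i => a (Pi.single i 1)
    have hb : b ≠ 0 := by
      intro hb
      apply ha
      apply LinearMap.pi_ext'
      intro i
      ext
      simpa using congrFun hb i
    obtain ⟨D, hD, hDF, hDb⟩ := hnobp b hb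
    rw [contract_eq] at hDF
    have e1 : ∀ j l, ∑ i, u i * tens F l j i = b l * b j := by
      intro j l
      have := h (Pi.single l 1) (Pi.single j 1)
      rw [← show b l * b j = _ from rfl] at *
      rw [← this, tri_apply]
      refine Finset.sum_congr rfl fun i _ => ?_
      rw [Finset.sum_eq_single l, Finset.sum_eq_single j]
      · simp
        rw [t12 i l j, t23 l i j]
        simp
      all_goals simp +contextual [Pi.single_apply]
    have e2 : ∑ i, u i • pderiv i F = (3 : k) • linForm b ^ 2 := by
      rw [linForm_sq]
      simp only [← e1, tens_two hF, smul_eq_C_mul, map_ofNat, Fin.sum_univ_three, map_add, map_mul]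
      ring
    have e3 : contrLin D (∑ i, u i • pderiv i F) = 0 := by
      rw [map_sum]
      refine Finset.sum_eq_zero fun i _ => ?_
      rw [map_smul, contrLin_comm, hDF, map_zero, smul_zero]
    rw [e2, map_smul, contrLin_sq D hD, smul_eq_C_mul, ← map_mul, C_eq_zero] at e3
    simp at e3
    exact hDb e3


/-- If `F` is a ternary cubic with `V((F^⊥)₂) = ∅` in `ℙ(S₁)`, then for every homogeneous
Zariski-closed proper subset `V ⊊ S₁`, `F` is a sum of at most `4` cubes of linear forms
avoiding `V`. -/
theorem stmt_14 (k : Type) [Field k] [IsAlgClosed k] [CharZero k]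
    (F : MvPolynomial (Fin 3) k) (hF : F.IsHomogeneous 3)
    (hnobp : ∀ a : Fin 3 → k, a ≠ 0 →
      ∃ D : MvPolynomial (Fin 3) k, D.IsHomogeneous 2 ∧ contract D F = 0 ∧ eval a D ≠ 0)
    (V : Set (Fin 3 → k)) (hV : HomZariskiClosed V) (hVproper : V ≠ Set.univ) :
    ∃ m ≤ 4, ∃ l : Fin m → (Fin 3 → k),
      (∀ i, l i ∉ V) ∧ F = ∑ i, linForm (l i) ^ 3 := by
  classical
  have : Infinite k := IsAlgClosed.instInfinite
  obtain ⟨P, hP, rfl⟩ := hV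
  obtain ⟨p, hpP, hp0⟩ : ∃ p ∈ P, p ≠ 0 := by
    by_contra! hcon
    apply hVproper
    ext a
    simp only [Set.mem_univ, iff_true]
    intro p hp
    rw [hcon p hp, map_zero]
  obtain ⟨e, hpe⟩ := hP p hpP
  have hg := tri_good hF hnobp
  by_cases hT : tri F = 0
  · refine ⟨0, by norm_num, fun i => i.elim0, fun i => i.elim0, ?_⟩
    rw [tens_three hF]
    simp [← tri_single, hT]
  · obtain ⟨l, hl, hsum⟩ := core hg hT hpe hp0
    refine ⟨4, le_rfl, l, fun i hi => hl i (hi p hpP), ?_⟩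
    have ht : ∀ i j m, tens F m j i = ∑ n, l n m * l n j * l n i := by
      intro i j m
      rw [← tri_single, hsum]
      simp
    conv_lhs => rw [tens_three hF]
    simp only [ht, linForm_cube, Fin.sum_univ_four, map_add, add_mul, Finset.sum_add_distrib]
end
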